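/- arXiv:1706.03571 — 2 statements merged into one kernel-verified Lean document; each statement's English description precedes it below -/
import Mathlib

section
/- Let C ⊂ ℝ^d be a polyhedral convex cone, let A be a conic Borel set, let n ∈ ℕ and k ∈ {1, …, d}. Let S_n be the isotropic random Schläfli cone with parameter n. Then 𝔼 Φ_k(C ∩ S_n, A) = (1 / C(n,d)) · Σ_{s=0}^{min{n, d−k}} binom(n, s) · Φ_{k+s}(C, A), where C(n,d) = 2 Σ_{r=0}^{d−1} binom(n−1, r). -/
open MeasureTheory Set
open scoped ENNReal RealInnerProductSpace Pointwise

noncomputable section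

/-- Abbreviation for Euclidean space `ℝ^d`. -/
abbrev Euc (d : ℕ) := EuclideanSpace ℝ (Fin d)

/-- The rotation group `SO(d)`, as a subgroup of the orthogonal group. -/
def SOG (d : ℕ) : Subgroup (Matrix.orthogonalGroup (Fin d) ℝ) where
  carrier := {A | (A : Matrix (Fin d) (Fin d) ℝ).det = 1}
  one_mem' := Matrix.det_one
  mul_mem' := by
    intro a b ha hb
    simp only [Set.mem_setOf_eq] at *
    rw [show ((a * b : Matrix.orthogonalGroup (Fin d) ℝ) : Matrix (Fin d) (Fin d) ℝ)
        = (a : Matrix (Fin d) (Fin d) ℝ) * (b : Matrix (Fin d) (Fin d) ℝ) from rfl,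
      Matrix.det_mul, ha, hb, mul_one]
  inv_mem' := by
    intro a ha
    simp only [Set.mem_setOf_eq] at *
    rw [show ((a⁻¹ : Matrix.orthogonalGroup (Fin d) ℝ) : Matrix (Fin d) (Fin d) ℝ)
        = star (a : Matrix (Fin d) (Fin d) ℝ) from rfl]
    rw [Matrix.star_eq_conjTranspose, Matrix.det_conjTranspose, ha, star_one]

instance (d : ℕ) : MeasurableSpace (SOG d) := borel _

/-- A rotation `ϑ ∈ SO(d)`, as a linear map on `ℝ^d`. -/
def rotLin {d : ℕ} (ϑ : SOG d) : Euc d →ₗ[ℝ] Euc d :=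
  ((EuclideanSpace.equiv (Fin d) ℝ).symm.toLinearEquiv.toLinearMap.comp
    (Matrix.mulVecLin (ϑ : Matrix (Fin d) (Fin d) ℝ))).comp
    (EuclideanSpace.equiv (Fin d) ℝ).toLinearEquiv.toLinearMap

/-- The action of a rotation `ϑ ∈ SO(d)` on `ℝ^d`. -/
def rot {d : ℕ} (ϑ : SOG d) : Euc d → Euc d := rotLin ϑ

variable {d : ℕ}

/-- The standard Gaussian probability measure `γ_d` on `ℝ^d`. -/
def stdGauss (d : ℕ) : Measure (Euc d) :=
  volume.withDensity fun x =>
    ENNReal.ofReal ((2 * Real.pi) ^ (-(d : ℝ) / 2) * Real.exp (-‖x‖ ^ 2 / 2))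

/-- The standard Gaussian measure `γ_L` of a linear subspace `L` of `ℝ^d`, viewed as a measure
on `ℝ^d` concentrated on `L`. -/
def gauss (L : Submodule ℝ (Euc d)) : Measure (Euc d) :=
  Measure.map (Subtype.val) <|
    (volume : Measure L).withDensity fun x =>
      ENNReal.ofReal ((2 * Real.pi) ^ (-(Module.finrank ℝ L : ℝ) / 2) *
        Real.exp (-‖(x : Euc d)‖ ^ 2 / 2))

/-- A set is conic if it is stable under multiplication by positive scalars. -/
def IsConic (A : Set (Euc d)) : Prop := ∀ a ∈ A, ∀ r : ℝ, 0 < r → r • a ∈ A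

/-- A polyhedral (convex) cone: an intersection of finitely many closed halfspaces bounded by
linear hyperplanes (the empty intersection being all of `ℝ^d`). -/
def IsPolyCone (C : Set (Euc d)) : Prop :=
  ∃ U : Finset (Euc d), C = ⋂ u ∈ U, {x | ⟪u, x⟫ ≤ 0}

/-- `F` is a face of the convex set `C`: a nonempty convex extreme subset. -/
def IsFace (C F : Set (Euc d)) : Prop := IsExtreme ℝ C F ∧ Convex ℝ F ∧ F.Nonempty

/-- The linear hull `L(F)` of a set `F`. -/
def linHull (F : Set (Euc d)) : Submodule ℝ (Euc d) := Submodule.span ℝ F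

/-- The dimension of a face (or cone) `F`, i.e. the dimension of its linear hull. -/
def dimS (F : Set (Euc d)) : ℕ := Module.finrank ℝ (linHull F)

/-- `F` is a `k`-dimensional face of `C`. -/
def IsFaceDim (C F : Set (Euc d)) (k : ℕ) : Prop := IsFace C F ∧ dimS F = k

/-- The normal cone `N(C,F)` of the cone `C` at its face `F`. -/
def normalCone (C F : Set (Euc d)) : Set (Euc d) :=
  {u | (∀ y ∈ C, ⟪u, y⟫ ≤ 0) ∧ ∀ x ∈ F, ⟪u, x⟫ = 0}

/-- The conic curvature measure `Φ_k(C, A)` of a polyhedral cone `C`, evaluated at `A`: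
`Φ_k(C,A) = ∑_{F ∈ 𝓕_k(C)} γ_{L(F)}(F ∩ A) ⬝ γ_{L(F)^⊥}(N(C,F))`. -/
def Phi (k : ℕ) (C A : Set (Euc d)) : ℝ≥0∞ :=
  ∑' F : {F : Set (Euc d) // IsFaceDim C F k},
    gauss (linHull F.1) (F.1 ∩ A) * gauss (linHull F.1)ᗮ (normalCone C F.1)

/-- The conic intrinsic volume `V_k(C) = ∑_{F ∈ 𝓕_k(C)} γ_d(F + N(C,F))`. -/
def cV (k : ℕ) (C : Set (Euc d)) : ℝ≥0∞ :=
  ∑' F : {F : Set (Euc d) // IsFaceDim C F k},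
    stdGauss d (F.1 + normalCone C F.1)

/-- The localization `φ_F(C,A) = γ_d((A ∩ F) + N(C,F))` of `v_F(C)`. -/
def phiLoc (C F A : Set (Euc d)) : ℝ≥0∞ := stdGauss d ((A ∩ F) + normalCone C F)

/-- `C` is (the underlying set of) a linear subspace of `ℝ^d`. -/
def IsLinSubspace (C : Set (Euc d)) : Prop := ∃ L : Submodule ℝ (Euc d), (L : Set (Euc d)) = C

/-- Two polyhedral cones intersect transversely: `dim (F ∩ G) = dim F + dim G − d` and the
relative interiors meet. -/
def Transverse (F G : Set (Euc d)) : Prop :=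
  (dimS (F ∩ G) : ℤ) = (dimS F : ℤ) + (dimS G : ℤ) - d ∧
    (intrinsicInterior ℝ F ∩ intrinsicInterior ℝ G).Nonempty

/-- The volume of the parallelepiped spanned by the union of orthonormal bases of `L₁` and `L₂`
(the square root of the Gram determinant of the combined family). -/
def gramVol (L₁ L₂ : Submodule ℝ (Euc d)) : ℝ :=
  Real.sqrt (Matrix.det (Matrix.of fun i j :
      Fin (Module.finrank ℝ L₁) ⊕ Fin (Module.finrank ℝ L₂) =>
    ⟪Sum.elim (fun a => ((stdOrthonormalBasis ℝ L₁) a : Euc d))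
        (fun b => ((stdOrthonormalBasis ℝ L₂) b : Euc d)) i,
      Sum.elim (fun a => ((stdOrthonormalBasis ℝ L₁) a : Euc d))
        (fun b => ((stdOrthonormalBasis ℝ L₂) b : Euc d)) j⟫))

/-- The generalized sine function `[L₁, L₂]` of two subspaces. -/
def genSine (L₁ L₂ : Submodule ℝ (Euc d)) : ℝ :=
  if Module.finrank ℝ L₁ + Module.finrank ℝ L₂ ≤ d then gramVol L₁ L₂ else gramVol L₁ᗮ L₂ᗮ

/-- The generalized sine function `[C, D] = [L(C), L(D)]` of two cones. -/
def genSineC (C D : Set (Euc d)) : ℝ := genSine (linHull C) (linHull D)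

/-- Spherical Lebesgue measure `σ_{d-1}` on the unit sphere of `ℝ^d`. -/
def sphLebesgue (d : ℕ) : Measure (Metric.sphere (0 : Euc d) 1) :=
  (volume : Measure (Euc d)).toSphere

/-- The normalized spherical Lebesgue measure `σ = σ_{d-1}/ω_d` on the unit sphere. -/
def sphNormalized (d : ℕ) : Measure (Metric.sphere (0 : Euc d) 1) :=
  (sphLebesgue d Set.univ)⁻¹ • sphLebesgue d

/-- The Schläfli cones induced by the hyperplanes `(u i)^⊥`, `i = 1, …, n`: the closures of the
connected components of the complement of the union of the hyperplanes. -/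
def schlafliCones {n : ℕ} (u : Fin n → Euc d) : Set (Set (Euc d)) :=
  {C | ∃ x : Euc d, (∀ i, ⟪u i, x⟫ ≠ 0) ∧
    C = closure (connectedComponentIn {y : Euc d | ∀ i, ⟪u i, y⟫ ≠ 0} x)}

/-- `C(n,d) = 2 ∑_{r=0}^{d-1} binom(n-1, r)`, the number of Schläfli cones induced by `n`
hyperplanes in general position. -/
def schlafliCount (n d : ℕ) : ℕ := 2 * ∑ r ∈ Finset.range d, (n - 1).choose r

/-- The joint distribution `σ^n` of the unit normal vectors of `n` independent isotropic random
hyperplanes. -/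
def sphPi (d n : ℕ) : Measure (Fin n → Metric.sphere (0 : Euc d) 1) :=
  Measure.pi fun _ => sphNormalized d

end

namespace SchlafliCone

open ProbabilityTheory

variable {d : ℕ}

/-- The polyhedral cone `{x | ∀ i, ⟪v i, x⟫ ≤ 0}` cut out by the family `v`. -/
def polyCone {m : ℕ} (v : Fin m → Euc d) : Set (Euc d) := {x | ∀ i, ⟪v i, x⟫ ≤ 0}

/-- The common orthogonal complement of the `v i` with `J i`. -/
def faceSpan {m : ℕ} (v : Fin m → Euc d) (J : Fin m → Bool) : Submodule ℝ (Euc d) where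
  carrier := {x | ∀ i, J i = true → ⟪v i, x⟫ = 0}
  add_mem' := by
    intro a b ha hb i hi
    rw [inner_add_right, ha i hi, hb i hi, add_zero]
  zero_mem' := by
    intro i _
    exact inner_zero_right _
  smul_mem' := by
    intro c x hx i hi
    rw [inner_smul_right, hx i hi, mul_zero]

/-- The points of `polyCone v` at which exactly the constraints in `J` are tight. -/
def relFace {m : ℕ} (v : Fin m → Euc d) (J : Fin m → Bool) : Set (Euc d) :=
  {x | ∀ i, if J i = true then ⟪v i, x⟫ = 0 else ⟪v i, x⟫ < 0}

/-- The cone generated by the `v i` with `J i`. -/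
def genCone {m : ℕ} (v : Fin m → Euc d) (J : Fin m → Bool) : Set (Euc d) :=
  {w | ∃ t : Fin m → ℝ, (∀ i, 0 ≤ t i) ∧ w = ∑ i, t i • (if J i = true then v i else 0)}

theorem farkas {m : ℕ} (v : Fin m → Euc d) (w : Euc d)
    (h : ∀ y, (∀ i, ⟪v i, y⟫ ≤ 0) → ⟪w, y⟫ ≤ 0) :
    ∃ t : Fin m → ℝ, (∀ i, 0 ≤ t i) ∧ w = ∑ i, t i • v i := by
  induction m generalizing w with
  | zero =>
    refine ⟨fun _ => 0, fun _ => le_rfl, ?_⟩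
    have := h w (fun i => i.elim0)
    simpa using this
  | succ m ih =>
    by_contra hcon
    have hno : ¬ ∃ t : Fin m → ℝ, (∀ i, 0 ≤ t i) ∧ w = ∑ i, t i • v i.succ := by
      rintro ⟨t, ht, hw⟩
      refine hcon ⟨Fin.cons 0 t, Fin.cases (by simp) (by simpa using ht), ?_⟩
      simpa [Fin.sum_univ_succ] using hw
    obtain ⟨y, hy, hwy⟩ : ∃ y, (∀ i : Fin m, ⟪v i.succ, y⟫ ≤ 0) ∧ 0 < ⟪w, y⟫ := by
      by_contra! hc
      exact hno (ih _ _ hc)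
    have hvy : 0 < ⟪v 0, y⟫ := by
      by_contra! hc
      exact absurd (h y (Fin.cases hc hy)) (not_le.2 hwy)
    set p : Euc d → Euc d := fun x => x - (⟪x, y⟫ / ⟪v 0, y⟫) • v 0 with hp
    have hno' : ¬ ∃ t : Fin m → ℝ, (∀ i, 0 ≤ t i) ∧ p w = ∑ i, t i • p (v i.succ) := by
      rintro ⟨t, ht, hw⟩
      refine hcon ⟨Fin.cons (⟪w, y⟫ / ⟪v 0, y⟫ - ∑ i, t i * (⟪v i.succ, y⟫ / ⟪v 0, y⟫)) t,
        fun i => ?_, ?_⟩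
      · refine Fin.cases ?_ (by simpa using ht) i
        have h1 : ∑ i, t i * (⟪v i.succ, y⟫ / ⟪v 0, y⟫) ≤ 0 :=
          Finset.sum_nonpos fun i _ => mul_nonpos_of_nonneg_of_nonpos (ht i)
            (div_nonpos_of_nonpos_of_nonneg (hy i) hvy.le)
        have h2 : 0 ≤ ⟪w, y⟫ / ⟪v 0, y⟫ := by positivity
        simp only [Fin.cons_zero]
        linarith
      · simp only [hp, smul_sub, Finset.sum_sub_distrib, smul_smul, ← Finset.sum_smul] at hw
        rw [sub_eq_iff_eq_add] at hw
        rw [Fin.sum_univ_succ]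
        simp only [Fin.cons_zero, Fin.cons_succ]
        conv_lhs => rw [hw]
        rw [sub_smul]
        abel
    obtain ⟨z, hz, hwz⟩ : ∃ z, (∀ i : Fin m, ⟪p (v i.succ), z⟫ ≤ 0) ∧ 0 < ⟪p w, z⟫ := by
      by_contra! hc
      exact hno' (ih _ _ hc)
    have key : ∀ x, ⟪p x, z⟫ = ⟪x, z - (⟪v 0, z⟫ / ⟪v 0, y⟫) • y⟫ := by
      intro x
      simp only [hp, inner_sub_left, inner_sub_right, inner_smul_left, inner_smul_right]
      simp
      ring
    refine absurd (h (z - (⟪v 0, z⟫ / ⟪v 0, y⟫) • y) fun i => ?_) ?_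
    · refine Fin.cases ?_ (fun i => ?_) i
      · rw [inner_sub_right, inner_smul_right, div_mul_cancel₀ _ hvy.ne', sub_self]
      · rw [← key]
        exact hz i
    · rw [← key]
      exact not_le.2 hwz

section Faces

variable {m : ℕ} {v : Fin m → Euc d} {J : Fin m → Bool}

theorem relFace_subset_faceSpan : relFace v J ⊆ faceSpan v J := by
  intro x hx i hi
  have := hx i
  rwa [if_pos hi] at this

theorem relFace_subset_polyCone : relFace v J ⊆ polyCone v := by
  intro x hx i
  have := hx i
  split_ifs at this
  · exact this.le
  · exact this.le

theorem exists_pos_add_smul_mem {x y : Euc d} (hx : x ∈ relFace v J)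
    (hy : ∀ i, J i = true → ⟪v i, y⟫ ≤ 0) : ∃ ε : ℝ, 0 < ε ∧ x + ε • y ∈ polyCone v := by
  have h : ∀ᶠ ε : ℝ in nhdsWithin 0 (Ioi 0), ∀ i, ⟪v i, x + ε • y⟫ ≤ 0 := by
    rw [Filter.eventually_all]
    intro i
    have hxi := hx i
    split_ifs at hxi with hi
    · filter_upwards [self_mem_nhdsWithin] with ε hε
      rw [inner_add_right, inner_smul_right, hxi, zero_add]
      exact mul_nonpos_of_nonneg_of_nonpos (le_of_lt hε) (hy i hi)
    · refine Filter.Eventually.filter_mono nhdsWithin_le_nhds ?_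
      have hc : Continuous fun ε : ℝ => ⟪v i, x + ε • y⟫ := by fun_prop
      have := hc.tendsto 0
      simp only [zero_smul, add_zero] at this
      exact (this.eventually (gt_mem_nhds hxi)).mono fun ε hε => hε.le
  obtain ⟨ε, h1, h2⟩ := (h.and self_mem_nhdsWithin).exists
  exact ⟨ε, h2, h1⟩

theorem isFace_inter_faceSpan (h : (relFace v J).Nonempty) :
    IsFace (polyCone v) (polyCone v ∩ faceSpan v J) := by
  refine ⟨⟨inter_subset_left, ?_⟩, ?_, ?_⟩
  · rintro a ha b hb x ⟨-, hx⟩ ⟨s, t, hs, ht, -, rfl⟩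
    refine ⟨ha, fun i hi => ?_⟩
    have h1 := hx i hi
    rw [inner_add_right, inner_smul_right, inner_smul_right] at h1
    have h2 := ha i
    have h3 := hb i
    by_contra hne
    have h4 : ⟪v i, a⟫ < 0 := lt_of_le_of_ne h2 hne
    nlinarith [mul_neg_of_pos_of_neg hs h4, mul_nonpos_of_nonneg_of_nonpos ht.le h3]
  · refine Convex.inter ?_ (faceSpan v J).convex
    intro a ha b hb s t hs ht _ i
    rw [inner_add_right, inner_smul_right, inner_smul_right]
    nlinarith [mul_nonpos_of_nonneg_of_nonpos hs (ha i), mul_nonpos_of_nonneg_of_nonpos ht (hb i)]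
  · exact h.mono fun x hx => ⟨relFace_subset_polyCone hx, relFace_subset_faceSpan hx⟩

theorem linHull_inter_faceSpan (h : (relFace v J).Nonempty) :
    linHull (polyCone v ∩ faceSpan v J) = faceSpan v J := by
  refine le_antisymm (Submodule.span_le.2 inter_subset_right) fun w hw => ?_
  obtain ⟨x, hx⟩ := h
  obtain ⟨ε, hε, hmem⟩ := exists_pos_add_smul_mem hx (y := w) fun i hi => (hw i hi).le
  have h1 : x ∈ linHull (polyCone v ∩ faceSpan v J) :=
    Submodule.subset_span ⟨relFace_subset_polyCone hx, relFace_subset_faceSpan hx⟩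
  have h2 : x + ε • w ∈ linHull (polyCone v ∩ faceSpan v J) :=
    Submodule.subset_span ⟨hmem, (faceSpan v J).add_mem (relFace_subset_faceSpan hx)
      ((faceSpan v J).smul_mem _ hw)⟩
  have h3 := Submodule.smul_mem _ ε⁻¹ (Submodule.sub_mem _ h2 h1)
  rwa [add_sub_cancel_left, smul_smul, inv_mul_cancel₀ hε.ne', one_smul] at h3

theorem normalCone_inter_faceSpan (h : (relFace v J).Nonempty) :
    normalCone (polyCone v) (polyCone v ∩ faceSpan v J) = genCone v J := by
  ext w
  constructor
  · rintro ⟨h1, h2⟩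
    obtain ⟨x, hx⟩ := h
    refine farkas _ w fun y hy => ?_
    obtain ⟨ε, hε, hmem⟩ := exists_pos_add_smul_mem hx (y := y) fun i hi => by
      have := hy i
      rwa [if_pos hi] at this
    have h3 := h1 _ hmem
    rw [inner_add_right, inner_smul_right,
      h2 x ⟨relFace_subset_polyCone hx, relFace_subset_faceSpan hx⟩, zero_add] at h3
    by_contra! hc
    exact absurd h3 (not_le.2 (mul_pos hε hc))
  · rintro ⟨t, ht, rfl⟩
    refine ⟨fun y hy => ?_, fun x hx => ?_⟩
    · rw [sum_inner]
      refine Finset.sum_nonpos fun i _ => ?_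
      rw [real_inner_smul_left]
      refine mul_nonpos_of_nonneg_of_nonpos (ht i) ?_
      split_ifs
      · exact hy i
      · simp
    · rw [sum_inner]
      refine Finset.sum_eq_zero fun i _ => ?_
      rw [real_inner_smul_left]
      split_ifs with hi
      · rw [hx.2 i hi, mul_zero]
      · simp

theorem eq_of_inter_faceSpan_eq {J' : Fin m → Bool} (h : (relFace v J).Nonempty)
    (h' : (relFace v J').Nonempty)
    (heq : polyCone v ∩ (faceSpan v J : Set (Euc d)) = polyCone v ∩ faceSpan v J') : J = J' := by
  have aux : ∀ {J J' : Fin m → Bool}, (relFace v J).Nonempty →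
      polyCone v ∩ (faceSpan v J : Set (Euc d)) = polyCone v ∩ faceSpan v J' →
      ∀ i, J' i = true → J i = true := by
    rintro J J' ⟨x, hx⟩ heq i hi
    by_contra hJ
    have h1 : x ∈ polyCone v ∩ (faceSpan v J' : Set (Euc d)) :=
      heq ▸ ⟨relFace_subset_polyCone hx, relFace_subset_faceSpan hx⟩
    have h2 := hx i
    rw [if_neg hJ] at h2
    exact h2.ne (h1.2 i hi)
  funext i
  have h1 := aux h heq i
  have h2 := aux h' heq.symm i
  cases hi : J i <;> cases hi' : J' i <;> simp_all

theorem exists_eq_inter_faceSpan {F : Set (Euc d)} (hF : IsFace (polyCone v) F) :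
    ∃ J : Fin m → Bool, (relFace v J).Nonempty ∧ F = polyCone v ∩ faceSpan v J := by
  classical
  obtain ⟨⟨hsub, hext⟩, hconv, hne⟩ := hF
  set J : Fin m → Bool := fun i => decide (∀ x ∈ F, ⟪v i, x⟫ = 0) with hJ
  have hJt : ∀ i, J i = true ↔ ∀ x ∈ F, ⟪v i, x⟫ = 0 := fun i => by simp [hJ]
  have hpt : ∀ i, ∃ x ∈ F, J i = false → ⟪v i, x⟫ < 0 := by
    intro i
    by_cases hi : J i = true
    · obtain ⟨x, hx⟩ := hne
      exact ⟨x, hx, by simp [hi]⟩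
    · rw [hJt] at hi
      push Not at hi
      obtain ⟨x, hx, hx'⟩ := hi
      exact ⟨x, hx, fun _ => lt_of_le_of_ne (hsub hx i) hx'⟩
  choose p hpF hp using hpt
  obtain ⟨x, hxF, hxR⟩ : ∃ x ∈ F, x ∈ relFace v J := by
    rcases Nat.eq_zero_or_pos m with rfl | hm
    · obtain ⟨x, hx⟩ := hne
      exact ⟨x, hx, fun i => i.elim0⟩
    · have hm' : (0 : ℝ) < m := by exact_mod_cast hm
      refine ⟨∑ i, (m : ℝ)⁻¹ • p i, hconv.sum_mem (fun _ _ => by positivity) ?_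
        (fun i _ => hpF i), fun i => ?_⟩
      · simp [hm'.ne']
      · simp only [inner_sum, inner_smul_right]
        split_ifs with hi
        · exact Finset.sum_eq_zero fun j _ => by rw [(hJt i).1 hi _ (hpF j), mul_zero]
        · refine Finset.sum_neg' (fun j _ => ?_) ⟨i, Finset.mem_univ i, ?_⟩
          · exact mul_nonpos_of_nonneg_of_nonpos (by positivity) (hsub (hpF j) i)
          · exact mul_neg_of_pos_of_neg (by positivity) (hp i (by simpa using hi))
  refine ⟨J, ⟨x, hxR⟩, Subset.antisymm (fun y hy => ⟨hsub hy, fun i hi => (hJt i).1 hi y hy⟩) ?_⟩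
  rintro y ⟨hyC, hyL⟩
  obtain ⟨ε, hε, hmem⟩ := exists_pos_add_smul_mem hxR (y := x - y) fun i hi => by
    rw [inner_sub_right, hyL i hi, (hJt i).1 hi x hxF, sub_zero]
  refine hext hyC hmem hxF ⟨ε / (1 + ε), 1 / (1 + ε), by positivity, by positivity, ?_, ?_⟩
  · field_simp
    ring
  · have h2 : 1 / (1 + ε) * (1 + ε) = 1 := by field_simp
    have h3 : ε / (1 + ε) = 1 / (1 + ε) * ε := by ring
    rw [h3]
    calc (1 / (1 + ε) * ε) • y + (1 / (1 + ε)) • (x + ε • (x - y))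
        = (1 / (1 + ε) * (1 + ε)) • x := by module
      _ = x := by rw [h2, one_smul]

end Faces

section Gaussian

section General

variable {E : Type*} [NormedAddCommGroup E] [InnerProductSpace ℝ E] [FiniteDimensional ℝ E]
  [MeasurableSpace E] [BorelSpace E]

theorem withDensity_eq_stdGaussian :
    ((volume : Measure E).withDensity fun x =>
      ENNReal.ofReal ((2 * Real.pi) ^ (-(Module.finrank ℝ E : ℝ) / 2) *
        Real.exp (-‖x‖ ^ 2 / 2))) = stdGaussian E := by
  set c : ℝ := (2 * Real.pi) ^ (-(Module.finrank ℝ E : ℝ) / 2) with hc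
  have hc0 : 0 < c := by positivity
  have hexp_int : Integrable fun x : E => c * Real.exp (-‖x‖ ^ 2 / 2) := by
    refine Integrable.const_mul ?_ _
    have h := GaussianFourier.integral_rexp_neg_mul_sq_norm (V := E) (b := 1 / 2) (by norm_num)
    have h' : Integrable fun x : E => Real.exp (-(1 / 2) * ‖x‖ ^ 2) := by
      by_contra hcon
      rw [integral_undef hcon] at h
      have : 0 < (Real.pi / (1 / 2)) ^ ((Module.finrank ℝ E : ℝ) / 2) := by positivity
      exact this.ne h
    refine h'.congr (Filter.Eventually.of_forall fun x => ?_)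
    ring_nf
  have hfin : IsFiniteMeasure ((volume : Measure E).withDensity fun x =>
      ENNReal.ofReal (c * Real.exp (-‖x‖ ^ 2 / 2))) :=
    isFiniteMeasure_withDensity_ofReal hexp_int.2
  refine Measure.ext_of_charFun (funext fun t => ?_)
  rw [charFun_stdGaussian, charFun_apply,
    integral_withDensity_eq_integral_toReal_smul (by fun_prop) (by simp)]
  have h1 : ∀ x : E, (ENNReal.ofReal (c * Real.exp (-‖x‖ ^ 2 / 2))).toReal •
      Complex.exp (⟪x, t⟫ * Complex.I) =
      (c : ℂ) * Complex.exp (-(1 / 2 : ℂ) * ‖x‖ ^ 2 + Complex.I * ⟪t, x⟫) := by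
    intro x
    rw [ENNReal.toReal_ofReal (by positivity), Complex.real_smul, Complex.exp_add,
      real_inner_comm]
    push_cast
    rw [mul_assoc, mul_comm Complex.I]
    congr 3
    ring_nf
  simp_rw [h1]
  rw [integral_const_mul, GaussianFourier.integral_cexp_neg_mul_sq_norm_add (by norm_num)]
  have h2 : (c : ℂ) * (Real.pi / (1 / 2 : ℂ)) ^ (Module.finrank ℝ E / 2 : ℂ) = 1 := by
    have : (Real.pi / (1 / 2 : ℂ)) = ((2 * Real.pi : ℝ) : ℂ) := by
      push_cast
      ring
    rw [this, show (Module.finrank ℝ E / 2 : ℂ) = ((Module.finrank ℝ E / 2 : ℝ) : ℂ) by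
      push_cast; rfl,
      ← Complex.ofReal_cpow (by positivity), ← Complex.ofReal_mul, hc,
      ← Real.rpow_add (by positivity)]
    ring_nf
    simp
  rw [← mul_assoc, h2, one_mul, Complex.I_sq]
  ring_nf

theorem stdGaussian_absolutelyContinuous : stdGaussian E ≪ (volume : Measure E) := by
  rw [← withDensity_eq_stdGaussian]
  exact withDensity_absolutelyContinuous _ _

theorem stdGaussian_submodule {V : Submodule ℝ E} (hV : V ≠ ⊤) : stdGaussian E V = 0 :=
  stdGaussian_absolutelyContinuous (Measure.addHaar_submodule _ _ hV)

/-- A rotation invariant probability measure on the unit sphere is unique. -/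
theorem eq_of_map_isometry_eq {μ ν : Measure E} [IsProbabilityMeasure μ] [IsProbabilityMeasure ν]
    (hμ : ∀ f : E ≃ₗᵢ[ℝ] E, μ.map f = μ) (hν : ∀ f : E ≃ₗᵢ[ℝ] E, ν.map f = ν)
    (hμ1 : ∀ᵐ x ∂μ, ‖x‖ = 1) (hν1 : ∀ᵐ x ∂ν, ‖x‖ = 1) : μ = ν := by
  have hrot : ∀ {ξ : Measure E}, (∀ f : E ≃ₗᵢ[ℝ] E, ξ.map f = ξ) → ∀ {x y : E}, ‖x‖ = ‖y‖ →
      charFun ξ x = charFun ξ y := by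
    intro ξ hξ x y hxy
    have h := Submodule.reflection_sub hxy
    set f := (ℝ ∙ (x - y))ᗮ.reflection
    conv_rhs => rw [← hξ f]
    rw [charFun_apply, charFun_apply, integral_map (by fun_prop) (by fun_prop)]
    refine integral_congr_ae (Filter.Eventually.of_forall fun z => ?_)
    dsimp only
    rw [← h, LinearIsometryEquiv.inner_map_map]
  have hmix : ∀ r : ℝ, ∫ y, charFun μ (r • y) ∂ν = ∫ x, charFun ν (r • x) ∂μ := by
    intro r
    simp_rw [charFun_apply]
    rw [integral_integral_swap]
    · simp_rw [inner_smul_right, real_inner_comm]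
    · refine Integrable.of_bound (C := 1) ?_ ?_
      · exact Measurable.aestronglyMeasurable (by fun_prop)
      · refine Filter.Eventually.of_forall fun p => ?_
        simp only [Function.uncurry]
        rw [Complex.norm_exp_ofReal_mul_I]
  have hconst : ∀ {ξ ζ : Measure E} [IsProbabilityMeasure ζ],
      (∀ f : E ≃ₗᵢ[ℝ] E, ξ.map f = ξ) → (∀ᵐ x ∂ζ, ‖x‖ = 1) → ∀ t : E,
      ∫ y, charFun ξ (‖t‖ • y) ∂ζ = charFun ξ t := by
    intro ξ ζ _ hξ hζ t
    rw [integral_congr_ae (g := fun _ => charFun ξ t)]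
    · simp
    · filter_upwards [hζ] with y hy
      exact hrot hξ (by rw [norm_smul, hy, mul_one, norm_norm])
  refine Measure.ext_of_charFun (funext fun t => ?_)
  rw [← hconst hμ hν1 t, hmix, hconst hν hμ1 t]

theorem ae_stdGaussian_ne_zero [Nontrivial E] : ∀ᵐ x ∂(stdGaussian E), x ≠ 0 := by
  have h := stdGaussian_submodule (E := E) (V := ⊥) bot_ne_top
  rw [ae_iff]
  simpa using h

theorem eq_map_normalize_stdGaussian [Nontrivial E] {μ : Measure E} [IsProbabilityMeasure μ]
    (hμ : ∀ f : E ≃ₗᵢ[ℝ] E, μ.map f = μ) (hμ1 : ∀ᵐ x ∂μ, ‖x‖ = 1) :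
    μ = (stdGaussian E).map fun x => ‖x‖⁻¹ • x := by
  have hm : Measurable fun x : E => ‖x‖⁻¹ • x := by fun_prop
  have : IsProbabilityMeasure ((stdGaussian E).map fun x => ‖x‖⁻¹ • x) :=
    Measure.isProbabilityMeasure_map hm.aemeasurable
  refine eq_of_map_isometry_eq hμ (fun f => ?_) hμ1 ?_
  · have h1 : (f ∘ fun x : E => ‖x‖⁻¹ • x) = (fun x : E => ‖x‖⁻¹ • x) ∘ f := by
      funext x
      simp
    rw [Measure.map_map (by fun_prop) hm, h1, ← Measure.map_map hm (by fun_prop),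
      stdGaussian_map]
  · rw [ae_map_iff hm.aemeasurable (measurableSet_eq_fun (by fun_prop) (by fun_prop))]
    filter_upwards [ae_stdGaussian_ne_zero] with x hx
    rw [norm_smul, norm_inv, norm_norm, inv_mul_cancel₀ (norm_ne_zero_iff.2 hx)]

/-- The component of `x` orthogonal to `a`. -/
noncomputable def rejection (x a : E) : E := x - (⟪x, a⟫ / ‖a‖ ^ 2) • a

theorem measurable_rejection : Measurable fun p : E × E => rejection p.1 p.2 := by
  unfold rejection
  fun_prop

theorem lintegral_rejection (hE : 2 ≤ Module.finrank ℝ E) {P : Set E} (hP : MeasurableSet P)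
    (hcon : ∀ x ∈ P, ∀ r : ℝ, 0 < r → r • x ∈ P) :
    ∫⁻ a, ∫⁻ x, P.indicator 1 (rejection x a) ∂(stdGaussian E) ∂(stdGaussian E)
      = stdGaussian E P := by
  have hnt : Nontrivial E := Module.nontrivial_of_finrank_pos (R := ℝ) (by omega)
  have hiff : ∀ x : E, x ≠ 0 → (‖x‖⁻¹ • x ∈ P ↔ x ∈ P) := by
    intro x hx
    have hx' : 0 < ‖x‖ := norm_pos_iff.2 hx
    refine ⟨fun h => ?_, fun h => hcon x h _ (by positivity)⟩
    have := hcon _ h _ hx'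
    rwa [smul_smul, mul_inv_cancel₀ hx'.ne', one_smul] at this
  have hindn : ∀ x : E, x ≠ 0 →
      P.indicator (1 : E → ℝ≥0∞) (‖x‖⁻¹ • x) = P.indicator 1 x := by
    intro x hx
    by_cases h : x ∈ P
    · rw [indicator_of_mem h, indicator_of_mem ((hiff x hx).2 h)]
      rfl
    · rw [indicator_of_notMem h, indicator_of_notMem (mt (hiff x hx).1 h)]
  have hn : Measurable fun x : E => ‖x‖⁻¹ • x := by fun_prop
  set γ := stdGaussian E with hγ
  set R : E × E → E := fun p => rejection p.2 p.1 with hR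
  have hRm : Measurable R := measurable_rejection.comp measurable_swap
  set R' : E × E → E := fun p => ‖R p‖⁻¹ • R p with hR'
  have hRm' : Measurable R' := hn.comp hRm
  have hne : ∀ᵐ p ∂(γ.prod γ), R p ≠ 0 := by
    rw [Measure.ae_prod_iff_ae_ae (p := fun p => R p ≠ 0)
      (hRm (measurableSet_singleton (0 : E)).compl)]
    refine Filter.Eventually.of_forall fun a => ?_
    have hV : (ℝ ∙ a) ≠ (⊤ : Submodule ℝ E) := by
      intro h
      have h1 := finrank_span_le_card (R := ℝ) ({a} : Set E)
      rw [h, finrank_top, toFinset_singleton, Finset.card_singleton] at h1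
      omega
    have h0 := stdGaussian_submodule hV
    rw [ae_iff]
    refine measure_mono_null (fun x hx => ?_) h0
    have hx0 : x - (⟪x, a⟫ / ‖a‖ ^ 2) • a = 0 := not_not.1 hx
    rw [sub_eq_zero] at hx0
    rw [SetLike.mem_coe, Submodule.mem_span_singleton]
    exact ⟨_, hx0.symm⟩
  have : IsProbabilityMeasure ((γ.prod γ).map R') :=
    Measure.isProbabilityMeasure_map hRm'.aemeasurable
  have hlaw : (γ.prod γ).map R' = γ.map fun x => ‖x‖⁻¹ • x := by
    refine eq_map_normalize_stdGaussian (fun f => ?_) ?_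
    · have h1 : f ∘ R' = R' ∘ Prod.map f f := by
        funext p
        simp only [hR', hR, rejection, Function.comp, Prod.map, map_smul, map_sub,
          LinearIsometryEquiv.inner_map_map, LinearIsometryEquiv.norm_map]
        rw [← LinearIsometryEquiv.norm_map f (p.2 - _)]
        simp only [map_sub, map_smul]
      rw [Measure.map_map (by fun_prop) hRm', h1,
        ← Measure.map_map hRm' (by fun_prop),
        ← Measure.map_prod_map _ _ (by fun_prop) (by fun_prop), hγ, stdGaussian_map]
    · rw [ae_map_iff hRm'.aemeasurable (measurableSet_eq_fun (by fun_prop) (by fun_prop))]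
      filter_upwards [hne] with p hp
      simp only [hR']
      rw [norm_smul, norm_inv, norm_norm, inv_mul_cancel₀ (norm_ne_zero_iff.2 hp)]
  have hind : Measurable (P.indicator (1 : E → ℝ≥0∞)) := measurable_one.indicator hP
  calc ∫⁻ a, ∫⁻ x, P.indicator 1 (rejection x a) ∂γ ∂γ
      = ∫⁻ p, P.indicator 1 (R p) ∂(γ.prod γ) :=
        (lintegral_prod _ (hind.comp hRm).aemeasurable).symm
    _ = ∫⁻ p, P.indicator 1 (R' p) ∂(γ.prod γ) := by
        refine lintegral_congr_ae ?_
        filter_upwards [hne] with p hp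
        exact (hindn _ hp).symm
    _ = ∫⁻ x, P.indicator 1 x ∂((γ.prod γ).map R') := (lintegral_map hind hRm').symm
    _ = ∫⁻ x, P.indicator 1 (‖x‖⁻¹ • x) ∂γ := by rw [hlaw, lintegral_map hind hn]
    _ = ∫⁻ x, P.indicator 1 x ∂γ := by
        refine lintegral_congr_ae ?_
        filter_upwards [ae_stdGaussian_ne_zero] with x hx
        exact hindn _ hx
    _ = γ P := by rw [lintegral_indicator_one hP]

end General

theorem indicator_one_congr {α β : Type*} {P : Set α} {Q : Set β} {x : α} {y : β}
    (h : x ∈ P ↔ y ∈ Q) : P.indicator (1 : α → ℝ≥0∞) x = Q.indicator 1 y := by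
  by_cases hx : x ∈ P
  · simp [hx, h.1 hx]
  · simp [hx, mt h.2 hx]

theorem indicator_one_mul_indicator_one {α β δ : Type*} {P : Set α} {Q : Set β} {R : Set δ}
    {x : α} {y : β} {z : δ} (h : z ∈ R ↔ x ∈ P ∧ y ∈ Q) :
    P.indicator (1 : α → ℝ≥0∞) x * Q.indicator 1 y = R.indicator 1 z := by
  by_cases hx : x ∈ P <;> by_cases hy : y ∈ Q <;> by_cases hz : z ∈ R <;> simp_all

theorem gauss_eq_map_coe (L : Submodule ℝ (Euc d)) :
    gauss L = (stdGaussian L).map Subtype.val := by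
  rw [gauss, ← withDensity_eq_stdGaussian]
  rfl

instance (L : Submodule ℝ (Euc d)) : IsProbabilityMeasure (gauss L) := by
  rw [gauss_eq_map_coe]
  exact Measure.isProbabilityMeasure_map (by fun_prop)

theorem ae_gauss_mem (L : Submodule ℝ (Euc d)) : ∀ᵐ x ∂(gauss L), x ∈ L := by
  rw [gauss_eq_map_coe, ae_map_iff (p := fun x => x ∈ L) (by fun_prop)
    L.closed_of_finiteDimensional.measurableSet]
  exact Filter.Eventually.of_forall fun x => x.2

theorem charFun_gauss (L : Submodule ℝ (Euc d)) (t : Euc d) :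
    charFun (gauss L) t = Complex.exp (-‖L.starProjection t‖ ^ 2 / 2) := by
  have h := charFun_stdGaussian (L.orthogonalProjectionOnto t)
  rw [charFun_apply] at h
  rw [gauss_eq_map_coe, charFun_apply, integral_map (by fun_prop)
    (Measurable.aestronglyMeasurable (by fun_prop)), Submodule.starProjection_apply]
  simpa using h

theorem gauss_submodule {L V : Submodule ℝ (Euc d)} (h : ¬ L ≤ V) : gauss L V = 0 := by
  rw [gauss_eq_map_coe, Measure.map_apply (by fun_prop)
    V.closed_of_finiteDimensional.measurableSet]
  have h1 : V.comap L.subtype ≠ ⊤ := by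
    rwa [Ne, Submodule.comap_subtype_eq_top]
  exact stdGaussian_submodule h1

theorem gauss_conv_gauss_orthogonal (L : Submodule ℝ (Euc d)) :
    gauss L ∗ gauss Lᗮ = stdGaussian (Euc d) := by
  refine Measure.ext_of_charFun (funext fun t => ?_)
  rw [charFun_conv, charFun_gauss, charFun_gauss, charFun_stdGaussian, ← Complex.exp_add]
  congr 1
  have h := L.norm_sq_eq_add_norm_sq_starProjection t
  have h' : (‖t‖ : ℂ) ^ 2 = (‖L.starProjection t‖ : ℂ) ^ 2 + (‖Lᗮ.starProjection t‖ : ℂ) ^ 2 := by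
    exact_mod_cast h
  rw [h']
  ring

theorem lintegral_stdGaussian_eq (L : Submodule ℝ (Euc d)) {f : Euc d → Euc d → ℝ≥0∞}
    (hf : Measurable (Function.uncurry f)) :
    ∫⁻ z, f (L.starProjection z) (Lᗮ.starProjection z) ∂(stdGaussian (Euc d)) =
      ∫⁻ x, ∫⁻ y, f x y ∂(gauss Lᗮ) ∂(gauss L) := by
  have hf' : Measurable fun z => f (L.starProjection z) (Lᗮ.starProjection z) :=
    hf.comp (f := fun z => (L.starProjection z, Lᗮ.starProjection z)) (by fun_prop)
  rw [← gauss_conv_gauss_orthogonal L, Measure.lintegral_conv hf']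
  refine lintegral_congr_ae ?_
  filter_upwards [ae_gauss_mem L] with x hx
  refine lintegral_congr_ae ?_
  filter_upwards [ae_gauss_mem Lᗮ] with y hy
  have h1 : L.starProjection (x + y) = x := by
    rw [map_add, Submodule.starProjection_eq_self_iff.2 hx,
      (Submodule.starProjection_apply_eq_zero_iff L).2 hy, add_zero]
  have h2 : Lᗮ.starProjection (x + y) = y := by
    rw [map_add, Submodule.starProjection_eq_self_iff.2 hy,
      (Submodule.starProjection_apply_eq_zero_iff Lᗮ).2 (by simpa using hx), zero_add]
  rw [h1, h2]

theorem gauss_mul_gauss_orthogonal (L : Submodule ℝ (Euc d)) {P N : Set (Euc d)}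
    (hP : MeasurableSet P) (hN : MeasurableSet N) :
    gauss L P * gauss Lᗮ N =
      stdGaussian (Euc d) {z | L.starProjection z ∈ P ∧ Lᗮ.starProjection z ∈ N} := by
  have hm : MeasurableSet {z | L.starProjection z ∈ P ∧ Lᗮ.starProjection z ∈ N} :=
    (hP.preimage (f := L.starProjection) (by fun_prop)).inter
      (hN.preimage (f := Lᗮ.starProjection) (by fun_prop))
  have h := lintegral_stdGaussian_eq L
    (f := fun x y => P.indicator 1 x * N.indicator 1 y)
    (by
      exact ((measurable_one.indicator hP).comp measurable_fst).mul
        ((measurable_one.indicator hN).comp measurable_snd))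
  simp_rw [lintegral_const_mul _ (measurable_one.indicator hN : Measurable
      (N.indicator (1 : Euc d → ℝ≥0∞))), lintegral_mul_const _ (measurable_one.indicator hP :
      Measurable (P.indicator (1 : Euc d → ℝ≥0∞))), lintegral_indicator_one hP,
    lintegral_indicator_one hN] at h
  rw [← h, ← lintegral_indicator_one hm]
  refine lintegral_congr fun z => ?_
  exact indicator_one_mul_indicator_one Iff.rfl

theorem lintegral_gauss_sub_smul (L : Submodule ℝ (Euc d)) {N : Set (Euc d)}
    (hN : MeasurableSet N) (hcon : IsConic N) (s : ℝ) :
    ∫⁻ b, ∫⁻ y, N.indicator 1 (y - s • b) ∂(gauss L) ∂(gauss L) = gauss L N := by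
  have hind : Measurable (N.indicator (1 : Euc d → ℝ≥0∞)) := measurable_one.indicator hN
  set c : ℝ := Real.sqrt (1 + s ^ 2) with hc
  have hc0 : 0 < c := Real.sqrt_pos.2 (by positivity)
  have hc2 : c ^ 2 = 1 + s ^ 2 := Real.sq_sqrt (by positivity)
  have hlaw : (gauss L).map (fun b => (-s) • b) ∗ gauss L = (gauss L).map fun x => c • x := by
    have : IsProbabilityMeasure ((gauss L).map fun b => (-s) • b) :=
      Measure.isProbabilityMeasure_map (by fun_prop)
    refine Measure.ext_of_charFun (funext fun t => ?_)
    rw [charFun_conv, charFun_map_smul, charFun_map_smul, charFun_gauss, charFun_gauss,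
      charFun_gauss, ← Complex.exp_add]
    congr 1
    simp only [map_smul, norm_smul, norm_neg, Real.norm_eq_abs, Complex.ofReal_mul, mul_pow]
    have h1 : ((|s| : ℝ) : ℂ) ^ 2 = (s : ℂ) ^ 2 := by exact_mod_cast sq_abs s
    have h2 : ((|c| : ℝ) : ℂ) ^ 2 = 1 + (s : ℂ) ^ 2 := by
      have := (sq_abs c).trans hc2
      exact_mod_cast this
    rw [h1, h2]
    ring
  have hiff : ∀ x, c • x ∈ N ↔ x ∈ N := fun x => by
    refine ⟨fun h => ?_, fun h => hcon _ h _ hc0⟩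
    have := hcon _ h c⁻¹ (by positivity)
    rwa [smul_smul, inv_mul_cancel₀ hc0.ne', one_smul] at this
  calc ∫⁻ b, ∫⁻ y, N.indicator 1 (y - s • b) ∂(gauss L) ∂(gauss L)
      = ∫⁻ x, N.indicator 1 x ∂((gauss L).map (fun b => (-s) • b) ∗ gauss L) := by
        rw [Measure.lintegral_conv hind, lintegral_map _ (by fun_prop)]
        · refine lintegral_congr fun b => lintegral_congr fun y => ?_
          congr 1
          rw [neg_smul]
          abel
        · exact Measurable.lintegral_prod_right'
            (f := fun p : Euc d × Euc d => N.indicator 1 (p.1 + p.2))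
            (hind.comp (by fun_prop))
    _ = gauss L N := by
        rw [hlaw, lintegral_map hind (by fun_prop), ← lintegral_indicator_one hN]
        refine lintegral_congr fun x => ?_
        exact indicator_one_congr (hiff x)

theorem lintegral_gauss_rejection (L : Submodule ℝ (Euc d)) (hL : 2 ≤ Module.finrank ℝ L)
    {P : Set (Euc d)} (hP : MeasurableSet P) (hcon : IsConic P) :
    ∫⁻ a, ∫⁻ x, P.indicator 1 (rejection x a) ∂(gauss L) ∂(gauss L) = gauss L P := by
  have hind : Measurable (P.indicator (1 : Euc d → ℝ≥0∞)) := measurable_one.indicator hP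
  have hP' : MeasurableSet (((↑) : L → Euc d) ⁻¹' P) := hP.preimage (by fun_prop)
  have h := lintegral_rejection hL hP' (fun x hx r hr => hcon _ hx r hr)
  rw [gauss_eq_map_coe, Measure.map_apply (by fun_prop) hP, ← h, lintegral_map _ (by fun_prop)]
  · refine lintegral_congr fun a => ?_
    rw [lintegral_map _ (by fun_prop)]
    · rfl
    · exact hind.comp (measurable_rejection.comp (measurable_id.prodMk measurable_const))
  · exact Measurable.lintegral_prod_right'
      (f := fun p : Euc d × Euc d => P.indicator 1 (rejection p.2 p.1))
      (hind.comp (measurable_rejection.comp measurable_swap))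

/-- The intersection of a subspace with an independent isotropic hyperplane. -/
theorem lintegral_stdGaussian_section (L : Submodule ℝ (Euc d)) (hL : 2 ≤ Module.finrank ℝ L)
    {P N : Set (Euc d)} (hP : MeasurableSet P) (hN : MeasurableSet N) (hPc : IsConic P)
    (hNc : IsConic N) :
    ∫⁻ g, stdGaussian (Euc d) {z | rejection (L.starProjection z) (L.starProjection g) ∈ P ∧
        Lᗮ.starProjection z - (⟪L.starProjection z, L.starProjection g⟫ /
          ‖L.starProjection g‖ ^ 2) • Lᗮ.starProjection g ∈ N} ∂(stdGaussian (Euc d)) =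
      gauss L P * gauss Lᗮ N := by
  have hiP : Measurable (P.indicator (1 : Euc d → ℝ≥0∞)) := measurable_one.indicator hP
  have hiN : Measurable (N.indicator (1 : Euc d → ℝ≥0∞)) := measurable_one.indicator hN
  set F : Euc d → Euc d → Euc d → Euc d → ℝ≥0∞ := fun a b x y =>
    P.indicator 1 (rejection x a) * N.indicator 1 (y - (⟪x, a⟫ / ‖a‖ ^ 2) • b) with hF
  have hFm : Measurable fun p : (Euc d × Euc d) × (Euc d × Euc d) =>
      F p.1.1 p.1.2 p.2.1 p.2.2 := by
    refine Measurable.mul ?_ ?_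
    · exact hiP.comp (measurable_rejection.comp
        (f := fun p : (Euc d × Euc d) × (Euc d × Euc d) => (p.2.1, p.1.1)) (by fun_prop))
    · exact hiN.comp (f := fun p : (Euc d × Euc d) × (Euc d × Euc d) =>
        p.2.2 - (⟪p.2.1, p.1.1⟫ / ‖p.1.1‖ ^ 2) • p.1.2) (by fun_prop)
  have hset : ∀ g, stdGaussian (Euc d) {z |
      rejection (L.starProjection z) (L.starProjection g) ∈ P ∧
        Lᗮ.starProjection z - (⟪L.starProjection z, L.starProjection g⟫ /
          ‖L.starProjection g‖ ^ 2) • Lᗮ.starProjection g ∈ N} =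
      ∫⁻ x, ∫⁻ y, F (L.starProjection g) (Lᗮ.starProjection g) x y ∂(gauss Lᗮ) ∂(gauss L) := by
    intro g
    rw [← lintegral_stdGaussian_eq L
      (f := fun x y => F (L.starProjection g) (Lᗮ.starProjection g) x y)
      (hFm.comp (f := fun q => ((L.starProjection g, Lᗮ.starProjection g), q)) (by fun_prop)),
      ← lintegral_indicator_one]
    · refine lintegral_congr fun z => ?_
      exact (indicator_one_mul_indicator_one Iff.rfl).symm
    · refine MeasurableSet.inter (s₁ := {z | _}) (s₂ := {z | _}) ?_ ?_
      · exact hP.preimage (measurable_rejection.comp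
          (f := fun z => (L.starProjection z, L.starProjection g)) (by fun_prop))
      · exact hN.preimage (f := fun z => Lᗮ.starProjection z -
          (⟪L.starProjection z, L.starProjection g⟫ /
          ‖L.starProjection g‖ ^ 2) • Lᗮ.starProjection g) (by fun_prop)
  simp_rw [hset]
  have hFx : Measurable fun p : (Euc d × Euc d) × Euc d =>
      ∫⁻ y, F p.1.1 p.1.2 p.2 y ∂(gauss Lᗮ) :=
    Measurable.lintegral_prod_right'
      (f := fun p : ((Euc d × Euc d) × Euc d) × Euc d => F p.1.1.1 p.1.1.2 p.1.2 p.2)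
      (hFm.comp (f := fun p : ((Euc d × Euc d) × Euc d) × Euc d =>
        (p.1.1, (p.1.2, p.2))) (by fun_prop))
  rw [lintegral_stdGaussian_eq L
    (f := fun a b => ∫⁻ x, ∫⁻ y, F a b x y ∂(gauss Lᗮ) ∂(gauss L))
    (Measurable.lintegral_prod_right' hFx)]
  have hinner : ∀ a, ∫⁻ b, ∫⁻ x, ∫⁻ y, F a b x y ∂(gauss Lᗮ) ∂(gauss L) ∂(gauss Lᗮ) =
      (∫⁻ x, P.indicator 1 (rejection x a) ∂(gauss L)) * gauss Lᗮ N := by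
    intro a
    rw [lintegral_lintegral_swap (f := fun b x => ∫⁻ y, F a b x y ∂(gauss Lᗮ))
      (hFx.comp (f := fun p : Euc d × Euc d => ((a, p.1), p.2)) (by fun_prop)).aemeasurable,
      ← lintegral_mul_const _ (f := fun x => P.indicator 1 (rejection x a))
        (hiP.comp (measurable_rejection.comp (f := fun x => (x, a)) (by fun_prop)))]
    refine lintegral_congr fun x => ?_
    simp only [hF]
    rw [← lintegral_gauss_sub_smul Lᗮ hN hNc (⟪x, a⟫ / ‖a‖ ^ 2), ← lintegral_const_mul]
    · refine lintegral_congr fun b => ?_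
      rw [lintegral_const_mul]
      exact hiN.comp (by fun_prop)
    · exact Measurable.lintegral_prod_right' (f := fun p : Euc d × Euc d =>
        N.indicator 1 (p.2 - (⟪x, a⟫ / ‖a‖ ^ 2) • p.1)) (hiN.comp (by fun_prop))
  simp_rw [hinner]
  rw [lintegral_mul_const, lintegral_gauss_rejection L hL hP hPc]
  exact Measurable.lintegral_prod_right'
    (f := fun p : Euc d × Euc d => P.indicator 1 (rejection p.2 p.1))
    (hiP.comp (measurable_rejection.comp measurable_swap))

theorem map_toSphere_isometry (f : Euc d ≃ₗᵢ[ℝ] Euc d) :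
    ((sphNormalized d).map Subtype.val).map f = (sphNormalized d).map Subtype.val := by
  refine Measure.ext fun s hs => ?_
  have hs' : MeasurableSet (f ⁻¹' s) := hs.preimage (by fun_prop)
  rw [Measure.map_apply (by fun_prop) hs, Measure.map_apply (by fun_prop) hs',
    Measure.map_apply (by fun_prop) hs]
  simp only [sphNormalized, Measure.smul_apply, smul_eq_mul]
  congr 1
  rw [sphLebesgue, Measure.toSphere_apply' _ (hs'.preimage measurable_subtype_coe),
    Measure.toSphere_apply' _ (hs.preimage measurable_subtype_coe)]
  congr 1
  symm
  rw [← f.measurePreserving.measure_preimage_equiv (f := f.toMeasurableEquiv)]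
  congr 1
  ext x
  simp only [mem_preimage, mem_smul, mem_image]
  constructor
  · rintro ⟨r, hr, -, ⟨u, hu, rfl⟩, h⟩
    refine ⟨r, hr, _, ⟨⟨f.symm u, by simp⟩, by simpa using hu, rfl⟩, f.injective ?_⟩
    exact (map_smul f r _).trans ((congrArg (r • ·) (f.apply_symm_apply (u : Euc d))).trans h)
  · rintro ⟨r, hr, -, ⟨u, hu, rfl⟩, rfl⟩
    exact ⟨r, hr, _, ⟨⟨f u, by simp⟩, hu, rfl⟩, (map_smul f r (u : Euc d)).symm⟩

theorem isProbabilityMeasure_sphNormalized (hd : 1 ≤ d) :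
    IsProbabilityMeasure (sphNormalized d) := by
  have : Nontrivial (Euc d) := Module.nontrivial_of_finrank_pos (R := ℝ) (by simp; omega)
  constructor
  rw [sphNormalized, Measure.smul_apply, smul_eq_mul]
  refine ENNReal.inv_mul_cancel ?_ ?_
  · rw [Ne, Measure.measure_univ_eq_zero]
    exact Measure.toSphere_ne_zero _
  · rw [sphLebesgue, Measure.toSphere_apply_univ]
    exact ENNReal.mul_ne_top (by simp) measure_ball_lt_top.ne

theorem map_coe_sphNormalized (hd : 1 ≤ d) :
    (sphNormalized d).map Subtype.val = (stdGaussian (Euc d)).map fun x => ‖x‖⁻¹ • x := by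
  have : Nontrivial (Euc d) := Module.nontrivial_of_finrank_pos (R := ℝ) (by simp; omega)
  have := isProbabilityMeasure_sphNormalized hd
  have : IsProbabilityMeasure ((sphNormalized d).map Subtype.val) :=
    Measure.isProbabilityMeasure_map (by fun_prop)
  refine eq_map_normalize_stdGaussian map_toSphere_isometry ?_
  rw [ae_map_iff (by fun_prop) (measurableSet_eq_fun (by fun_prop) (by fun_prop))]
  exact Filter.Eventually.of_forall fun u => by simp

theorem lintegral_sphNormalized (hd : 1 ≤ d) {f : Euc d → ℝ≥0∞} (hf : Measurable f)
    (hcon : ∀ x, ∀ r : ℝ, 0 < r → f (r • x) = f x) :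
    ∫⁻ u, f u ∂(sphNormalized d) = ∫⁻ x, f x ∂(stdGaussian (Euc d)) := by
  have : Nontrivial (Euc d) := Module.nontrivial_of_finrank_pos (R := ℝ) (by simp; omega)
  rw [← lintegral_map (f := f) (g := Subtype.val) hf (by fun_prop), map_coe_sphNormalized hd,
    lintegral_map hf (by fun_prop)]
  refine lintegral_congr_ae ?_
  filter_upwards [ae_stdGaussian_ne_zero] with x hx
  have : 0 < ‖x‖ := norm_pos_iff.2 hx
  exact hcon x _ (by positivity)

theorem ae_sphNormalized_notMem (hd : 1 ≤ d) {K : Set (Euc d)} (hK : MeasurableSet K)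
    (hcon : ∀ x, ∀ r : ℝ, 0 < r → (r • x ∈ K ↔ x ∈ K)) (h0 : volume K = 0) :
    ∀ᵐ u : Metric.sphere (0 : Euc d) 1 ∂(sphNormalized d), (u : Euc d) ∉ K := by
  have h := lintegral_sphNormalized hd (f := K.indicator 1) (measurable_one.indicator hK)
    (fun x r hr => indicator_one_congr (hcon x r hr))
  rw [lintegral_indicator_one hK, stdGaussian_absolutelyContinuous h0,
    lintegral_eq_zero_iff (f := fun u : Metric.sphere (0 : Euc d) 1 => K.indicator 1 (u : Euc d))
      ((measurable_one.indicator hK).comp measurable_subtype_coe)] at h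
  filter_upwards [h] with u hu hmem
  simp [hmem] at hu

end Gaussian

section Faces

variable {m : ℕ} {v : Fin m → Euc d} {J : Fin m → Bool} {A : Set (Euc d)} {k : ℕ}

theorem ae_gauss_inner_ne_zero {L : Submodule ℝ (Euc d)} {w : Euc d} (h : w ∉ Lᗮ) :
    ∀ᵐ x ∂(gauss L), ⟪w, x⟫ ≠ 0 := by
  have h0 : gauss L (ℝ ∙ w)ᗮ = 0 := gauss_submodule fun hle => h fun x hx =>
    Submodule.mem_orthogonal_singleton_iff_inner_left.1 (hle hx)
  rw [ae_iff]
  convert h0 using 2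
  ext x
  simp only [mem_ofPred_eq, not_not, SetLike.mem_coe]
  exact Submodule.mem_orthogonal_singleton_iff_inner_right.symm

/-- The contribution of the face indexed by `J` to the curvature measures of `polyCone v`. -/
noncomputable def faceMass (v : Fin m → Euc d) (J : Fin m → Bool) (A : Set (Euc d)) : ℝ≥0∞ :=
  gauss (faceSpan v J) (relFace v J ∩ A) * gauss (faceSpan v J)ᗮ (genCone v J)

theorem gauss_inter_faceSpan (h : (relFace v J).Nonempty) :
    gauss (faceSpan v J) (polyCone v ∩ faceSpan v J ∩ A) =
      gauss (faceSpan v J) (relFace v J ∩ A) := by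
  obtain ⟨x₀, hx₀⟩ := h
  refine measure_congr ?_
  have h1 : ∀ᵐ x ∂(gauss (faceSpan v J)), ∀ i, J i = false → ⟪v i, x⟫ ≠ 0 := by
    refine ae_all_iff.2 fun i => ?_
    by_cases hi : J i = false
    · have h2 : v i ∉ (faceSpan v J)ᗮ := fun hmem => by
        have h3 := hx₀ i
        have h4 := hmem x₀ (relFace_subset_faceSpan hx₀)
        rw [real_inner_comm] at h4
        simp only [hi, h4] at h3
        simp at h3
      filter_upwards [ae_gauss_inner_ne_zero h2] with x hx _ using hx
    · exact Filter.Eventually.of_forall fun x hx => absurd hx hi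
  filter_upwards [h1] with x hx
  refine propext ⟨?_, fun hm => ⟨⟨relFace_subset_polyCone hm.1, relFace_subset_faceSpan hm.1⟩,
    hm.2⟩⟩
  rintro ⟨⟨hp, hs⟩, hxA⟩
  refine ⟨fun i => ?_, hxA⟩
  by_cases hi : J i = true
  · simpa [hi] using hs i hi
  · simpa [hi] using lt_of_le_of_ne (hp i) (hx i (by simpa using hi))

theorem Phi_polyCone (v : Fin m → Euc d) (A : Set (Euc d)) (k : ℕ) :
    Phi k (polyCone v) A =
      ∑ J, if Module.finrank ℝ (faceSpan v J) = k then faceMass v J A else 0 := by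
  classical
  set S : Set (Fin m → Bool) :=
    {J | (relFace v J).Nonempty ∧ Module.finrank ℝ (faceSpan v J) = k} with hS
  have hmem : ∀ J : S, IsFaceDim (polyCone v) (polyCone v ∩ faceSpan v J.1) k := fun J =>
    ⟨isFace_inter_faceSpan J.2.1, by rw [dimS, linHull_inter_faceSpan J.2.1]; exact J.2.2⟩
  set e : S → {F : Set (Euc d) // IsFaceDim (polyCone v) F k} :=
    fun J => ⟨polyCone v ∩ faceSpan v J.1, hmem J⟩ with he
  have hbij : Function.Bijective e := by
    refine ⟨fun J J' h => Subtype.ext (eq_of_inter_faceSpan_eq J.2.1 J'.2.1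
      (congrArg Subtype.val h)), ?_⟩
    rintro ⟨F, hF, hk⟩
    obtain ⟨J, hJ, rfl⟩ := exists_eq_inter_faceSpan hF
    refine ⟨⟨J, hJ, ?_⟩, rfl⟩
    rwa [dimS, linHull_inter_faceSpan hJ] at hk
  have h1 : Phi k (polyCone v) A = ∑' J : S, faceMass v J.1 A := by
    rw [Phi, ← (Equiv.ofBijective e hbij).tsum_eq]
    refine tsum_congr fun J => ?_
    simp only [Equiv.ofBijective_apply, he]
    rw [linHull_inter_faceSpan J.2.1, normalCone_inter_faceSpan J.2.1,
      gauss_inter_faceSpan J.2.1, faceMass]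
  rw [h1, tsum_subtype S (fun J => faceMass v J A), tsum_fintype]
  refine Finset.sum_congr rfl fun J _ => ?_
  by_cases hk : Module.finrank ℝ (faceSpan v J) = k
  · by_cases hJ : (relFace v J).Nonempty
    · rw [indicator_of_mem (show J ∈ S from ⟨hJ, hk⟩), if_pos hk]
    · rw [indicator_of_notMem (fun h => hJ h.1), if_pos hk, faceMass,
        not_nonempty_iff_eq_empty.1 hJ]
      simp
  · rw [indicator_of_notMem (fun h => hk h.2), if_neg hk]

theorem IsPolyCone.exists_polyCone {C : Set (Euc d)} (hC : IsPolyCone C) :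
    ∃ (m : ℕ) (v : Fin m → Euc d), C = polyCone v := by
  obtain ⟨U, rfl⟩ := hC
  refine ⟨U.card, fun i => U.equivFin.symm i, ?_⟩
  ext x
  simp only [mem_iInter, mem_ofPred_eq, polyCone]
  refine ⟨fun h i => h _ (U.equivFin.symm i).2, fun h u hu => ?_⟩
  have := h (U.equivFin ⟨u, hu⟩)
  rwa [Equiv.symm_apply_apply] at this

theorem Phi_eq_zero_of_lt {k : ℕ} (hk : d < k) (C A : Set (Euc d)) : Phi k C A = 0 := by
  have : IsEmpty {F : Set (Euc d) // IsFaceDim C F k} := by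
    refine ⟨fun ⟨F, _, hF⟩ => ?_⟩
    have := Submodule.finrank_le (linHull F)
    rw [finrank_euclideanSpace_fin] at this
    unfold dimS at hF
    omega
  rw [Phi, tsum_empty]

theorem Phi_eq_zero_of_subset {k : ℕ} (hk : 1 ≤ k) {C : Set (Euc d)} (hC : C ⊆ {0})
    (A : Set (Euc d)) : Phi k C A = 0 := by
  have : IsEmpty {F : Set (Euc d) // IsFaceDim C F k} := by
    refine ⟨fun ⟨F, ⟨hext, _⟩, hF⟩ => ?_⟩
    have h : linHull F = ⊥ := Submodule.span_eq_bot.2 fun x hx => hC (hext.1 hx)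
    rw [dimS, h, finrank_bot] at hF
    omega
  rw [Phi, tsum_empty]

theorem measurableSet_relFace :
    MeasurableSet {p : (Fin m → Euc d) × Euc d | p.2 ∈ relFace p.1 J} := by
  have : {p : (Fin m → Euc d) × Euc d | p.2 ∈ relFace p.1 J} =
      ⋂ i, {p | if J i = true then ⟪p.1 i, p.2⟫ = 0 else ⟪p.1 i, p.2⟫ < 0} := by
    ext p
    simp [relFace]
  rw [this]
  refine MeasurableSet.iInter fun i => ?_
  split_ifs
  · exact measurableSet_eq_fun (by fun_prop) (by fun_prop)
  · exact measurableSet_lt (by fun_prop) (by fun_prop)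

theorem measurableSet_genCone :
    MeasurableSet {p : (Fin m → Euc d) × Euc d | p.2 ∈ genCone p.1 J} := by
  have : {p : (Fin m → Euc d) × Euc d | p.2 ∈ genCone p.1 J} =
      ⋃ N : ℕ, Prod.fst '' {q : ((Fin m → Euc d) × Euc d) × Icc (0 : Fin m → ℝ) (fun _ => (N : ℝ)) |
        q.1.2 = ∑ i, (q.2 : Fin m → ℝ) i • (if J i = true then q.1.1 i else 0)} := by
    ext p
    simp only [genCone, mem_ofPred_eq, mem_iUnion, mem_image]
    constructor
    · rintro ⟨t, ht, h⟩
      obtain ⟨N, hN⟩ := exists_nat_ge (∑ i, t i)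
      refine ⟨N, (p, ⟨t, ht, fun i => ?_⟩), h, rfl⟩
      exact (Finset.single_le_sum (fun j _ => ht j) (Finset.mem_univ i)).trans hN
    · rintro ⟨N, ⟨p, t⟩, h, rfl⟩
      exact ⟨t, t.2.1, h⟩
  rw [this]
  refine MeasurableSet.iUnion fun N => IsClosed.measurableSet ?_
  refine isClosedMap_fst_of_compactSpace _ (isClosed_eq (by fun_prop) ?_)
  refine continuous_finsetSum _ fun i _ => Continuous.smul
    ((continuous_apply i).comp (continuous_subtype_val.comp continuous_snd)) ?_
  split_ifs <;> fun_prop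

theorem mem_genCone_orthogonal {w : Euc d} (hw : w ∈ genCone v J) : w ∈ (faceSpan v J)ᗮ := by
  obtain ⟨t, -, rfl⟩ := hw
  refine Submodule.sum_mem _ fun i _ => Submodule.smul_mem _ _ ?_
  split_ifs with h
  · intro x hx
    rw [real_inner_comm]
    exact hx i h
  · exact zero_mem _

theorem measurableSet_relFace_right : MeasurableSet (relFace v J) :=
  measurableSet_relFace.preimage (f := fun x => (v, x)) (by fun_prop)

theorem measurableSet_genCone_right : MeasurableSet (genCone v J) :=
  measurableSet_genCone.preimage (f := fun x => (v, x)) (by fun_prop)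

theorem isConic_relFace : IsConic (relFace v J) := by
  intro x hx r hr i
  have := hx i
  rw [inner_smul_right]
  split_ifs at this ⊢
  · rw [this, mul_zero]
  · exact mul_neg_of_pos_of_neg hr this

theorem isConic_genCone : IsConic (genCone v J) := by
  rintro _ ⟨t, ht, rfl⟩ r hr
  refine ⟨fun i => r * t i, fun i => mul_nonneg hr.le (ht i), ?_⟩
  simp only [Finset.smul_sum, smul_smul]

theorem faceMass_eq (hA : MeasurableSet A) : faceMass v J A =
    stdGaussian (Euc d) {z | ∃ x, x ∈ relFace v J ∩ A ∧ z - x ∈ genCone v J} := by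
  rw [faceMass, gauss_mul_gauss_orthogonal _ (measurableSet_relFace_right.inter hA)
    measurableSet_genCone_right]
  congr 1
  ext z
  constructor
  · rintro ⟨h1, h2⟩
    refine ⟨_, h1, ?_⟩
    rwa [Submodule.starProjection_orthogonal_val] at h2
  · rintro ⟨x, h1, h2⟩
    have h3 := relFace_subset_faceSpan h1.1
    have h4 : (faceSpan v J).starProjection z = x := by
      conv_lhs => rw [← sub_add_cancel z x]
      rw [map_add, Submodule.starProjection_eq_self_iff.2 h3,
        (Submodule.starProjection_apply_eq_zero_iff _).2 (mem_genCone_orthogonal h2), zero_add]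
    refine ⟨by rwa [h4], ?_⟩
    rwa [Submodule.starProjection_orthogonal_val, h4]

theorem measurable_faceMass (J : Fin m → Bool) (hA : MeasurableSet A) :
    Measurable fun v : Fin m → Euc d => faceMass v J A := by
  simp_rw [faceMass_eq hA]
  set S : Set (((Fin m → Euc d) × Euc d) × Euc d) :=
    {q | (q.1.1, q.2) ∈ {p : (Fin m → Euc d) × Euc d | p.2 ∈ relFace p.1 J} ∧ q.2 ∈ A ∧
      (q.1.1, q.1.2 - q.2) ∈ {p : (Fin m → Euc d) × Euc d | p.2 ∈ genCone p.1 J}} with hS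
  have hSm : MeasurableSet S := by
    refine (measurableSet_relFace.preimage
      (f := fun q : ((Fin m → Euc d) × Euc d) × Euc d => (q.1.1, q.2)) (by fun_prop)).inter
      ((hA.preimage (f := fun q : ((Fin m → Euc d) × Euc d) × Euc d => q.2)
        (by fun_prop)).inter (measurableSet_genCone.preimage
        (f := fun q : ((Fin m → Euc d) × Euc d) × Euc d => (q.1.1, q.1.2 - q.2)) (by fun_prop)))
  have hinj : InjOn Prod.fst S := by
    rintro ⟨⟨v, z⟩, x⟩ ⟨h1, -, h2⟩ ⟨⟨v', z'⟩, x'⟩ ⟨h1', -, h2'⟩ heq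
    obtain ⟨rfl, rfl⟩ := Prod.mk.inj heq
    have aux : ∀ {x : Euc d}, x ∈ relFace v J → z - x ∈ genCone v J →
        (faceSpan v J).starProjection z = x := by
      intro x h1 h2
      conv_lhs => rw [← sub_add_cancel z x]
      rw [map_add, Submodule.starProjection_eq_self_iff.2 (relFace_subset_faceSpan h1),
        (Submodule.starProjection_apply_eq_zero_iff _).2 (mem_genCone_orthogonal h2), zero_add]
    exact Prod.ext rfl ((aux h1 h2).symm.trans (aux h1' h2'))
  have h1 : StandardBorelSpace (Fin m → Euc d) := inferInstance
  have h2 : StandardBorelSpace ((Fin m → Euc d) × Euc d) := inferInstance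
  have him := hSm.image_of_measurable_injOn measurable_fst hinj
  convert measurable_measure_prodMk_left him (ν := stdGaussian (Euc d)) using 2 with v
  congr 1
  ext z
  simp [hS, and_assoc]

theorem measurableSet_finrank_faceSpan (J : Fin m → Bool) (k : ℕ) :
    MeasurableSet {v : Fin m → Euc d | Module.finrank ℝ (faceSpan v J) = k} := by
  set f : (Fin m → Euc d) → (Euc d →L[ℝ] Fin m → ℝ) := fun v =>
    ContinuousLinearMap.pi fun i => innerSL ℝ (if J i = true then v i else 0) with hf
  have hcont : Continuous f := by
    refine continuous_clm_apply.2 fun x => continuous_pi fun i => ?_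
    by_cases hi : J i = true
    · simp only [hf, hi, if_true, ContinuousLinearMap.coe_pi', innerSL_apply_apply]
      fun_prop
    · simp only [hf, hi, ContinuousLinearMap.coe_pi', innerSL_apply_apply]
      simpa using continuous_const
  have hker : ∀ v, faceSpan v J = LinearMap.ker (f v : Euc d →ₗ[ℝ] Fin m → ℝ) := fun v => by
    ext x
    rw [LinearMap.mem_ker, funext_iff]
    refine forall_congr' fun i => ?_
    by_cases hi : J i = true <;> simp [hf, hi]
  have hopen : ∀ n : ℕ, MeasurableSet {v | n ≤ Module.finrank ℝ
      (LinearMap.range (f v : Euc d →ₗ[ℝ] Fin m → ℝ))} := fun n => by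
    convert ((isOpen_setOfPred_nat_le_rank (𝕜 := ℝ) (E := Euc d) (F := Fin m → ℝ)
      n).preimage hcont).measurableSet using 1
    ext v
    simp only [mem_ofPred_eq, mem_preimage, LinearMap.rank, ← Module.finrank_eq_rank,
      Nat.cast_le]
  have hsum : ∀ v, Module.finrank ℝ (LinearMap.range (f v : Euc d →ₗ[ℝ] Fin m → ℝ)) +
      Module.finrank ℝ (faceSpan v J) = d := fun v => by
    rw [hker, LinearMap.finrank_range_add_finrank_ker, finrank_euclideanSpace_fin]
  by_cases hk : k ≤ d
  · convert (hopen (d - k)).diff (hopen (d - k + 1)) using 1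
    ext v
    have := hsum v
    simp only [mem_ofPred_eq, mem_sdiff]
    omega
  · convert MeasurableSet.empty using 1
    ext v
    have := hsum v
    simp only [mem_ofPred_eq, mem_empty_iff_false, iff_false]
    omega

theorem measurable_Phi_polyCone (hA : MeasurableSet A) (k : ℕ) :
    Measurable fun v : Fin m → Euc d => Phi k (polyCone v) A := by
  simp_rw [Phi_polyCone]
  exact Finset.measurable_sum _ fun J _ =>
    (measurable_faceMass J hA).ite (measurableSet_finrank_faceSpan J k) measurable_const

end Faces

section Splitting

variable {m : ℕ} {v : Fin m → Euc d} {u : Euc d} {J : Fin m → Bool} {A : Set (Euc d)} {k : ℕ}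

theorem polyCone_cons : polyCone (Fin.cons u v : Fin (m + 1) → Euc d) =
    polyCone v ∩ {x | ⟪u, x⟫ ≤ 0} := by
  ext x
  simp [polyCone, Fin.forall_fin_succ, and_comm]

theorem faceSpan_cons_false : faceSpan (Fin.cons u v : Fin (m + 1) → Euc d)
    (Fin.cons false J : Fin (m + 1) → Bool) = faceSpan v J := by
  ext x
  change (∀ i, _) ↔ ∀ i, _
  simp [Fin.forall_fin_succ]

theorem faceSpan_cons_true : faceSpan (Fin.cons u v : Fin (m + 1) → Euc d)
    (Fin.cons true J : Fin (m + 1) → Bool) = faceSpan v J ⊓ (ℝ ∙ u)ᗮ := by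
  ext x
  rw [Submodule.mem_inf, Submodule.mem_orthogonal_singleton_iff_inner_right, and_comm]
  change (∀ i, _) ↔ _ ∧ ∀ i, _
  simp [Fin.forall_fin_succ]

theorem relFace_cons_false : relFace (Fin.cons u v : Fin (m + 1) → Euc d)
    (Fin.cons false J : Fin (m + 1) → Bool) = relFace v J ∩ {x | ⟪u, x⟫ < 0} := by
  ext x
  simp [relFace, Fin.forall_fin_succ, and_comm]

theorem relFace_cons_true : relFace (Fin.cons u v : Fin (m + 1) → Euc d)
    (Fin.cons true J : Fin (m + 1) → Bool) = relFace v J ∩ {x | ⟪u, x⟫ = 0} := by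
  ext x
  simp [relFace, Fin.forall_fin_succ, and_comm]

theorem genCone_cons_false : genCone (Fin.cons u v : Fin (m + 1) → Euc d)
    (Fin.cons false J : Fin (m + 1) → Bool) = genCone v J := by
  ext w
  constructor
  · rintro ⟨t, ht, rfl⟩
    exact ⟨fun i => t i.succ, fun i => ht _, by simp [Fin.sum_univ_succ]⟩
  · rintro ⟨t, ht, rfl⟩
    exact ⟨Fin.cons 0 t, Fin.cases (by simp) (by simpa using ht), by simp [Fin.sum_univ_succ]⟩

theorem mem_genCone_cons_true {w : Euc d} : w ∈ genCone (Fin.cons u v : Fin (m + 1) → Euc d)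
    (Fin.cons true J : Fin (m + 1) → Bool) ↔ ∃ t : ℝ, 0 ≤ t ∧ w - t • u ∈ genCone v J := by
  constructor
  · rintro ⟨t, ht, rfl⟩
    exact ⟨t 0, ht 0, fun i => t i.succ, fun i => ht _, by simp [Fin.sum_univ_succ]⟩
  · rintro ⟨s, hs, t, ht, h⟩
    refine ⟨Fin.cons s t, Fin.cases (by simpa using hs) (by simpa using ht), ?_⟩
    rw [sub_eq_iff_eq_add] at h
    simp [Fin.sum_univ_succ, h, add_comm]

theorem ae_notMem_submodule (hd : 1 ≤ d) {V : Submodule ℝ (Euc d)} (hV : V ≠ ⊤) :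
    ∀ᵐ u : Metric.sphere (0 : Euc d) 1 ∂(sphNormalized d), (u : Euc d) ∉ V :=
  ae_sphNormalized_notMem hd (K := V) V.closed_of_finiteDimensional.measurableSet
    (fun _ _ hr => V.smul_mem_iff hr.ne') (Measure.addHaar_submodule _ _ hV)

theorem orthogonal_ne_top {L : Submodule ℝ (Euc d)} (hL : 1 ≤ Module.finrank ℝ L) : Lᗮ ≠ ⊤ := by
  rw [Ne, Submodule.orthogonal_eq_top_iff]
  rintro rfl
  simp at hL

theorem faceMass_cons_false_add (hu : u ∉ (faceSpan v J)ᗮ) :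
    faceMass (Fin.cons u v : Fin (m + 1) → Euc d) (Fin.cons false J : Fin (m + 1) → Bool) A +
      faceMass (Fin.cons (-u) v : Fin (m + 1) → Euc d) (Fin.cons false J : Fin (m + 1) → Bool) A =
    faceMass v J A := by
  simp only [faceMass, faceSpan_cons_false, relFace_cons_false, genCone_cons_false, ← add_mul]
  congr 1
  have hm : MeasurableSet {x : Euc d | ⟪u, x⟫ < 0} := measurableSet_lt (by fun_prop) (by fun_prop)
  rw [← measure_inter_add_sdiff (relFace v J ∩ A) hm]
  congr 1
  · congr 1
    ext x
    simp only [mem_inter_iff, mem_ofPred_eq]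
    tauto
  · refine measure_congr ?_
    filter_upwards [ae_gauss_inner_ne_zero hu] with x hx
    refine propext ?_
    change (_ ∧ ⟪-u, x⟫ < 0) ∧ _ ↔ (_ ∧ _) ∧ ¬ ⟪u, x⟫ < 0
    rw [inner_neg_left, neg_lt_zero, not_lt, le_iff_lt_or_eq]
    have : 0 ≠ ⟪u, x⟫ := Ne.symm hx
    tauto

theorem finrank_inf_orthogonal_singleton {L : Submodule ℝ (Euc d)} (hu : u ∉ Lᗮ) :
    Module.finrank ℝ (L ⊓ (ℝ ∙ u)ᗮ : Submodule ℝ (Euc d)) + 1 = Module.finrank ℝ L := by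
  have h := LinearMap.finrank_range_add_finrank_ker
    ((innerSL ℝ u : Euc d →ₗ[ℝ] ℝ).comp L.subtype)
  have h1 : LinearMap.range ((innerSL ℝ u : Euc d →ₗ[ℝ] ℝ).comp L.subtype) = ⊤ := by
    refine LinearMap.range_eq_top.2 (LinearMap.surjective fun h0 => hu fun x hx => ?_)
    rw [real_inner_comm]
    exact LinearMap.congr_fun h0 ⟨x, hx⟩
  have h2 : L ⊓ (ℝ ∙ u)ᗮ =
      (LinearMap.ker ((innerSL ℝ u : Euc d →ₗ[ℝ] ℝ).comp L.subtype)).map L.subtype := by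
    ext x
    simp [Submodule.mem_orthogonal_singleton_iff_inner_right, and_comm]
  rw [h1, finrank_top, Module.finrank_self] at h
  rw [h2, LinearEquiv.finrank_eq (Submodule.equivSubtypeMap _ _).symm, ← h, add_comm]

/-- The probability, for a Gaussian vector `z`, that the nearest point to `z` in the section of the
face indexed by `J` with the hyperplane `g^⊥` lies in `A`. -/
noncomputable def sectionMass (v : Fin m → Euc d) (J : Fin m → Bool) (A : Set (Euc d))
    (g : Euc d) : ℝ≥0∞ :=
  stdGaussian (Euc d) {z |
    rejection ((faceSpan v J).starProjection z) ((faceSpan v J).starProjection g) ∈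
      relFace v J ∩ A ∧
    (faceSpan v J)ᗮ.starProjection z - (⟪(faceSpan v J).starProjection z,
      (faceSpan v J).starProjection g⟫ / ‖(faceSpan v J).starProjection g‖ ^ 2) •
        (faceSpan v J)ᗮ.starProjection g ∈ genCone v J}

theorem measurableSet_section (v : Fin m → Euc d) (J : Fin m → Bool) (hA : MeasurableSet A) :
    MeasurableSet {p : Euc d × Euc d |
    rejection ((faceSpan v J).starProjection p.2) ((faceSpan v J).starProjection p.1) ∈
      relFace v J ∩ A ∧
    (faceSpan v J)ᗮ.starProjection p.2 - (⟪(faceSpan v J).starProjection p.2,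
      (faceSpan v J).starProjection p.1⟫ / ‖(faceSpan v J).starProjection p.1‖ ^ 2) •
        (faceSpan v J)ᗮ.starProjection p.1 ∈ genCone v J} :=
  ((measurableSet_relFace_right.inter hA).preimage (measurable_rejection.comp
    (f := fun p : Euc d × Euc d => ((faceSpan v J).starProjection p.2,
      (faceSpan v J).starProjection p.1)) (by fun_prop))).inter
    (measurableSet_genCone_right.preimage (by fun_prop))

theorem measurable_sectionMass (hA : MeasurableSet A) : Measurable (sectionMass v J A) :=
  measurable_measure_prodMk_left (measurableSet_section v J hA)

theorem sectionMass_smul (g : Euc d) {r : ℝ} (hr : r ≠ 0) :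
    sectionMass v J A (r • g) = sectionMass v J A g := by
  unfold sectionMass
  congr 1
  ext z
  have h1 : ∀ x a : Euc d, rejection x (r • a) = rejection x a := by
    intro x a
    rcases eq_or_ne a 0 with rfl | ha
    · rw [smul_zero]
    · have : ‖a‖ ≠ 0 := norm_ne_zero_iff.2 ha
      rw [rejection, rejection, smul_smul, inner_smul_right, norm_smul, mul_pow,
        Real.norm_eq_abs, sq_abs]
      congr 2
      field_simp
  have h2 : ∀ x a b : Euc d, (⟪x, r • a⟫ / ‖r • a‖ ^ 2) • (r • b) = (⟪x, a⟫ / ‖a‖ ^ 2) • b := by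
    intro x a b
    rcases eq_or_ne a 0 with rfl | ha
    · simp
    · have : ‖a‖ ≠ 0 := norm_ne_zero_iff.2 ha
      rw [smul_smul, inner_smul_right, norm_smul, mul_pow, Real.norm_eq_abs, sq_abs]
      congr 1
      field_simp
  simp only [map_smul, h1, h2]

theorem lintegral_sectionMass (hd : 1 ≤ d) (hA : MeasurableSet A) (hAc : IsConic A)
    (hJ : 2 ≤ Module.finrank ℝ (faceSpan v J)) :
    ∫⁻ u : Metric.sphere (0 : Euc d) 1, sectionMass v J A u ∂(sphNormalized d) =
      faceMass v J A := by
  rw [lintegral_sphNormalized hd (measurable_sectionMass hA)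
    fun x r hr => sectionMass_smul x hr.ne']
  exact lintegral_stdGaussian_section _ hJ (measurableSet_relFace_right.inter hA)
    measurableSet_genCone_right
    (fun x hx r hr => ⟨isConic_relFace x hx.1 r hr, hAc x hx.2 r hr⟩) isConic_genCone

theorem faceMass_cons_true (hA : MeasurableSet A) (hu : u ∉ (faceSpan v J)ᗮ) :
    faceMass (Fin.cons u v : Fin (m + 1) → Euc d) (Fin.cons true J : Fin (m + 1) → Bool) A =
      stdGaussian (Euc d) ({z |
        rejection ((faceSpan v J).starProjection z) ((faceSpan v J).starProjection u) ∈
          relFace v J ∩ A ∧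
        (faceSpan v J)ᗮ.starProjection z - (⟪(faceSpan v J).starProjection z,
          (faceSpan v J).starProjection u⟫ / ‖(faceSpan v J).starProjection u‖ ^ 2) •
            (faceSpan v J)ᗮ.starProjection u ∈ genCone v J} ∩
        {z | 0 ≤ ⟪(faceSpan v J).starProjection u, z⟫}) := by
  rw [faceMass_eq hA]
  congr 1
  set L := faceSpan v J with hL
  set a := L.starProjection u with ha
  have ha0 : a ≠ 0 := fun h => hu ((Submodule.starProjection_apply_eq_zero_iff L).1 h)
  have ha1 : 0 < ‖a‖ ^ 2 := by positivity
  have haL : a ∈ L := L.starProjection_apply_mem u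
  have hinn : ∀ x ∈ L, ∀ y, ⟪L.starProjection y, x⟫ = ⟪y, x⟫ := fun x hx y => by
    rw [Submodule.inner_starProjection_left_eq_right, Submodule.starProjection_eq_self_iff.2 hx]
  have haa : ⟪u, a⟫ = ‖a‖ ^ 2 := by
    rw [← hinn a haL u, real_inner_self_eq_norm_sq]
  ext z
  simp only [mem_ofPred_eq, mem_inter_iff, mem_genCone_cons_true, relFace_cons_true]
  rw [hinn a haL z, real_inner_comm z a]
  constructor
  · rintro ⟨x, ⟨⟨hxR, hux⟩, hxA⟩, t, ht, hN⟩
    have hxL : x ∈ L := relFace_subset_faceSpan hxR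
    have hN' := mem_genCone_orthogonal hN
    have h1 : L.starProjection z = x + t • a := by
      have := (Submodule.starProjection_apply_eq_zero_iff L).2 hN'
      rw [map_sub, map_sub, map_smul, Submodule.starProjection_eq_self_iff.2 hxL, sub_sub,
        sub_eq_zero] at this
      exact this
    have hxa : ⟪x, a⟫ = 0 := by
      rw [real_inner_comm, hinn x hxL u, hux]
    have h2 : ⟪z, a⟫ = t * ‖a‖ ^ 2 := by
      rw [← hinn a haL z, h1, inner_add_left, hxa, inner_smul_left, real_inner_self_eq_norm_sq]
      simp
    have h3 : ⟪z, a⟫ / ‖a‖ ^ 2 = t := by rw [h2, mul_div_cancel_right₀ _ ha1.ne']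
    refine ⟨⟨?_, ?_⟩, ?_⟩
    · rw [rejection, hinn a haL z, h3, h1, add_sub_cancel_right]
      exact ⟨hxR, hxA⟩
    · rw [h3]
      convert hN using 1
      rw [Submodule.starProjection_orthogonal_val, Submodule.starProjection_orthogonal_val, h1,
        smul_sub]
      abel
    · rw [h2]
      positivity
  · rintro ⟨⟨⟨hR, hRA⟩, hN⟩, hpos⟩
    refine ⟨_, ⟨⟨hR, ?_⟩, hRA⟩, ⟪z, a⟫ / ‖a‖ ^ 2, by positivity, ?_⟩
    · have h1 : L.starProjection z ∈ L := L.starProjection_apply_mem z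
      rw [rejection, inner_sub_right, inner_smul_right, hinn a haL z, haa,
        div_mul_cancel₀ _ ha1.ne', ← hinn _ h1 u, real_inner_comm, ← ha, hinn a haL z, sub_self]
    · convert hN using 1
      rw [rejection, hinn a haL z, Submodule.starProjection_orthogonal_val,
        Submodule.starProjection_orthogonal_val, smul_sub]
      abel

theorem faceMass_cons_true_add (hA : MeasurableSet A) (hu : u ∉ (faceSpan v J)ᗮ) :
    faceMass (Fin.cons u v : Fin (m + 1) → Euc d) (Fin.cons true J : Fin (m + 1) → Bool) A +
      faceMass (Fin.cons (-u) v : Fin (m + 1) → Euc d) (Fin.cons true J : Fin (m + 1) → Bool) A =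
    sectionMass v J A u := by
  rw [faceMass_cons_true hA hu, faceMass_cons_true hA (by rwa [neg_mem_iff])]
  set a := (faceSpan v J).starProjection u with ha
  have ha0 : a ≠ 0 := fun h => hu ((Submodule.starProjection_apply_eq_zero_iff _).1 h)
  have hm : MeasurableSet {z : Euc d | 0 ≤ ⟪a, z⟫} := measurableSet_le (by fun_prop) (by fun_prop)
  refine Eq.trans ?_ (measure_inter_add_sdiff _ hm)
  congr 1
  have hne : ∀ᵐ z ∂(stdGaussian (Euc d)), ⟪a, z⟫ ≠ 0 := by
    rw [ae_iff]
    convert stdGaussian_submodule (V := (ℝ ∙ a)ᗮ) ?_ using 2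
    · ext z
      simp [Submodule.mem_orthogonal_singleton_iff_inner_right]
    · rwa [Ne, Submodule.orthogonal_eq_top_iff, Submodule.span_singleton_eq_bot]
  refine measure_congr ?_
  filter_upwards [hne] with z hz
  refine propext ?_
  change (_ ∧ _) ∧ 0 ≤ ⟪(faceSpan v J).starProjection (-u), z⟫ ↔ (_ ∧ _) ∧ ¬ 0 ≤ ⟪a, z⟫
  have h1 : ∀ x a : Euc d, rejection x (-a) = rejection x a := by
    intro x a
    simp [rejection, neg_div]
  have hz' : ⟪a, z⟫ < 0 ↔ ⟪a, z⟫ ≤ 0 := ⟨le_of_lt, fun h => lt_of_le_of_ne h hz⟩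
  simp only [map_neg, h1, inner_neg_right, norm_neg, neg_div, smul_neg, neg_smul, neg_neg,
    inner_neg_left, not_le, ← ha, Left.nonneg_neg_iff, hz']

theorem Phi_polyCone_cons (u : Euc d) (v : Fin m → Euc d) (A : Set (Euc d)) (k : ℕ) :
    Phi k (polyCone (Fin.cons u v : Fin (m + 1) → Euc d)) A =
      ∑ J, ((if Module.finrank ℝ (faceSpan v J) = k then
        faceMass (Fin.cons u v : Fin (m + 1) → Euc d) (Fin.cons false J : Fin (m + 1) → Bool) A
          else 0) +
      if Module.finrank ℝ (faceSpan v J ⊓ (ℝ ∙ u)ᗮ : Submodule ℝ (Euc d)) = k then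
        faceMass (Fin.cons u v : Fin (m + 1) → Euc d) (Fin.cons true J : Fin (m + 1) → Bool) A
          else 0) := by
  rw [Phi_polyCone, ← (Fin.consEquiv fun _ : Fin (m + 1) => Bool).sum_comp,
    Fintype.sum_prod_type, Fintype.sum_bool, add_comm, ← Finset.sum_add_distrib]
  refine Finset.sum_congr rfl fun J _ => ?_
  change (if Module.finrank ℝ (faceSpan _ (Fin.cons false J : Fin (m + 1) → Bool)) = k then
    faceMass _ (Fin.cons false J : Fin (m + 1) → Bool) A else 0) +
    (if Module.finrank ℝ (faceSpan _ (Fin.cons true J : Fin (m + 1) → Bool)) = k then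
    faceMass _ (Fin.cons true J : Fin (m + 1) → Bool) A else 0) = _
  rw [faceSpan_cons_false, faceSpan_cons_true]

theorem lintegral_Phi_cons (hd : 1 ≤ d) (hA : MeasurableSet A) (hAc : IsConic A) (hk : 1 ≤ k)
    (v : Fin m → Euc d) :
    ∫⁻ u : Metric.sphere (0 : Euc d) 1,
      (Phi k (polyCone (Fin.cons (u : Euc d) v : Fin (m + 1) → Euc d)) A +
        Phi k (polyCone (Fin.cons (-(u : Euc d)) v : Fin (m + 1) → Euc d)) A) ∂(sphNormalized d) =
      Phi k (polyCone v) A + Phi (k + 1) (polyCone v) A := by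
  have := isProbabilityMeasure_sphNormalized hd
  have hae : ∀ᵐ u : Metric.sphere (0 : Euc d) 1 ∂(sphNormalized d), ∀ J : Fin m → Bool,
      1 ≤ Module.finrank ℝ (faceSpan v J) → (u : Euc d) ∉ (faceSpan v J)ᗮ := by
    refine ae_all_iff.2 fun J => ?_
    by_cases h : 1 ≤ Module.finrank ℝ (faceSpan v J)
    · filter_upwards [ae_notMem_submodule hd (orthogonal_ne_top h)] with u hu _ using hu
    · exact Filter.Eventually.of_forall fun u h' => absurd h' h
  have hsum : ∀ᵐ u : Metric.sphere (0 : Euc d) 1 ∂(sphNormalized d),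
      Phi k (polyCone (Fin.cons (u : Euc d) v : Fin (m + 1) → Euc d)) A +
        Phi k (polyCone (Fin.cons (-(u : Euc d)) v : Fin (m + 1) → Euc d)) A =
      Phi k (polyCone v) A + ∑ J, if Module.finrank ℝ (faceSpan v J) = k + 1 then
        sectionMass v J A u else 0 := by
    filter_upwards [hae] with u hu
    rw [Phi_polyCone_cons, Phi_polyCone_cons, Phi_polyCone, ← Finset.sum_add_distrib,
      ← Finset.sum_add_distrib]
    refine Finset.sum_congr rfl fun J _ => ?_
    have hspan : (ℝ ∙ -(u : Euc d)) = ℝ ∙ (u : Euc d) := by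
      simpa using Submodule.span_singleton_smul_eq (R := ℝ) (r := -1) (by simp) (u : Euc d)
    rw [add_add_add_comm, hspan]
    by_cases h1 : 1 ≤ Module.finrank ℝ (faceSpan v J)
    · have h2 := finrank_inf_orthogonal_singleton (hu J h1)
      congr 1
      · split_ifs
        · exact faceMass_cons_false_add (hu J h1)
        · exact add_zero _
      · by_cases h3 : Module.finrank ℝ (faceSpan v J) = k + 1
        · rw [if_pos (by omega), if_pos (by omega), if_pos h3]
          exact faceMass_cons_true_add hA (hu J h1)
        · rw [if_neg (by omega), if_neg (by omega), if_neg h3, add_zero]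
    · have h2 := Submodule.finrank_mono
        (inf_le_left : faceSpan v J ⊓ (ℝ ∙ (u : Euc d))ᗮ ≤ faceSpan v J)
      rw [if_neg (by omega), if_neg (by omega), if_neg (by omega), if_neg (by omega),
        if_neg (by omega), if_neg (by omega)]
      simp
  have hmeas : ∀ J : Fin m → Bool, Measurable fun u : Metric.sphere (0 : Euc d) 1 =>
      if Module.finrank ℝ (faceSpan v J) = k + 1 then sectionMass v J A u else 0 := fun J => by
    split_ifs
    · exact (measurable_sectionMass hA).comp measurable_subtype_coe
    · exact measurable_const
  rw [lintegral_congr_ae hsum, lintegral_add_left measurable_const, lintegral_const,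
    measure_univ, mul_one, lintegral_finsetSum _ fun J _ => hmeas J, Phi_polyCone v A (k + 1)]
  congr 1
  refine Finset.sum_congr rfl fun J _ => ?_
  split_ifs with h
  · exact lintegral_sectionMass hd hA hAc (by omega)
  · simp

end Splitting

section Expectation

variable {m n : ℕ} {A : Set (Euc d)} {k : ℕ}

/-- The family `u` with the sign of `u i` flipped whenever `ε i = false`. -/
def signed (ε : Fin n → Bool) (u : Fin n → Euc d) (i : Fin n) : Euc d :=
  if ε i = true then u i else -u i

theorem signed_cons (e : Bool) (ε : Fin n → Bool) (w : Euc d) (u : Fin n → Euc d) :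
    signed (Fin.cons e ε : Fin (n + 1) → Bool) (Fin.cons w u : Fin (n + 1) → Euc d) =
      Fin.cons (if e = true then w else -w) (signed ε u) := by
  ext i : 1
  refine Fin.cases ?_ (fun i => ?_) i <;> simp [signed]

theorem continuous_signed (ε : Fin n → Bool) :
    Continuous (signed ε : (Fin n → Euc d) → Fin n → Euc d) := by
  refine continuous_pi fun i => ?_
  unfold signed
  split_ifs <;> fun_prop

theorem polyCone_inter_polyCone (v : Fin m → Euc d) (w : Fin n → Euc d) :
    polyCone v ∩ polyCone w = polyCone (Fin.append v w) := by
  ext x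
  simp only [polyCone, mem_inter_iff, mem_ofPred_eq]
  constructor
  · exact fun h i => Fin.addCases (fun j => by simpa using h.1 j) (fun j => by simpa using h.2 j) i
  · exact fun h => ⟨fun i => by simpa using h (Fin.castAdd n i),
      fun i => by simpa using h (Fin.natAdd m i)⟩

theorem measurable_Phi_inter_signed (hA : MeasurableSet A) (k : ℕ) (v : Fin m → Euc d)
    (ε : Fin n → Bool) : Measurable fun u : Fin n → Metric.sphere (0 : Euc d) 1 =>
      Phi k (polyCone v ∩ polyCone (signed ε fun i => (u i : Euc d))) A := by
  simp_rw [polyCone_inter_polyCone]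
  refine (measurable_Phi_polyCone hA k).comp (measurable_pi_lambda _ fun i => ?_)
  refine Fin.addCases (fun j => ?_) (fun j => ?_) i
  · simp
  · simp only [Fin.append_right]
    exact (measurable_pi_apply j).comp ((continuous_signed ε).measurable.comp
      (f := fun (u : Fin n → Metric.sphere (0 : Euc d) 1) i => (u i : Euc d)) (by fun_prop))

theorem coe_comp_cons (w : Metric.sphere (0 : Euc d) 1) (u : Fin n → Metric.sphere (0 : Euc d) 1) :
    (fun i => ((Fin.cons w u : Fin (n + 1) → Metric.sphere (0 : Euc d) 1) i : Euc d)) =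
      Fin.cons (w : Euc d) fun i => (u i : Euc d) := by
  ext i : 1
  refine Fin.cases ?_ (fun i => ?_) i <;> simp

theorem measurePreserving_cons (hd : 1 ≤ d) (n : ℕ) :
    MeasurePreserving (fun p : Metric.sphere (0 : Euc d) 1 ×
      (Fin n → Metric.sphere (0 : Euc d) 1) =>
      (Fin.cons p.1 p.2 : Fin (n + 1) → Metric.sphere (0 : Euc d) 1))
      ((sphNormalized d).prod (sphPi d n)) (sphPi d (n + 1)) := by
  have := isProbabilityMeasure_sphNormalized hd
  have h := (measurePreserving_piFinSuccAbove
    (fun _ : Fin (n + 1) => sphNormalized d) 0).symm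
  convert h using 1
  · ext p : 1
    exact (Fin.insertNth_zero _ _).symm
  · rfl
  · rfl

theorem polyCone_cons_inter (w : Euc d) (v : Fin m → Euc d) (u : Fin n → Euc d) :
    polyCone v ∩ polyCone (Fin.cons w u : Fin (n + 1) → Euc d) =
      polyCone (Fin.cons w v : Fin (m + 1) → Euc d) ∩ polyCone u := by
  rw [polyCone_cons, polyCone_cons]
  ext x
  simp only [mem_inter_iff]
  tauto

theorem lintegral_sum_Phi_signed (hd : 1 ≤ d) (hA : MeasurableSet A) (hAc : IsConic A)
    (hk : 1 ≤ k) (v : Fin m → Euc d) :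
    ∫⁻ u : Fin n → Metric.sphere (0 : Euc d) 1, ∑ ε : Fin n → Bool,
      Phi k (polyCone v ∩ polyCone (signed ε fun i => (u i : Euc d))) A ∂(sphPi d n) =
    ∑ s ∈ Finset.range (n + 1), (n.choose s : ℝ≥0∞) * Phi (k + s) (polyCone v) A := by
  have := isProbabilityMeasure_sphNormalized hd
  induction n generalizing m v with
  | zero =>
    have : IsProbabilityMeasure (sphPi d 0) := by unfold sphPi; infer_instance
    simp [polyCone]
  | succ n ih =>
    have : IsProbabilityMeasure (sphPi d n) := by unfold sphPi; infer_instance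
    have hmeas : Measurable fun u : Fin (n + 1) → Metric.sphere (0 : Euc d) 1 =>
        ∑ ε, Phi k (polyCone v ∩ polyCone (signed ε fun i => (u i : Euc d))) A :=
      Finset.measurable_sum _ fun ε _ => measurable_Phi_inter_signed hA k v ε
    have hmp := measurePreserving_cons hd n
    rw [← hmp.lintegral_comp hmeas]
    refine (lintegral_prod _ (hmeas.comp hmp.measurable).aemeasurable).trans ?_
    have hinner : ∀ w : Metric.sphere (0 : Euc d) 1,
        ∫⁻ u : Fin n → Metric.sphere (0 : Euc d) 1, ∑ ε : Fin (n + 1) → Bool,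
          Phi k (polyCone v ∩ polyCone (signed ε fun i =>
            ((Fin.cons w u : Fin (n + 1) → Metric.sphere (0 : Euc d) 1) i : Euc d))) A
            ∂(sphPi d n) =
        ∑ s ∈ Finset.range (n + 1), (n.choose s : ℝ≥0∞) *
          (Phi (k + s) (polyCone (Fin.cons (w : Euc d) v : Fin (m + 1) → Euc d)) A +
          Phi (k + s) (polyCone (Fin.cons (-(w : Euc d)) v : Fin (m + 1) → Euc d)) A) := by
      intro w
      simp_rw [mul_add, Finset.sum_add_distrib, ← ih]
      rw [← lintegral_add_left (Finset.measurable_sum _ fun ε _ =>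
        measurable_Phi_inter_signed hA k _ ε)]
      refine lintegral_congr fun u => ?_
      rw [← (Fin.consEquiv fun _ : Fin (n + 1) => Bool).sum_comp, Fintype.sum_prod_type,
        Fintype.sum_bool, coe_comp_cons]
      have hcons : ∀ (e : Bool) (ε : Fin n → Bool),
          (Fin.consEquiv fun _ : Fin (n + 1) => Bool) (e, ε) = Fin.cons e ε := fun _ _ => rfl
      simp only [hcons, signed_cons, polyCone_cons_inter]
      simp
    refine (lintegral_congr hinner).trans ?_
    have hcons : ∀ (f : Euc d → Euc d) (s : ℕ), Measurable f →
        Measurable fun w : Metric.sphere (0 : Euc d) 1 =>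
          Phi (k + s) (polyCone (Fin.cons (f w) v : Fin (m + 1) → Euc d)) A := by
      refine fun f s hf => (measurable_Phi_polyCone hA _).comp (measurable_pi_lambda _ fun i => ?_)
      refine Fin.cases ?_ (fun i => ?_) i
      · exact hf.comp measurable_subtype_coe
      · simp
    refine (lintegral_finsetSum _ fun s _ => ((hcons (fun x => x) s measurable_id).add
      (hcons Neg.neg s measurable_neg)).const_mul _).trans ?_
    have h1 : ∀ s ∈ Finset.range (n + 1), ∫⁻ w : Metric.sphere (0 : Euc d) 1,
        (n.choose s : ℝ≥0∞) *
        (Phi (k + s) (polyCone (Fin.cons (w : Euc d) v : Fin (m + 1) → Euc d)) A +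
        Phi (k + s) (polyCone (Fin.cons (-(w : Euc d)) v : Fin (m + 1) → Euc d)) A)
          ∂(sphNormalized d) =
        (n.choose s : ℝ≥0∞) * Phi (k + s) (polyCone v) A +
        (n.choose s : ℝ≥0∞) * Phi (k + (s + 1)) (polyCone v) A := by
      intro s _
      rw [lintegral_const_mul' _ _ (by simp), lintegral_Phi_cons hd hA hAc (by omega), mul_add,
        add_assoc]
    refine (Finset.sum_congr rfl h1).trans ?_
    rw [Finset.sum_add_distrib, Finset.sum_range_succ' _ (n + 1)]
    simp_rw [Nat.choose_succ_succ, Nat.cast_add, add_mul, Finset.sum_add_distrib]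
    rw [Finset.sum_range_succ' _ n,
      Finset.sum_range_succ (fun s => (n.choose (s + 1) : ℝ≥0∞) * _) n]
    simp only [Nat.choose_succ_self, Nat.choose_zero_right, Nat.cast_zero, zero_mul, add_zero]
    abel

end Expectation

section Nondegenerate

variable {m n : ℕ} {v : Fin m → Euc d} {w : Euc d}

/-- The cone cut out by `v` has interior points where all constraints are strict, or is trivial. -/
def Nondegenerate (v : Fin m → Euc d) : Prop := (∃ x, ∀ i, ⟪v i, x⟫ < 0) ∨ polyCone v ⊆ {0}

/-- The polar of a set. -/
def polarSet (D : Set (Euc d)) : Set (Euc d) := {w | ∀ x ∈ D, ⟪w, x⟫ ≤ 0}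

theorem polarSet_eq_iInter (D : Set (Euc d)) : polarSet D = ⋂ x ∈ D, {w | ⟪w, x⟫ ≤ 0} := by
  ext w
  simp [polarSet]

theorem isClosed_polarSet (D : Set (Euc d)) : IsClosed (polarSet D) := by
  rw [polarSet_eq_iInter]
  exact isClosed_biInter fun x _ => isClosed_le (by fun_prop) continuous_const

theorem convex_polarSet (D : Set (Euc d)) : Convex ℝ (polarSet D) := by
  intro a ha b hb s t hs ht _ x hx
  rw [inner_add_left, inner_smul_left, inner_smul_left]
  have h1 := mul_nonpos_of_nonneg_of_nonpos hs (ha x hx)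
  have h2 := mul_nonpos_of_nonneg_of_nonpos ht (hb x hx)
  simpa using add_nonpos h1 h2

theorem smul_mem_frontier_polarSet (D : Set (Euc d)) (x : Euc d) {r : ℝ} (hr : 0 < r) :
    r • x ∈ frontier (polarSet D) ↔ x ∈ frontier (polarSet D) := by
  have h : (Homeomorph.smulOfNeZero r hr.ne' : Euc d ≃ₜ Euc d) ⁻¹' polarSet D = polarSet D := by
    ext w
    simp only [polarSet, mem_preimage, Homeomorph.smulOfNeZero_apply, mem_ofPred_eq,
      inner_smul_left]
    exact forall₂_congr fun x _ => by
      rw [conj_trivial, ← smul_eq_mul, smul_nonpos_iff_nonpos_of_pos_left hr]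
  conv_rhs => rw [← h, ← Homeomorph.preimage_frontier]
  rfl

theorem ae_notMem_frontier_polarSet (hd : 1 ≤ d) (D : Set (Euc d)) :
    ∀ᵐ u : Metric.sphere (0 : Euc d) 1 ∂(sphNormalized d), (u : Euc d) ∉ frontier (polarSet D) ∧
      -(u : Euc d) ∉ frontier (polarSet D) := by
  have h0 : volume (frontier (polarSet D)) = 0 := (convex_polarSet D).addHaar_frontier _
  refine (ae_sphNormalized_notMem hd isClosed_frontier.measurableSet
    (fun x r hr => smul_mem_frontier_polarSet D x hr) h0).and
    (ae_sphNormalized_notMem hd (K := Neg.neg ⁻¹' frontier (polarSet D))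
    (measurable_neg isClosed_frontier.measurableSet) (fun x r hr => ?_) ?_)
  · simp only [mem_preimage, ← smul_neg]
    exact smul_mem_frontier_polarSet D _ hr
  · exact (Measure.measure_neg _ _).trans h0

theorem Nondegenerate.cons (hv : Nondegenerate v) (hw : -w ∉ frontier (polarSet (polyCone v))) :
    Nondegenerate (Fin.cons w v : Fin (m + 1) → Euc d) := by
  rcases hv with ⟨y, hy⟩ | hv
  swap
  · exact Or.inr ((polyCone_cons.trans_subset inter_subset_left).trans hv)
  by_cases hK : -w ∈ polarSet (polyCone v)
  · right
    have hmem_int : -w ∈ interior (polarSet (polyCone v)) := by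
      by_contra hn
      exact hw ((isClosed_polarSet _).frontier_eq ▸ ⟨hK, hn⟩)
    rw [polyCone_cons]
    rintro x ⟨hx, hwx⟩
    have hcont : Filter.Tendsto (fun δ : ℝ => -w + δ • x) (nhdsWithin 0 (Ioi 0)) (nhds (-w)) := by
      have : Continuous fun δ : ℝ => -w + δ • x := by fun_prop
      simpa using (this.tendsto 0).mono_left nhdsWithin_le_nhds
    obtain ⟨δ, hδ, hδ0⟩ := ((hcont.eventually (mem_interior_iff_mem_nhds.1 hmem_int)).and
      self_mem_nhdsWithin).exists
    have h1 := hδ x hx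
    have h2 := hK x hx
    rw [inner_add_left, inner_smul_left, real_inner_self_eq_norm_sq] at h1
    rw [inner_neg_left] at h1 h2
    simp only [mem_ofPred_eq, conj_trivial] at hwx h1 hδ0
    have h3 : ‖x‖ ^ 2 ≤ 0 := by nlinarith
    simpa using h3
  · left
    obtain ⟨x, hx, hwx⟩ : ∃ x ∈ polyCone v, ⟪w, x⟫ < 0 := by
      simpa [polarSet, inner_neg_left] using hK
    have hcont : Filter.Tendsto (fun δ : ℝ => ⟪w, x + δ • y⟫) (nhdsWithin 0 (Ioi 0))
        (nhds ⟪w, x⟫) := by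
      have : Continuous fun δ : ℝ => ⟪w, x + δ • y⟫ := by fun_prop
      simpa using (this.tendsto 0).mono_left nhdsWithin_le_nhds
    obtain ⟨δ, hδ, hδ0⟩ := ((hcont.eventually (gt_mem_nhds hwx)).and self_mem_nhdsWithin).exists
    refine ⟨x + δ • y, Fin.cases (by simpa using hδ) fun i => ?_⟩
    rw [Fin.cons_succ, inner_add_right, inner_smul_right]
    exact add_neg_of_nonpos_of_neg (hx i) (mul_neg_of_pos_of_neg hδ0 (hy i))

theorem measurableSet_nondegenerate :
    MeasurableSet {v : Fin m → Euc d | Nondegenerate v} := by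
  have h1 : IsOpen {v : Fin m → Euc d | ∃ x, ∀ i, ⟪v i, x⟫ < 0} := by
    have : {v : Fin m → Euc d | ∃ x, ∀ i, ⟪v i, x⟫ < 0} =
        ⋃ x, ⋂ i, {v : Fin m → Euc d | ⟪v i, x⟫ < 0} := by
      ext v
      simp
    rw [this]
    exact isOpen_iUnion fun x => isOpen_iInter_of_finite fun i =>
      isOpen_lt (by fun_prop) continuous_const
  have h2 : IsOpen {v : Fin m → Euc d | polyCone v ⊆ {0}} := by
    have hcl : IsClosed {p : (Fin m → Euc d) × Metric.sphere (0 : Euc d) 1 |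
        ∀ i, ⟪p.1 i, (p.2 : Euc d)⟫ ≤ 0} := by
      simp only [ofPred_forall]
      exact isClosed_iInter fun i => isClosed_le (by fun_prop) continuous_const
    have := isClosedMap_fst_of_compactSpace _ hcl
    convert this.isOpen_compl using 1
    ext v
    simp only [mem_ofPred_eq, mem_compl_iff, mem_image, Prod.exists, exists_and_right,
      exists_eq_right, not_exists, not_forall, not_le]
    constructor
    · intro h x
      by_contra! hx
      exact ne_zero_of_mem_unit_sphere x (h hx)
    · intro h x hx
      by_contra hx0
      obtain ⟨i, hi⟩ := h ⟨‖x‖⁻¹ • x, by simp [norm_smul, norm_ne_zero_iff.2 hx0]⟩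
      rw [inner_smul_right] at hi
      exact hi.not_ge (mul_nonpos_of_nonneg_of_nonpos (by positivity) (hx i))
  exact h1.measurableSet.union h2.measurableSet

theorem ae_nondegenerate_signed (hd : 1 ≤ d) (n : ℕ) :
    ∀ᵐ u ∂(sphPi d n), ∀ ε, Nondegenerate (signed ε fun i => (u i : Euc d)) := by
  have := isProbabilityMeasure_sphNormalized hd
  have hmeas : ∀ n, MeasurableSet {u : Fin n → Metric.sphere (0 : Euc d) 1 |
      ∀ ε, Nondegenerate (signed ε fun i => (u i : Euc d))} := by
    intro n
    simp only [ofPred_forall]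
    refine MeasurableSet.iInter fun ε => ?_
    exact ((continuous_signed ε).measurable.comp
      (f := fun (u : Fin n → Metric.sphere (0 : Euc d) 1) i => (u i : Euc d)) (by fun_prop))
      measurableSet_nondegenerate
  induction n with
  | zero => exact Filter.Eventually.of_forall fun u ε => Or.inl ⟨0, fun i => i.elim0⟩
  | succ n ih =>
    have : IsProbabilityMeasure (sphPi d n) := by unfold sphPi; infer_instance
    have hmp := measurePreserving_cons hd n
    rw [← hmp.map_eq, ae_map_iff hmp.measurable.aemeasurable (hmeas _)]
    refine (Measure.ae_prod_iff_ae_ae (hmp.measurable (hmeas _))).2 ?_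
    rw [Measure.ae_ae_comm]
    · filter_upwards [ih] with u hu
      have hfr := ae_all_iff.2 fun ε : Fin n → Bool =>
        ae_notMem_frontier_polarSet hd (polyCone (signed ε fun i => (u i : Euc d)))
      filter_upwards [hfr] with w hw ε
      rw [coe_comp_cons, ← Fin.cons_self_tail ε, signed_cons]
      refine (hu _).cons ?_
      split_ifs
      · exact (hw _).2
      · rw [neg_neg]
        exact (hw _).1
    · exact hmp.measurable (hmeas _)

end Nondegenerate

section Cells

variable {m n : ℕ} {v : Fin m → Euc d} {u : Fin n → Euc d} {ε ε' : Fin n → Bool} {x : Euc d}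

theorem closure_setOf_inner_neg (hx : ∀ i, ⟪v i, x⟫ < 0) :
    closure {y | ∀ i, ⟪v i, y⟫ < 0} = polyCone v := by
  refine (closure_minimal (fun y hy i => (hy i).le) ?_).antisymm fun y hy => ?_
  · unfold polyCone
    simp only [ofPred_forall]
    exact isClosed_iInter fun i => isClosed_le (by fun_prop) continuous_const
  · have hcont : Filter.Tendsto (fun δ : ℝ => y + δ • x) (nhdsWithin 0 (Ioi 0)) (nhds y) := by
      have : Continuous fun δ : ℝ => y + δ • x := by fun_prop
      simpa using (this.tendsto 0).mono_left nhdsWithin_le_nhds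
    refine mem_closure_of_tendsto hcont ?_
    filter_upwards [self_mem_nhdsWithin] with δ hδ i
    rw [inner_add_right, inner_smul_right]
    exact add_neg_of_nonpos_of_neg (hy i) (mul_neg_of_pos_of_neg hδ (hx i))

theorem inner_signed (ε : Fin n → Bool) (u : Fin n → Euc d) (i : Fin n) (y : Euc d) :
    ⟪signed ε u i, y⟫ = if ε i = true then ⟪u i, y⟫ else -⟪u i, y⟫ := by
  unfold signed
  split_ifs
  · rfl
  · exact inner_neg_left _ _

theorem connectedComponentIn_eq_cell (hx : ∀ i, ⟪signed ε u i, x⟫ < 0) :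
    connectedComponentIn {y | ∀ i, ⟪u i, y⟫ ≠ 0} x = {y | ∀ i, ⟪signed ε u i, y⟫ < 0} := by
  have hsub : {y | ∀ i, ⟪signed ε u i, y⟫ < 0} ⊆ {y | ∀ i, ⟪u i, y⟫ ≠ 0} := by
    intro y hy i h0
    have := hy i
    simp [inner_signed, h0] at this
  refine Subset.antisymm (fun y hy i => ?_) ?_
  · by_contra! hyi
    have hcont : ContinuousOn (fun z => ⟪signed ε u i, z⟫)
        (connectedComponentIn {y | ∀ i, ⟪u i, y⟫ ≠ 0} x) := by fun_prop
    obtain ⟨z, hz, hz0⟩ := isPreconnected_connectedComponentIn.intermediate_value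
      (mem_connectedComponentIn (hsub hx)) hy hcont ⟨(hx i).le, hyi⟩
    have := connectedComponentIn_subset _ _ hz i
    simp only [inner_signed] at hz0
    split_ifs at hz0
    · exact this hz0
    · exact this (neg_eq_zero.1 hz0)
  · refine IsPreconnected.subset_connectedComponentIn (Convex.isPreconnected ?_) hx hsub
    simp only [ofPred_forall]
    exact convex_iInter fun i => convex_halfSpace_lt (innerₛₗ ℝ (signed ε u i)).isLinear 0

theorem eq_of_polyCone_signed_eq (hx : ∀ i, ⟪signed ε u i, x⟫ < 0)
    (h : polyCone (signed ε u) = polyCone (signed ε' u)) : ε = ε' := by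
  funext i
  have h1 : ⟪signed ε' u i, x⟫ ≤ 0 := (h.subset fun j => (hx j).le : x ∈ _) i
  have h2 := hx i
  rw [inner_signed] at h1 h2
  cases hi : ε i <;> cases hi' : ε' i <;> simp [hi, hi'] at h1 h2 ⊢ <;> linarith

theorem tsum_schlafliCones (hu : ∀ ε, Nondegenerate (signed ε u)) {k : ℕ} (hk : 1 ≤ k)
    (C A : Set (Euc d)) :
    ∑' S : schlafliCones u, Phi k (C ∩ (S : Set (Euc d))) A =
      ∑ ε, Phi k (C ∩ polyCone (signed ε u)) A := by
  set R : Set (Fin n → Bool) := {ε | ∃ x, ∀ i, ⟪signed ε u i, x⟫ < 0} with hR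
  have hmem : ∀ ε : R, polyCone (signed ε.1 u) ∈ schlafliCones u := by
    rintro ⟨ε, x, hx⟩
    refine ⟨x, fun i h0 => ?_, ?_⟩
    · have := hx i
      simp [inner_signed, h0] at this
    · rw [connectedComponentIn_eq_cell hx, closure_setOf_inner_neg hx]
  set e : R → schlafliCones u := fun ε => ⟨polyCone (signed ε.1 u), hmem ε⟩ with he
  have hbij : Function.Bijective e := by
    refine ⟨fun ε ε' h => Subtype.ext ?_, ?_⟩
    · obtain ⟨x, hx⟩ := ε.2
      exact eq_of_polyCone_signed_eq hx (congrArg Subtype.val h)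
    · rintro ⟨S, x, hx, rfl⟩
      have hε : ∀ i, ⟪signed (fun i => decide (⟪u i, x⟫ < 0)) u i, x⟫ < 0 := by
        intro i
        rw [inner_signed]
        rcases (hx i).lt_or_gt with h | h
        · simp [h]
        · simp [h, h.not_gt]
      refine ⟨⟨_, x, hε⟩, Subtype.ext ?_⟩
      simp only [he]
      rw [connectedComponentIn_eq_cell hε, closure_setOf_inner_neg hε]
  rw [← (Equiv.ofBijective e hbij).tsum_eq]
  simp only [Equiv.ofBijective_apply, he]
  rw [tsum_subtype R fun ε => Phi k (C ∩ polyCone (signed ε u)) A, tsum_fintype]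
  refine Finset.sum_congr rfl fun ε _ => indicator_apply_eq_self.2 fun hε => ?_
  exact Phi_eq_zero_of_subset hk (inter_subset_right.trans ((hu ε).resolve_left hε)) A

end Cells

end SchlafliCone

/-- **Theorem 1.2.** For a polyhedral cone `C ⊆ ℝ^d`, a conic Borel set `A`, `n ∈ ℕ` and
`k ∈ {1,…,d}`, the isotropic random Schläfli cone `S_n` satisfies
`𝔼 Φ_k(C ∩ S_n, A) = C(n,d)⁻¹ ∑_{s=0}^{min{n,d−k}} binom(n,s) Φ_{k+s}(C,A)`.
The expectation is written out according to the definition of the distribution of `S_n`: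
an average, over `n` independent uniform unit vectors `u i` (the normals of the random
hyperplanes), of the normalized sum over all Schläfli cones `S` induced by them. -/
theorem expectation_curvature_schlafli {d : ℕ} (C A : Set (Euc d))
    (hC : IsPolyCone C) (hA : MeasurableSet A) (hAc : IsConic A)
    (n k : ℕ) (hk1 : 1 ≤ k) (hkd : k ≤ d) :
    ∫⁻ u : Fin n → Metric.sphere (0 : Euc d) 1,
        (schlafliCount n d : ℝ≥0∞)⁻¹ *
          ∑' S : (schlafliCones fun i => ((u i : Euc d))),
            Phi k (C ∩ (S : Set (Euc d))) A ∂(sphPi d n)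
      = (schlafliCount n d : ℝ≥0∞)⁻¹ *
          ∑ s ∈ Finset.range (min n (d - k) + 1), (n.choose s : ℝ≥0∞) * Phi (k + s) C A := by
  obtain ⟨m, v, rfl⟩ := SchlafliCone.IsPolyCone.exists_polyCone hC
  have hd : 1 ≤ d := hk1.trans hkd
  have hcount : (schlafliCount n d : ℝ≥0∞)⁻¹ ≠ ⊤ := by
    have h0 : 0 ∈ Finset.range d := Finset.mem_range.2 hd
    have h1 := Finset.single_le_sum (f := fun r => (n - 1).choose r) (fun _ _ => Nat.zero_le _) h0
    rw [Nat.choose_zero_right] at h1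
    rw [ENNReal.inv_ne_top, Nat.cast_ne_zero, schlafliCount]
    omega
  rw [lintegral_const_mul' _ _ hcount]
  congr 1
  have hae : ∀ᵐ u ∂(sphPi d n),
      ∑' S : (schlafliCones fun i => ((u i : Euc d))),
        Phi k (SchlafliCone.polyCone v ∩ (S : Set (Euc d))) A =
      ∑ ε, Phi k (SchlafliCone.polyCone v ∩
        SchlafliCone.polyCone (SchlafliCone.signed ε fun i => (u i : Euc d))) A := by
    filter_upwards [SchlafliCone.ae_nondegenerate_signed hd n] with u hu
    exact SchlafliCone.tsum_schlafliCones hu hk1 _ _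
  rw [lintegral_congr_ae hae, SchlafliCone.lintegral_sum_Phi_signed hd hA hAc hk1]
  refine (Finset.sum_subset (Finset.range_subset_range.2 (by omega)) fun s hs hs' => ?_).symm
  rw [Finset.mem_range] at hs hs'
  rw [SchlafliCone.Phi_eq_zero_of_lt (by omega), mul_zero]
end

section
/- Let C, D ⊂ ℝ^d be polyhedral convex cones with dim C = i, dim D = j, where i + j = d − k < d. Let f : [0,1] → ℝ be a bounded measurable function. Then ∫_{SO(d)} V_{d−k}(C + ϑD) · f([C, ϑD]) ν(dϑ) = c_{ij}(f) · V_i(C) · V_j(D), where c_{ij}(f) = ∫_{SO(d)} f([C, ϑD]) ν(dϑ) depends only on i, j, f, and C + ϑD denotes the Minkowski sum. -/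
open MeasureTheory Set
open scoped ENNReal RealInnerProductSpace Pointwise

noncomputable section

section CompactGroup

variable {G : Type*} [Group G] [TopologicalSpace G] [IsTopologicalGroup G] [CompactSpace G]
  [SecondCountableTopology G] [MeasurableSpace G] [BorelSpace G]

lemma eq_haarMeasure_top (μ : Measure G) [μ.IsMulLeftInvariant] [IsProbabilityMeasure μ] :
    μ = Measure.haarMeasure ⊤ := by
  have h := Measure.haarMeasure_unique μ (⊤ : TopologicalSpace.PositiveCompacts G)
  simpa using h

lemma isMulRightInvariant_of_compact (μ : Measure G) [μ.IsMulLeftInvariant]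
    [IsProbabilityMeasure μ] : μ.IsMulRightInvariant := by
  refine ⟨fun g => ?_⟩
  have : IsProbabilityMeasure (μ.map (· * g)) :=
    Measure.isProbabilityMeasure_map (measurable_mul_const g).aemeasurable
  have : (μ.map (· * g)).IsMulLeftInvariant := by
    refine ⟨fun a => ?_⟩
    rw [Measure.map_map (measurable_const_mul a) (measurable_mul_const g)]
    conv_rhs => rw [← map_mul_left_eq_self μ a]
    rw [Measure.map_map (measurable_mul_const g) (measurable_const_mul a)]
    congr 1
    ext x
    simp [mul_assoc]
  rw [eq_haarMeasure_top (μ.map (· * g)), ← eq_haarMeasure_top μ]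

end CompactGroup

variable {d : ℕ}

instance : BorelSpace (SOG d) := ⟨rfl⟩

instance : SecondCountableTopology (SOG d) := by
  have : SecondCountableTopology (Matrix (Fin d) (Fin d) ℝ) :=
    inferInstanceAs (SecondCountableTopology (Fin d → Fin d → ℝ))
  have : SecondCountableTopology (Matrix.orthogonalGroup (Fin d) ℝ) :=
    TopologicalSpace.Subtype.secondCountableTopology _
  exact TopologicalSpace.Subtype.secondCountableTopology _

lemma continuous_coe_SOG :
    Continuous fun ϑ : SOG d => ((ϑ : Matrix.orthogonalGroup (Fin d) ℝ) :
      Matrix (Fin d) (Fin d) ℝ) :=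
  continuous_subtype_val.comp continuous_subtype_val

instance : CompactSpace (SOG d) := by
  have hemb : Topology.IsEmbedding fun ϑ : SOG d => ((ϑ : Matrix.orthogonalGroup (Fin d) ℝ) :
      Matrix (Fin d) (Fin d) ℝ) :=
    Topology.IsEmbedding.subtypeVal.comp Topology.IsEmbedding.subtypeVal
  refine isCompact_univ_iff.1 (hemb.isCompact_iff.2 ?_)
  have hrange : (fun ϑ : SOG d => ((ϑ : Matrix.orthogonalGroup (Fin d) ℝ) :
      Matrix (Fin d) (Fin d) ℝ)) '' univ =
      {A : Matrix (Fin d) (Fin d) ℝ | A * A.transpose = 1 ∧ A.det = 1} := by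
    ext A
    constructor
    · rintro ⟨ϑ, -, rfl⟩
      exact ⟨(Matrix.mem_orthogonalGroup_iff _ _).1 ϑ.1.2, ϑ.2⟩
    · rintro ⟨h, h1⟩
      exact ⟨⟨⟨A, (Matrix.mem_orthogonalGroup_iff _ _).2 h⟩, h1⟩, trivial, rfl⟩
  rw [hrange]
  have hcpt : IsCompact (univ.pi fun _ => univ.pi fun _ => Icc (-1) 1 :
      Set (Fin d → Fin d → ℝ)) :=
    isCompact_univ_pi fun _ => isCompact_univ_pi fun _ => isCompact_Icc
  refine IsCompact.of_isClosed_subset hcpt ?_ ?_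
  · exact (isClosed_eq (by fun_prop) (by fun_prop)).inter (isClosed_eq (by fun_prop) (by fun_prop))
  · intro A hA a _ b _
    have := entry_norm_bound_of_unitary (U := A) ((Matrix.mem_orthogonalGroup_iff _ _).2 hA.1) a b
    exact abs_le.1 this

lemma rot_apply (ϑ : SOG d) (x : Euc d) :
    rot ϑ x = WithLp.toLp 2 ((ϑ : Matrix (Fin d) (Fin d) ℝ).mulVec x.ofLp) := rfl

lemma rot_one (x : Euc d) : rot (1 : SOG d) x = x := by
  rw [rot_apply]
  change WithLp.toLp 2 ((1 : Matrix (Fin d) (Fin d) ℝ).mulVec x.ofLp) = x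
  simp

lemma rot_mul (ϑ η : SOG d) (x : Euc d) : rot (ϑ * η) x = rot ϑ (rot η x) := by
  rw [rot_apply, rot_apply, rot_apply]
  change WithLp.toLp 2 (((ϑ : Matrix (Fin d) (Fin d) ℝ) * (η : Matrix (Fin d) (Fin d) ℝ)).mulVec
    x.ofLp) = _
  simp

lemma rot_inv_rot (ϑ : SOG d) (x : Euc d) : rot ϑ⁻¹ (rot ϑ x) = x := by
  rw [← rot_mul, inv_mul_cancel, rot_one]

lemma rot_rot_inv (ϑ : SOG d) (x : Euc d) : rot ϑ (rot ϑ⁻¹ x) = x := by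
  rw [← rot_mul, mul_inv_cancel, rot_one]

lemma rot_add (ϑ : SOG d) (x y : Euc d) : rot ϑ (x + y) = rot ϑ x + rot ϑ y :=
  map_add (rotLin ϑ) x y

lemma rot_smul (ϑ : SOG d) (r : ℝ) (x : Euc d) : rot ϑ (r • x) = r • rot ϑ x :=
  map_smul (rotLin ϑ) r x

lemma rot_zero (ϑ : SOG d) : rot ϑ (0 : Euc d) = 0 := map_zero (rotLin ϑ)

lemma inner_rot_rot (ϑ : SOG d) (x y : Euc d) : ⟪rot ϑ x, rot ϑ y⟫ = ⟪x, y⟫ := by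
  simp only [rot_apply, EuclideanSpace.inner_eq_star_dotProduct, star_trivial]
  rw [Matrix.dotProduct_mulVec, Matrix.vecMul_mulVec]
  have : (ϑ : Matrix (Fin d) (Fin d) ℝ).transpose * (ϑ : Matrix (Fin d) (Fin d) ℝ) = 1 :=
    (Matrix.mem_orthogonalGroup_iff' _ _).1 ϑ.1.2
  rw [← Matrix.mulVec_transpose]
  simp [this]

/-- A rotation as a linear isometric automorphism of `ℝ^d`. -/
def rotIso (ϑ : SOG d) : Euc d ≃ₗᵢ[ℝ] Euc d where
  toLinearEquiv := LinearEquiv.ofLinearMap (rotLin ϑ) (rotLin ϑ⁻¹)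
    (LinearMap.ext fun x => rot_rot_inv ϑ x) (LinearMap.ext fun x => rot_inv_rot ϑ x)
  norm_map' x := by
    change ‖rot ϑ x‖ = ‖x‖
    rw [norm_eq_sqrt_real_inner, inner_rot_rot, ← norm_eq_sqrt_real_inner]

lemma norm_rot (ϑ : SOG d) (x : Euc d) : ‖rot ϑ x‖ = ‖x‖ := (rotIso ϑ).norm_map x

lemma continuous_rot_uncurry : Continuous fun z : SOG d × Euc d => rot z.1 z.2 := by
  simp only [rot_apply]
  have h1 : Continuous fun z : SOG d × Euc d =>
      ((z.1 : Matrix.orthogonalGroup (Fin d) ℝ) : Matrix (Fin d) (Fin d) ℝ) :=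
    continuous_coe_SOG.comp continuous_fst
  have h2 : Continuous fun z : SOG d × Euc d => z.2.ofLp := by fun_prop
  exact (PiLp.continuous_toLp 2 _).comp (h1.matrix_mulVec h2)

@[fun_prop]
lemma Continuous.rot {X : Type*} [TopologicalSpace X] {a : X → SOG d} {b : X → Euc d}
    (ha : Continuous a) (hb : Continuous b) : Continuous fun x => rot (a x) (b x) :=
  continuous_rot_uncurry.comp (ha.prodMk hb)

lemma exists_rot_eq (e : Euc d ≃ₗᵢ[ℝ] Euc d)
    (he : LinearMap.det (e.toLinearEquiv : Euc d →ₗ[ℝ] Euc d) = 1) :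
    ∃ ϑ : SOG d, ∀ x, rot ϑ x = e x := by
  set b := (EuclideanSpace.basisFun (Fin d) ℝ)
  set A : Matrix (Fin d) (Fin d) ℝ :=
    LinearMap.toMatrix b.toBasis b.toBasis (e.toLinearEquiv : Euc d →ₗ[ℝ] Euc d) with hA
  have hmul : ∀ x : Euc d, A.mulVec x.ofLp = (e x).ofLp := by
    intro x
    have := LinearMap.toMatrix_mulVec_repr b.toBasis b.toBasis
      (e.toLinearEquiv : Euc d →ₗ[ℝ] Euc d) x
    exact this
  have hdet : A.det = 1 := by rw [hA, LinearMap.det_toMatrix, he]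
  have hentry : ∀ a c, A a c = (e (EuclideanSpace.single c 1)).ofLp a := by
    intro a c
    rw [← hmul]
    simp
  have horth : A.transpose * A = 1 := by
    ext a c
    rw [Matrix.mul_apply]
    have : ⟪e (EuclideanSpace.single c 1), e (EuclideanSpace.single a 1)⟫
        = ⟪(EuclideanSpace.single c (1 : ℝ) : Euc d), EuclideanSpace.single a 1⟫ :=
      e.inner_map_map _ _
    rw [EuclideanSpace.inner_eq_star_dotProduct] at this
    simp only [dotProduct, star_trivial] at this
    simp only [Matrix.transpose_apply, hentry, this, EuclideanSpace.inner_single_left]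
    simp [Matrix.one_apply, eq_comm]
  refine ⟨⟨⟨A, (Matrix.mem_orthogonalGroup_iff' _ _).2 horth⟩, hdet⟩, fun x => ?_⟩
  rw [rot_apply]
  exact congrArg (WithLp.toLp 2) (hmul x)

section Gaussian

instance : IsProbabilityMeasure (stdGauss d) := by
  refine ⟨?_⟩
  have hG : ∫ x : Euc d, Real.exp (-(1 / 2) * ‖x‖ ^ 2) = (Real.pi / (1 / 2)) ^ ((d : ℝ) / 2) := by
    simpa using GaussianFourier.integral_rexp_neg_mul_sq_norm (V := Euc d)
      (b := 1 / 2) (by norm_num)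
  have hpos : (0 : ℝ) < 2 * Real.pi := by positivity
  have hI : ∫ x : Euc d, (2 * Real.pi) ^ (-(d : ℝ) / 2) * Real.exp (-‖x‖ ^ 2 / 2) = 1 := by
    rw [integral_const_mul]
    have h1 : (fun x : Euc d => Real.exp (-‖x‖ ^ 2 / 2))
        = fun x => Real.exp (-(1 / 2) * ‖x‖ ^ 2) := by
      ext x; congr 1; ring
    rw [h1, hG, show Real.pi / (1 / 2) = 2 * Real.pi by ring, ← Real.rpow_add hpos]
    simp [neg_div]
  rw [stdGauss, withDensity_apply _ MeasurableSet.univ, Measure.restrict_univ,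
    ← ofReal_integral_eq_lintegral_ofReal, hI, ENNReal.ofReal_one]
  · by_contra h
    rw [integral_undef h] at hI
    exact zero_ne_one hI
  · exact Filter.Eventually.of_forall fun x => by positivity

lemma measurePreserving_rot (ϑ : SOG d) : MeasurePreserving (rot ϑ) (stdGauss d) (stdGauss d) := by
  have hv : MeasurePreserving (rot ϑ) (volume : Measure (Euc d)) volume :=
    (rotIso ϑ).measurePreserving
  refine ⟨hv.measurable, ?_⟩
  ext s hs
  rw [Measure.map_apply hv.measurable hs, stdGauss, withDensity_apply _ hs,
    withDensity_apply _ (hv.measurable hs),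
    ← hv.setLIntegral_comp_preimage hs (by fun_prop)]
  simp only [norm_rot]

lemma stdGauss_submodule_eq_zero (H : Submodule ℝ (Euc d)) (hH : H ≠ ⊤) : stdGauss d H = 0 :=
  (withDensity_absolutelyContinuous _ _) (Measure.addHaar_submodule _ H hH)

end Gaussian

section Stabilizer

/-- The group of rotations which map the subspace `K` to itself. -/
def stab (K : Submodule ℝ (Euc d)) : Subgroup (SOG d) where
  carrier := {ϑ | (∀ x ∈ K, rot ϑ x ∈ K) ∧ ∀ x ∈ K, rot ϑ⁻¹ x ∈ K}
  one_mem' := ⟨fun x hx => by rwa [rot_one], fun x hx => by rwa [inv_one, rot_one]⟩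
  mul_mem' {a b} ha hb := ⟨fun x hx => by rw [rot_mul]; exact ha.1 _ (hb.1 x hx),
    fun x hx => by rw [mul_inv_rev, rot_mul]; exact hb.2 _ (ha.2 x hx)⟩
  inv_mem' {a} ha := ⟨ha.2, fun x hx => by rw [inv_inv]; exact ha.1 x hx⟩

lemma mem_stab {K : Submodule ℝ (Euc d)} {ϑ : SOG d} :
    ϑ ∈ stab K ↔ (∀ x ∈ K, rot ϑ x ∈ K) ∧ ∀ x ∈ K, rot ϑ⁻¹ x ∈ K := Iff.rfl

lemma rot_mem_of_stab {K : Submodule ℝ (Euc d)} (ρ : stab K) {x : Euc d} (hx : x ∈ K) :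
    rot (ρ : SOG d) x ∈ K := ρ.2.1 x hx

lemma rot_inv_mem_of_stab {K : Submodule ℝ (Euc d)} (ρ : stab K) {x : Euc d} (hx : x ∈ K) :
    rot (ρ : SOG d)⁻¹ x ∈ K := ρ.2.2 x hx

instance (K : Submodule ℝ (Euc d)) : CompactSpace (stab K) := by
  refine isCompact_iff_compactSpace.1 (IsClosed.isCompact ?_)
  have hK : IsClosed (K : Set (Euc d)) := K.closed_of_finiteDimensional
  have : (stab K : Set (SOG d)) = (⋂ x ∈ K, {ϑ | rot ϑ x ∈ K}) ∩ ⋂ x ∈ K, {ϑ | rot ϑ⁻¹ x ∈ K} := by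
    ext ϑ
    simp only [mem_inter_iff, mem_iInter]
    rfl
  rw [this]
  refine IsClosed.inter ?_ ?_ <;> refine isClosed_biInter fun x _ => hK.preimage ?_
  · fun_prop
  · fun_prop

/-- The Haar probability measure of the stabilizer of `K`. -/
def stabHaar (K : Submodule ℝ (Euc d)) : Measure (stab K) := Measure.haarMeasure ⊤

instance (K : Submodule ℝ (Euc d)) : (stabHaar K).IsMulLeftInvariant :=
  Measure.isMulLeftInvariant_haarMeasure _

instance (K : Submodule ℝ (Euc d)) : IsProbabilityMeasure (stabHaar K) :=
  ⟨Measure.haarMeasure_self (K₀ := (⊤ : TopologicalSpace.PositiveCompacts (stab K)))⟩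

instance (K : Submodule ℝ (Euc d)) : SecondCountableTopology (stab K) :=
  TopologicalSpace.Subtype.secondCountableTopology _

instance (K : Submodule ℝ (Euc d)) : (stabHaar K).IsMulRightInvariant :=
  isMulRightInvariant_of_compact _

lemma reflection_mem_of_mem {K : Submodule ℝ (Euc d)} {v x : Euc d} (hv : v ∈ K ∨ v ∈ Kᗮ)
    (hx : x ∈ K) : (ℝ ∙ v)ᗮ.reflection x ∈ K := by
  rw [Submodule.reflection_orthogonal_apply, Submodule.reflection_singleton_apply]
  rcases hv with hv | hv
  · exact K.neg_mem (K.sub_mem (nsmul_mem (K.smul_mem _ hv) 2) hx)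
  · rw [(K.mem_orthogonal' v).1 hv x hx]
    simpa using hx

lemma det_reflection_orthogonal_singleton {v : Euc d} (hv : v ≠ 0) :
    LinearMap.det ((ℝ ∙ v)ᗮ.reflection.toLinearEquiv : Euc d →ₗ[ℝ] Euc d) = -1 := by
  have := (ℝ ∙ v)ᗮ.det_reflection
  rw [Submodule.orthogonal_orthogonal, finrank_span_singleton hv, pow_one] at this
  exact this

lemma exists_stab_rot_eq (hd : 2 ≤ d) (K : Submodule ℝ (Euc d)) {x y : Euc d} (hx : x ∈ K)
    (hy : y ∈ K) (hxy : ‖x‖ = ‖y‖) : ∃ ρ : stab K, rot (ρ : SOG d) x = y := by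
  by_cases hne : x = y
  · exact ⟨1, by rw [← hne]; exact rot_one x⟩
  obtain ⟨v, hv0, hvK, hvy⟩ : ∃ v : Euc d, v ≠ 0 ∧ (v ∈ K ∨ v ∈ Kᗮ) ∧ ⟪v, y⟫ = 0 := by
    by_cases hK : K = ⊤
    · have : (ℝ ∙ y)ᗮ ≠ ⊥ := by
        intro h
        have h1 := (ℝ ∙ y).finrank_add_finrank_orthogonal
        have h2 := finrank_span_le_card (R := ℝ) ({y} : Set (Euc d))
        rw [h] at h1
        simp at h1 h2
        omega
      obtain ⟨v, hv, hv0⟩ := Submodule.exists_mem_ne_zero_of_ne_bot this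
      refine ⟨v, hv0, Or.inl (by simp [hK]), ?_⟩
      rw [real_inner_comm]
      exact Submodule.mem_orthogonal_singleton_iff_inner_right.1 hv
    · have : Kᗮ ≠ ⊥ := fun h => hK (Submodule.orthogonal_eq_bot_iff.1 h)
      obtain ⟨v, hv, hv0⟩ := Submodule.exists_mem_ne_zero_of_ne_bot this
      exact ⟨v, hv0, Or.inr hv, (K.mem_orthogonal' v).1 hv y hy⟩
  set r := (ℝ ∙ (x - y))ᗮ.reflection
  set s := (ℝ ∙ v)ᗮ.reflection
  have hr : r x = y := Submodule.reflection_sub hxy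
  have hs : s y = y := Submodule.reflection_mem_subspace_eq_self
    (Submodule.mem_orthogonal_singleton_iff_inner_right.2 hvy)
  obtain ⟨ϑ, hϑ⟩ := exists_rot_eq (r.trans s) (by
    change LinearMap.det ((s.toLinearEquiv : Euc d →ₗ[ℝ] Euc d) ∘ₗ
      (r.toLinearEquiv : Euc d →ₗ[ℝ] Euc d)) = 1
    rw [LinearMap.det_comp, det_reflection_orthogonal_singleton hv0,
      det_reflection_orthogonal_singleton (sub_ne_zero.2 hne)]
    norm_num)
  have hϑ' : ∀ z, rot ϑ⁻¹ z = r (s z) := by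
    intro z
    have : rot ϑ (r (s z)) = z := by
      rw [hϑ]
      change s (r (r (s z))) = z
      rw [Submodule.reflection_reflection, Submodule.reflection_reflection]
    conv_lhs => rw [← this]
    rw [rot_inv_rot]
  refine ⟨⟨ϑ, mem_stab.2 ⟨fun z hz => ?_, fun z hz => ?_⟩⟩, ?_⟩
  · rw [hϑ]
    change s (r z) ∈ K
    exact reflection_mem_of_mem hvK (reflection_mem_of_mem (Or.inl (K.sub_mem hx hy)) hz)
  · rw [hϑ']
    exact reflection_mem_of_mem (Or.inl (K.sub_mem hx hy)) (reflection_mem_of_mem hvK hz)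
  · change rot ϑ x = y
    rw [hϑ]
    change s (r x) = y
    rw [hr, hs]

lemma starProjection_rot_stab {K : Submodule ℝ (Euc d)} (ρ : stab K) (x : Euc d) :
    K.starProjection (rot (ρ : SOG d) x) = rot (ρ : SOG d) (K.starProjection x) := by
  refine Submodule.eq_starProjection_of_mem_of_inner_eq_zero
    (rot_mem_of_stab ρ (K.starProjection_apply_mem x)) fun w hw => ?_
  have : rot (ρ : SOG d) x - rot (ρ : SOG d) (K.starProjection x)
      = rot (ρ : SOG d) (x - K.starProjection x) := (map_sub (rotLin _) _ _).symm
  rw [this, ← rot_rot_inv (ρ : SOG d) w, inner_rot_rot]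
  exact K.starProjection_inner_eq_zero x _ (rot_inv_mem_of_stab ρ hw)

/-- A random rotation in the stabilizer of `K` moves a nonzero vector of `K` into a cone with
probability the Gaussian measure of that cone. -/
lemma stabHaar_rot_mem (hd : 2 ≤ d) (K : Submodule ℝ (Euc d)) {C : Set (Euc d)}
    (hC : MeasurableSet C) (hcone : ∀ r : ℝ, 0 < r → ∀ x ∈ C, r • x ∈ C) {p : Euc d}
    (hpK : p ∈ K) (hp : p ≠ 0) :
    stabHaar K {ρ | rot (ρ : SOG d) p ∈ C} = stdGauss d {x | K.starProjection x ∈ C} := by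
  set c : Euc d → ℝ≥0∞ := fun x => stabHaar K {ρ | rot (ρ : SOG d) x ∈ C} with hc
  have hconst : ∀ x ∈ K, x ≠ 0 → c x = c p := by
    intro x hx hx0
    have hxn : 0 < ‖x‖ := norm_pos_iff.2 hx0
    have hpn : 0 < ‖p‖ := norm_pos_iff.2 hp
    set r : ℝ := ‖p‖ / ‖x‖ with hr
    have hr0 : 0 < r := div_pos hpn hxn
    obtain ⟨τ, hτ⟩ := exists_stab_rot_eq hd K (K.smul_mem r hx) hpK (by
      rw [norm_smul, Real.norm_of_nonneg hr0.le, hr]; field_simp)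
    have hset : {ρ : stab K | rot (ρ : SOG d) x ∈ C}
        = (fun ρ => ρ * τ⁻¹) ⁻¹' {ρ : stab K | rot (ρ : SOG d) p ∈ C} := by
      ext ρ
      change rot (ρ : SOG d) x ∈ C ↔ rot ((ρ : SOG d) * (τ : SOG d)⁻¹) p ∈ C
      rw [rot_mul, ← hτ, rot_inv_rot, rot_smul]
      refine ⟨fun h => hcone r hr0 _ h, fun h => ?_⟩
      have := hcone r⁻¹ (inv_pos.2 hr0) _ h
      rwa [smul_smul, inv_mul_cancel₀ hr0.ne', one_smul] at this
    rw [hc]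
    simp only [hset]
    exact measure_preimage_mul_right _ _ _
  have hT : MeasurableSet {z : Euc d × stab K | rot (z.2 : SOG d) (K.starProjection z.1) ∈ C} := by
    have : Continuous fun z : Euc d × stab K => rot (z.2 : SOG d) (K.starProjection z.1) := by
      fun_prop
    exact this.measurable hC
  have hne : ∀ᵐ x ∂stdGauss d, K.starProjection x ≠ 0 := by
    have hker : LinearMap.ker (K.starProjection : Euc d →ₗ[ℝ] Euc d) ≠ ⊤ := by
      intro h
      have : p ∈ LinearMap.ker (K.starProjection : Euc d →ₗ[ℝ] Euc d) := h ▸ trivial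
      rw [LinearMap.mem_ker] at this
      exact hp ((Submodule.starProjection_eq_self_iff.2 hpK).symm.trans this)
    rw [ae_iff]
    simp only [ne_eq, not_not]
    exact stdGauss_submodule_eq_zero _ hker
  have h1 : ((stdGauss d).prod (stabHaar K))
      {z : Euc d × stab K | rot (z.2 : SOG d) (K.starProjection z.1) ∈ C} = c p := by
    rw [Measure.prod_apply hT]
    have h : ∀ᵐ x ∂stdGauss d, c (K.starProjection x) = c p := by
      filter_upwards [hne] with x hx
      exact hconst _ (K.starProjection_apply_mem x) hx
    refine (lintegral_congr_ae h).trans ?_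
    simp
  have h2 : ((stdGauss d).prod (stabHaar K))
      {z : Euc d × stab K | rot (z.2 : SOG d) (K.starProjection z.1) ∈ C}
      = stdGauss d {x | K.starProjection x ∈ C} := by
    rw [Measure.prod_apply_symm hT]
    have h : ∀ ρ : stab K, stdGauss d {x | rot (ρ : SOG d) (K.starProjection x) ∈ C}
        = stdGauss d {x | K.starProjection x ∈ C} := by
      intro ρ
      refine Eq.trans ?_ ((measurePreserving_rot (ρ : SOG d)).measure_preimage
        (K.starProjection.continuous.measurable hC).nullMeasurableSet)
      congr 1
      ext x
      change rot (ρ : SOG d) (K.starProjection x) ∈ C ↔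
        K.starProjection (rot (ρ : SOG d) x) ∈ C
      rw [starProjection_rot_stab]
    refine (lintegral_congr h).trans ?_
    simp
  exact h1.symm.trans h2

end Stabilizer

section GramVolume

lemma map_rotLin_mul (ϑ η : SOG d) (M : Submodule ℝ (Euc d)) :
    M.map (rotLin (ϑ * η)) = (M.map (rotLin η)).map (rotLin ϑ) := by
  rw [← Submodule.map_comp]
  congr 1
  exact LinearMap.ext fun x => rot_mul ϑ η x

lemma map_rotLin_stab {K : Submodule ℝ (Euc d)} (ρ : stab K) : K.map (rotLin (ρ : SOG d)) = K := by
  apply le_antisymm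
  · rintro _ ⟨x, hx, rfl⟩
    exact rot_mem_of_stab ρ hx
  · intro x hx
    exact ⟨rot (ρ : SOG d)⁻¹ x, rot_inv_mem_of_stab ρ hx, rot_rot_inv _ _⟩

lemma finrank_map_rotLin (ϑ : SOG d) (M : Submodule ℝ (Euc d)) :
    Module.finrank ℝ (M.map (rotLin ϑ)) = Module.finrank ℝ M :=
  LinearEquiv.finrank_map_eq (rotIso ϑ).toLinearEquiv M

/-- The restriction of a rotation to a subspace. -/
def rotSub (ϑ : SOG d) (M : Submodule ℝ (Euc d)) : M ≃ₗᵢ[ℝ] M.map (rotLin ϑ) :=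
  (rotIso ϑ).submoduleMap M

lemma coe_rotSub (ϑ : SOG d) (M : Submodule ℝ (Euc d)) (x : M) :
    (rotSub ϑ M x : Euc d) = rot ϑ x := rfl

/-- The map `(x, y) ↦ (x + P_L y, P_M x + y)`, whose matrix in orthonormal bases is the Gram
matrix of the union of these bases. -/
def gramMap (L M : Submodule ℝ (Euc d)) : (L × M) →ₗ[ℝ] (L × M) :=
  LinearMap.prod
    (LinearMap.fst ℝ L M + ((L.orthogonalProjectionOnto : Euc d →ₗ[ℝ] L) ∘ₗ M.subtype) ∘ₗ
      LinearMap.snd ℝ L M)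
    (((M.orthogonalProjectionOnto : Euc d →ₗ[ℝ] M) ∘ₗ L.subtype) ∘ₗ LinearMap.fst ℝ L M +
      LinearMap.snd ℝ L M)

lemma det_gram_eq (L M : Submodule ℝ (Euc d)) {ι κ : Type*} [Fintype ι] [Fintype κ]
    [DecidableEq ι] [DecidableEq κ] (b : OrthonormalBasis ι ℝ L) (c : OrthonormalBasis κ ℝ M) :
    Matrix.det (Matrix.of fun i j : ι ⊕ κ =>
      ⟪Sum.elim (fun a => (b a : Euc d)) (fun a => (c a : Euc d)) i,
        Sum.elim (fun a => (b a : Euc d)) (fun a => (c a : Euc d)) j⟫)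
      = LinearMap.det (gramMap L M) := by
  rw [← LinearMap.det_toMatrix (b.toBasis.prod c.toBasis)]
  congr 1
  ext i j
  rw [LinearMap.toMatrix_apply]
  rcases i with i | i <;> rcases j with j | j
  · simp [gramMap, ← Submodule.coe_inner, orthonormal_iff_ite.1 b.orthonormal]
  · simp [gramMap, b.repr_apply_apply]
  · simp [gramMap, c.repr_apply_apply]
  · simp [gramMap, ← Submodule.coe_inner, orthonormal_iff_ite.1 c.orthonormal]

lemma gramVol_eq (L M : Submodule ℝ (Euc d)) {ι κ : Type*} [Fintype ι] [Fintype κ]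
    [DecidableEq ι] [DecidableEq κ] (b : OrthonormalBasis ι ℝ L) (c : OrthonormalBasis κ ℝ M) :
    gramVol L M = Real.sqrt (Matrix.det (Matrix.of fun i j : ι ⊕ κ =>
      ⟪Sum.elim (fun a => (b a : Euc d)) (fun a => (c a : Euc d)) i,
        Sum.elim (fun a => (b a : Euc d)) (fun a => (c a : Euc d)) j⟫)) := by
  rw [det_gram_eq, gramVol, det_gram_eq]

lemma gramVol_map_rotLin (ϑ : SOG d) (L M : Submodule ℝ (Euc d)) :
    gramVol (L.map (rotLin ϑ)) (M.map (rotLin ϑ)) = gramVol L M := by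
  rw [gramVol_eq L M (stdOrthonormalBasis ℝ L) (stdOrthonormalBasis ℝ M),
    gramVol_eq (L.map (rotLin ϑ)) (M.map (rotLin ϑ))
      ((stdOrthonormalBasis ℝ L).map (rotSub ϑ L))
      ((stdOrthonormalBasis ℝ M).map (rotSub ϑ M))]
  congr 3
  ext i j
  have : ∀ i, Sum.elim (fun a => (((stdOrthonormalBasis ℝ L).map (rotSub ϑ L)) a :
      Euc d)) (fun a => (((stdOrthonormalBasis ℝ M).map (rotSub ϑ M)) a : Euc d)) i
      = rot ϑ (Sum.elim (fun a => ((stdOrthonormalBasis ℝ L) a : Euc d))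
        (fun a => ((stdOrthonormalBasis ℝ M) a : Euc d)) i) := by
    rintro (i | i)
    · simp [coe_rotSub]
    · simp [coe_rotSub]
  simp only [this, inner_rot_rot]

lemma continuous_gramVol_map_rotLin (L M : Submodule ℝ (Euc d)) :
    Continuous fun ϑ : SOG d => gramVol L (M.map (rotLin ϑ)) := by
  have h : ∀ ϑ : SOG d, gramVol L (M.map (rotLin ϑ)) = _ := fun ϑ =>
    gramVol_eq L (M.map (rotLin ϑ)) (stdOrthonormalBasis ℝ L)
      ((stdOrthonormalBasis ℝ M).map (rotSub ϑ M))
  simp only [h]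
  refine Real.continuous_sqrt.comp (Continuous.matrix_det (continuous_matrix fun i j => ?_))
  have : ∀ i, Continuous fun ϑ : SOG d =>
      (Sum.elim (fun a => ((stdOrthonormalBasis ℝ L) a : Euc d)) (fun a =>
        (((stdOrthonormalBasis ℝ M).map (rotSub ϑ M)) a : Euc d)) i : Euc d) := by
    rintro (i | i)
    · exact continuous_const
    · simp only [Sum.elim_inr, OrthonormalBasis.map_apply]
      exact continuous_id.rot continuous_const
  exact (this i).inner (this j)

end GramVolume

section IntrinsicVolume

lemma IsFace.smul_mem {C F : Set (Euc d)} (hcone : ∀ r : ℝ, 0 ≤ r → ∀ x ∈ C, r • x ∈ C)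
    (hF : IsFace C F) {r : ℝ} (hr : 0 ≤ r) {x : Euc d} (hx : x ∈ F) : r • x ∈ F := by
  have hxC := hF.1.subset hx
  rcases lt_trichotomy r 1 with h | h | h
  · refine hF.1.left_mem_of_mem_openSegment (hcone r hr x hxC) (hcone 2 (by norm_num) x hxC) hx
      ⟨1 / (2 - r), (1 - r) / (2 - r), ?_, ?_, ?_, ?_⟩
    · exact div_pos one_pos (by linarith)
    · exact div_pos (by linarith) (by linarith)
    · rw [← add_div, div_eq_one_iff_eq (by linarith)]; ring
    · rw [smul_smul, smul_smul, ← add_smul]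
      convert one_smul ℝ x using 2
      have : (2 - r) ≠ 0 := by linarith
      field_simp
      ring
  · rwa [h, one_smul]
  · refine hF.1.left_mem_of_mem_openSegment (hcone r hr x hxC) (hcone 0 le_rfl x hxC) hx
      ⟨1 / r, 1 - 1 / r, by positivity, ?_, by ring, ?_⟩
    · rw [sub_pos, div_lt_one (by linarith)]; exact h
    · rw [smul_smul, zero_smul, smul_zero, add_zero, one_div, inv_mul_cancel₀ (by linarith),
        one_smul]

lemma exists_sub_of_mem_span {F : Set (Euc d)} (hconv : Convex ℝ F) (hne : F.Nonempty)
    (hcone : ∀ r : ℝ, 0 ≤ r → ∀ x ∈ F, r • x ∈ F) {x : Euc d} (hx : x ∈ Submodule.span ℝ F) :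
    ∃ a ∈ F, ∃ b ∈ F, x = a - b := by
  obtain ⟨z, hz⟩ := hne
  have h0 : (0 : Euc d) ∈ F := by simpa using hcone 0 le_rfl z hz
  have hadd : ∀ a ∈ F, ∀ b ∈ F, a + b ∈ F := by
    intro a ha b hb
    have := hcone 2 (by norm_num) _
      (hconv ha hb (a := 1 / 2) (b := 1 / 2) (by norm_num) (by norm_num) (by norm_num))
    rw [← smul_add, smul_smul] at this
    simpa using this
  induction hx using Submodule.span_induction with
  | mem x hx => exact ⟨x, hx, 0, h0, by simp⟩
  | zero => exact ⟨0, h0, 0, h0, by simp⟩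
  | add x y _ _ ihx ihy =>
    obtain ⟨a, ha, b, hb, rfl⟩ := ihx
    obtain ⟨a', ha', b', hb', rfl⟩ := ihy
    exact ⟨a + a', hadd _ ha _ ha', b + b', hadd _ hb _ hb', by abel⟩
  | smul r x _ ih =>
    obtain ⟨a, ha, b, hb, rfl⟩ := ih
    rcases le_total 0 r with hr | hr
    · exact ⟨r • a, hcone r hr a ha, r • b, hcone r hr b hb, smul_sub _ _ _⟩
    · refine ⟨(-r) • b, hcone _ (by linarith) b hb, (-r) • a, hcone _ (by linarith) a ha, ?_⟩
      module

/-- A face of full dimension of a convex cone is the whole cone. -/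
lemma IsFace.eq_of_dimS_eq {C F : Set (Euc d)} (hcone : ∀ r : ℝ, 0 ≤ r → ∀ x ∈ C, r • x ∈ C)
    (hF : IsFace C F) (hdim : dimS F = dimS C) : F = C := by
  refine hF.1.subset.antisymm fun x hx => ?_
  have hspan : Submodule.span ℝ F = Submodule.span ℝ C :=
    Submodule.eq_of_le_of_finrank_eq (Submodule.span_mono hF.1.subset) hdim
  have hxF : x ∈ Submodule.span ℝ F := hspan ▸ Submodule.subset_span hx
  obtain ⟨a, ha, b, hb, hab⟩ := exists_sub_of_mem_span hF.2.1 hF.2.2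
    (fun r hr y hy => hF.smul_mem hcone hr hy) hxF
  refine hF.1.left_mem_of_mem_openSegment hx (hF.1.subset hb)
    (hF.smul_mem hcone (r := 1 / 2) (by norm_num) ha)
    ⟨1 / 2, 1 / 2, by norm_num, by norm_num, by norm_num, ?_⟩
  rw [hab]
  module

lemma normalCone_self (C : Set (Euc d)) : normalCone C C = (↑(linHull C)ᗮ : Set (Euc d)) := by
  ext u
  rw [SetLike.mem_coe, linHull, Submodule.mem_orthogonal']
  constructor
  · rintro ⟨-, h⟩ v hv
    induction hv using Submodule.span_induction with
    | mem x hx => exact h x hx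
    | zero => simp
    | add x y _ _ ihx ihy => rw [inner_add_right, ihx, ihy, add_zero]
    | smul r x _ ih => rw [inner_smul_right, ih, mul_zero]
  · intro h
    have h' := fun x hx => h x (Submodule.subset_span hx)
    exact ⟨fun y hy => (h' y hy).le, h'⟩

lemma cV_dimS {C : Set (Euc d)} (hconv : Convex ℝ C) (hne : C.Nonempty)
    (hcone : ∀ r : ℝ, 0 ≤ r → ∀ x ∈ C, r • x ∈ C) :
    cV (dimS C) C = stdGauss d (C + (↑(linHull C)ᗮ : Set (Euc d))) := by
  have hC : IsFaceDim C C (dimS C) := ⟨⟨IsExtreme.rfl, hconv, hne⟩, rfl⟩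
  rw [← normalCone_self]
  refine tsum_eq_single (⟨C, hC⟩ : {F : Set (Euc d) // IsFaceDim C F (dimS C)}) fun F hF => ?_
  exact (hF (Subtype.ext (F.2.1.eq_of_dimS_eq hcone F.2.2))).elim

end IntrinsicVolume

section Measurability

lemma measurableSet_image_of_isClosed {X Y : Type*} [TopologicalSpace X] [SigmaCompactSpace X]
    [TopologicalSpace Y] [T2Space Y] [MeasurableSpace Y] [BorelSpace Y] {f : X → Y}
    (hf : Continuous f) {s : Set X} (hs : IsClosed s) : MeasurableSet (f '' s) := by
  have h : f '' s = ⋃ n, f '' (s ∩ compactCovering X n) := by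
    rw [← image_iUnion, ← inter_iUnion, iUnion_compactCovering, inter_univ]
  rw [h]
  exact MeasurableSet.iUnion fun n =>
    (((isCompact_compactCovering X n).inter_left hs).image hf).isClosed.measurableSet

lemma mem_sup_map_rotLin {L M : Submodule ℝ (Euc d)} {ϑ : SOG d} {z : Euc d} :
    z ∈ L ⊔ M.map (rotLin ϑ) ↔ ∃ x ∈ L, ∃ y ∈ M, x + rot ϑ y = z := by
  simp only [Submodule.mem_sup, Submodule.mem_map, exists_exists_and_eq_and]
  rfl

lemma mem_orthogonal_sup_map_rotLin {L M : Submodule ℝ (Euc d)} {ϑ : SOG d} {w : Euc d} :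
    w ∈ (L ⊔ M.map (rotLin ϑ))ᗮ ↔ (∀ x ∈ L, ⟪x, w⟫ = 0) ∧ ∀ y ∈ M, ⟪rot ϑ y, w⟫ = 0 := by
  rw [← Submodule.inf_orthogonal, Submodule.mem_inf, Submodule.mem_orthogonal,
    Submodule.mem_orthogonal]
  simp only [Submodule.mem_map, forall_exists_index, and_imp, forall_apply_eq_imp_iff₂]
  rfl

end Measurability

section GeneralPosition

lemma measurableSet_rot_mem_sup (L M : Submodule ℝ (Euc d)) (e : Euc d) :
    MeasurableSet {ϑ : SOG d | rot ϑ e ∈ L ⊔ M.map (rotLin ϑ)} := by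
  have hcl : IsClosed {z : SOG d × Euc d × Euc d |
      z.2.1 ∈ L ∧ z.2.2 ∈ M ∧ z.2.1 + rot z.1 z.2.2 = rot z.1 e} := by
    refine (L.closed_of_finiteDimensional.preimage (by fun_prop)).inter
      ((M.closed_of_finiteDimensional.preimage (by fun_prop)).inter (isClosed_eq ?_ ?_)) <;>
    fun_prop
  convert measurableSet_image_of_isClosed continuous_fst hcl using 1
  ext ϑ
  simp only [mem_image, Prod.exists, exists_and_right, exists_eq_right]
  exact mem_sup_map_rotLin.trans ⟨fun ⟨x, hx, y, hy, h⟩ => ⟨x, y, hx, hy, h⟩,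
    fun ⟨x, y, hx, hy, h⟩ => ⟨x, hx, y, hy, h⟩⟩

/-- A uniformly random rotation of a fixed vector almost surely avoids a moving subspace of
codimension at least one. -/
lemma measure_rot_mem_sup_eq_zero (ν : Measure (SOG d)) [IsProbabilityMeasure ν]
    [ν.IsMulRightInvariant] (L M : Submodule ℝ (Euc d)) {e : Euc d} (he : e ∈ Mᗮ) (he0 : e ≠ 0)
    (hdim : Module.finrank ℝ M + Module.finrank ℝ L < d) (hd : 2 ≤ d) :
    ν {ϑ : SOG d | rot ϑ e ∈ L ⊔ M.map (rotLin ϑ)} = 0 := by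
  set B := {ϑ : SOG d | rot ϑ e ∈ L ⊔ M.map (rotLin ϑ)} with hB
  have hBm : MeasurableSet B := measurableSet_rot_mem_sup L M e
  have hT : MeasurableSet {z : SOG d × stab Mᗮ | z.1 * (z.2 : SOG d) ∈ B} := by
    have : Continuous fun z : SOG d × stab Mᗮ => z.1 * (z.2 : SOG d) := by fun_prop
    exact this.measurable hBm
  have h1 : (ν.prod (stabHaar Mᗮ)) {z : SOG d × stab Mᗮ | z.1 * (z.2 : SOG d) ∈ B} = ν B := by
    rw [Measure.prod_apply_symm hT]
    have h : ∀ ρ : stab Mᗮ, ν {ϑ | ϑ * (ρ : SOG d) ∈ B} = ν B := fun ρ =>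
      measure_preimage_mul_right ν (ρ : SOG d) B
    refine (lintegral_congr h).trans ?_
    simp
  rw [← h1, Measure.prod_apply hT]
  have h : ∀ ϑ : SOG d, stabHaar Mᗮ {ρ | ϑ * (ρ : SOG d) ∈ B} = 0 := by
    intro ϑ
    set H : Submodule ℝ (Euc d) := L.map (rotLin ϑ⁻¹) ⊔ M with hH
    have hHne : H ≠ ⊤ := by
      intro htop
      have h1 := Submodule.finrank_add_le_finrank_add_finrank (L.map (rotLin ϑ⁻¹)) M
      rw [← hH, htop, finrank_top, finrank_map_rotLin, finrank_euclideanSpace_fin] at h1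
      omega
    have hstab : ∀ ρ : stab Mᗮ, ∀ y ∈ M, rot (ρ : SOG d) y ∈ M := by
      intro ρ y hy
      have h : rot (ρ : SOG d) y ∈ Mᗮᗮ := by
        intro w hw
        rw [← rot_rot_inv (ρ : SOG d) w, inner_rot_rot]
        exact (M.mem_orthogonal' _).1 (rot_inv_mem_of_stab ρ hw) y hy
      exact M.orthogonal_orthogonal.le h
    have hsub : {ρ : stab Mᗮ | ϑ * (ρ : SOG d) ∈ B} ⊆ {ρ | rot (ρ : SOG d) e ∈ H} := by
      intro ρ hρ
      obtain ⟨x, hx, y, hy, hxy⟩ := mem_sup_map_rotLin.1 hρ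
      refine Submodule.mem_sup.2 ⟨rot ϑ⁻¹ x, ⟨x, hx, rfl⟩, rot (ρ : SOG d) y, hstab ρ y hy, ?_⟩
      rw [← rot_inv_rot ϑ (rot (ρ : SOG d) e), ← rot_mul ϑ, ← hxy, rot_add, rot_mul ϑ, rot_inv_rot]
    refine measure_mono_null hsub ?_
    have := stabHaar_rot_mem hd Mᗮ (C := (H : Set (Euc d)))
      H.closed_of_finiteDimensional.measurableSet (fun r _ x hx => H.smul_mem r hx) he he0
    refine this.trans (measure_mono_null ?_ (stdGauss_submodule_eq_zero H hHne))
    intro x hx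
    have h1 : x - Mᗮ.starProjection x ∈ M := by
      have := Mᗮ.sub_starProjection_mem_orthogonal x
      rwa [M.orthogonal_orthogonal] at this
    have h2 : Mᗮ.starProjection x ∈ H := hx
    have := H.add_mem h2 ((le_sup_right : M ≤ H) h1)
    rwa [add_sub_cancel] at this
  refine (lintegral_congr h).trans ?_
  simp

/-- Two subspaces of total dimension less than `d` are almost surely independent after a random
rotation of one of them. -/
lemma measure_not_disjoint_map_rotLin (ν : Measure (SOG d)) [IsProbabilityMeasure ν]
    [ν.IsMulRightInvariant] (L : Submodule ℝ (Euc d)) (n : ℕ) :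
    ∀ M : Submodule ℝ (Euc d), Module.finrank ℝ M = n → n + Module.finrank ℝ L < d →
      ν {ϑ : SOG d | ¬ Disjoint L (M.map (rotLin ϑ))} = 0 := by
  induction n with
  | zero =>
    intro M hM _
    rw [Submodule.finrank_eq_zero] at hM
    simp [hM]
  | succ n ih =>
    intro M hM hdim
    have hMne : M ≠ ⊥ := by
      rintro rfl
      simp at hM
    obtain ⟨e, heM, he0⟩ := Submodule.exists_mem_ne_zero_of_ne_bot hMne
    set M' : Submodule ℝ (Euc d) := (ℝ ∙ e)ᗮ ⊓ M with hM'
    have heM' : e ∈ M'ᗮ := by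
      rw [Submodule.mem_orthogonal]
      intro u hu
      exact Submodule.mem_orthogonal_singleton_iff_inner_left.1 hu.1
    have hspan : (ℝ ∙ e) ≤ M := (Submodule.span_singleton_le_iff_mem e M).2 heM
    have hfin : Module.finrank ℝ M' = n := by
      have := Submodule.finrank_add_inf_finrank_orthogonal hspan
      rw [finrank_span_singleton he0, hM] at this
      rw [hM']
      omega
    have hsup : (ℝ ∙ e) ⊔ M' = M := Submodule.sup_orthogonal_inf_of_hasOrthogonalProjection hspan
    refine measure_mono_null (t := {ϑ : SOG d | ¬ Disjoint L (M'.map (rotLin ϑ))} ∪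
      {ϑ : SOG d | rot ϑ e ∈ L ⊔ M'.map (rotLin ϑ)}) ?_ (measure_union_null
        (ih M' hfin (by omega))
        (measure_rot_mem_sup_eq_zero ν L M' heM' he0 (by omega) (by omega)))
    intro ϑ hϑ
    by_contra hcon
    simp only [mem_union, not_or] at hcon
    obtain ⟨hdis, hnot⟩ := hcon
    replace hdis : Disjoint L (M'.map (rotLin ϑ)) := not_not.1 hdis
    refine hϑ (Submodule.disjoint_def.2 ?_)
    rintro _ hz ⟨y, hy, rfl⟩
    rw [← hsup] at hy
    obtain ⟨_, ha, m, hm, rfl⟩ := Submodule.mem_sup.1 hy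
    obtain ⟨a, rfl⟩ := Submodule.mem_span_singleton.1 ha
    have hz' : a • rot ϑ e + rot ϑ m ∈ L := by
      rw [← rot_smul, ← rot_add]; exact hz
    by_cases ha0 : a = 0
    · subst ha0
      rw [zero_smul, zero_add] at hz ⊢
      exact Submodule.disjoint_def.1 hdis _ hz ⟨m, hm, rfl⟩
    · refine absurd (mem_sup_map_rotLin.2 ⟨a⁻¹ • (a • rot ϑ e + rot ϑ m), L.smul_mem _ hz',
        -(a⁻¹ • m), M'.neg_mem (M'.smul_mem _ hm), ?_⟩) hnot
      rw [← neg_smul, rot_smul, smul_add, smul_smul, inv_mul_cancel₀ ha0]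
      module

end GeneralPosition

section PolyCone

variable {C : Set (Euc d)}

lemma IsPolyCone.isClosed (hC : IsPolyCone C) : IsClosed C := by
  obtain ⟨U, rfl⟩ := hC
  exact isClosed_biInter fun u _ => isClosed_le (by fun_prop) continuous_const

lemma IsPolyCone.convex (hC : IsPolyCone C) : Convex ℝ C := by
  obtain ⟨U, rfl⟩ := hC
  exact convex_iInter₂ fun u _ => convex_halfSpace_le (innerₗ (Euc d) u).isLinear 0

lemma IsPolyCone.zero_mem (hC : IsPolyCone C) : (0 : Euc d) ∈ C := by
  obtain ⟨U, rfl⟩ := hC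
  simp

lemma IsPolyCone.smul_mem (hC : IsPolyCone C) (r : ℝ) (hr : 0 ≤ r) (x : Euc d) (hx : x ∈ C) :
    r • x ∈ C := by
  obtain ⟨U, rfl⟩ := hC
  simp only [mem_iInter, mem_ofPred_eq, inner_smul_right] at hx ⊢
  exact fun u hu => mul_nonpos_of_nonneg_of_nonpos hr (hx u hu)

end PolyCone

section SumSet

/-- The cone `(C + ϑD) + L(C + ϑD)^⊥`. -/
def sumSet (C D : Set (Euc d)) (ϑ : SOG d) : Set (Euc d) :=
  {g | ∃ x ∈ C, ∃ y ∈ D, ∃ w ∈ (linHull C ⊔ (linHull D).map (rotLin ϑ))ᗮ, x + rot ϑ y + w = g}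

lemma measurableSet_sumSet_uncurry {C D : Set (Euc d)} (hC : IsClosed C) (hD : IsClosed D) :
    MeasurableSet {z : SOG d × Euc d | z.2 ∈ sumSet C D z.1} := by
  have hcl : IsClosed {z : SOG d × Euc d × Euc d × Euc d | z.2.1 ∈ C ∧ z.2.2.1 ∈ D ∧
      (∀ x ∈ linHull C, ⟪x, z.2.2.2⟫ = 0) ∧ ∀ y ∈ linHull D, ⟪rot z.1 y, z.2.2.2⟫ = 0} := by
    have h1 : IsClosed (⋂ x ∈ linHull C,
        {z : SOG d × Euc d × Euc d × Euc d | ⟪x, z.2.2.2⟫ = 0}) :=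
      isClosed_biInter fun x _ => isClosed_eq (by fun_prop) continuous_const
    have h2 : IsClosed (⋂ y ∈ linHull D,
        {z : SOG d × Euc d × Euc d × Euc d | ⟪rot z.1 y, z.2.2.2⟫ = 0}) :=
      isClosed_biInter fun x _ => isClosed_eq (by fun_prop) continuous_const
    have h3 : IsClosed {z : SOG d × Euc d × Euc d × Euc d | z.2.1 ∈ C ∧ z.2.2.1 ∈ D} :=
      (hC.preimage (by fun_prop)).inter (hD.preimage (by fun_prop))
    convert h3.inter (h1.inter h2) using 1
    ext z
    simp only [mem_inter_iff, mem_iInter, mem_ofPred_eq, and_assoc]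
  have hf : Continuous fun z : SOG d × Euc d × Euc d × Euc d =>
      (z.1, z.2.1 + rot z.1 z.2.2.1 + z.2.2.2) := by fun_prop
  convert measurableSet_image_of_isClosed hf hcl using 1
  ext ⟨ϑ, g⟩
  constructor
  · rintro ⟨x, hx, y, hy, w, hw, h⟩
    have hw' := mem_orthogonal_sup_map_rotLin.1 hw
    exact ⟨(ϑ, x, y, w), ⟨hx, hy, hw'.1, hw'.2⟩, Prod.ext rfl h⟩
  · rintro ⟨⟨ϑ', x, y, w⟩, ⟨hx, hy, hw⟩, h⟩
    obtain ⟨rfl, hg⟩ : ϑ' = ϑ ∧ x + rot ϑ' y + w = g := Prod.mk.inj h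
    exact ⟨x, hx, y, hy, w, mem_orthogonal_sup_map_rotLin.2 hw, hg⟩

lemma measurableSet_sumSet {C D : Set (Euc d)} (hC : IsClosed C) (hD : IsClosed D) (ϑ : SOG d) :
    MeasurableSet (sumSet C D ϑ) :=
  measurable_prodMk_left (measurableSet_sumSet_uncurry hC hD)

lemma measurable_stdGauss_sumSet {C D : Set (Euc d)} (hC : IsClosed C) (hD : IsClosed D) :
    Measurable fun ϑ => stdGauss d (sumSet C D ϑ) :=
  measurable_measure_prodMk_left (measurableSet_sumSet_uncurry hC hD)

/-- The oblique projections onto the summands `L` and `ϑM` of their direct sum. -/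
lemma exists_decomposition {L M : Submodule ℝ (Euc d)} {ϑ : SOG d}
    (h : Disjoint L (M.map (rotLin ϑ))) :
    ∃ p q : Euc d →ₗ[ℝ] Euc d, (∀ g, p g ∈ L) ∧ (∀ g, q g ∈ M) ∧
      (∀ g, g - p g - rot ϑ (q g) ∈ (L ⊔ M.map (rotLin ϑ))ᗮ) ∧
      ∀ x ∈ L, ∀ y ∈ M, ∀ w ∈ (L ⊔ M.map (rotLin ϑ))ᗮ,
        p (x + rot ϑ y + w) = x ∧ q (x + rot ϑ y + w) = y := by
  set W := (L ⊔ M.map (rotLin ϑ))ᗮ with hW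
  set Φ : (L × M × W) →ₗ[ℝ] Euc d :=
    L.subtype.coprod ((rotLin ϑ ∘ₗ M.subtype).coprod W.subtype) with hΦ
  have hΦa : ∀ z, Φ z = z.1 + rot ϑ z.2.1 + z.2.2 := fun z => (add_assoc _ _ _).symm
  have hinj : Function.Injective Φ := by
    refine (injective_iff_map_eq_zero Φ).2 ?_
    rintro ⟨⟨x, hx⟩, ⟨y, hy⟩, w, hw⟩ hz
    replace hz : x + rot ϑ y + w = 0 := (hΦa _).symm.trans hz
    have hs : x + rot ϑ y ∈ L ⊔ M.map (rotLin ϑ) := mem_sup_map_rotLin.2 ⟨x, hx, y, hy, rfl⟩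
    have hw0 : w = 0 := by
      have h1 : w ∈ L ⊔ M.map (rotLin ϑ) := by
        rw [eq_neg_of_add_eq_zero_right hz]
        exact Submodule.neg_mem _ hs
      exact Submodule.disjoint_def.1 (Submodule.orthogonal_disjoint _) w h1 hw
    subst hw0
    rw [add_zero] at hz
    have hx0 : x = 0 := by
      refine Submodule.disjoint_def.1 h x hx ?_
      rw [eq_neg_of_add_eq_zero_left hz]
      exact Submodule.neg_mem _ ⟨y, hy, rfl⟩
    subst hx0
    rw [zero_add] at hz
    have hy0 : y = 0 := by rw [← rot_inv_rot ϑ y, hz, rot_zero]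
    subst hy0
    rfl
  have hsurj : Function.Surjective Φ := by
    intro g
    obtain ⟨s, hs, w, hw, rfl⟩ := (L ⊔ M.map (rotLin ϑ)).exists_add_mem_mem_orthogonal g
    obtain ⟨x, hx, y, hy, rfl⟩ := mem_sup_map_rotLin.1 hs
    exact ⟨(⟨x, hx⟩, ⟨y, hy⟩, ⟨w, hw⟩), hΦa _⟩
  set e := LinearEquiv.ofBijective Φ ⟨hinj, hsurj⟩ with he
  refine ⟨L.subtype ∘ₗ LinearMap.fst ℝ L (M × W) ∘ₗ e.symm,
    M.subtype ∘ₗ LinearMap.fst ℝ M W ∘ₗ LinearMap.snd ℝ L (M × W) ∘ₗ e.symm,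
    fun g => (e.symm g).1.2, fun g => (e.symm g).2.1.2, fun g => ?_, ?_⟩
  · have hg : ((e.symm g).1 : Euc d) + rot ϑ (e.symm g).2.1 + (e.symm g).2.2 = g :=
      (hΦa _).symm.trans (e.apply_symm_apply g)
    change g - ((e.symm g).1 : Euc d) - rot ϑ (e.symm g).2.1 ∈ W
    have : g - ((e.symm g).1 : Euc d) - rot ϑ (e.symm g).2.1 = (e.symm g).2.2 := by
      nth_rewrite 1 [← hg]
      abel
    rw [this]
    exact (e.symm g).2.2.2
  · intro x hx y hy w hw
    have : e.symm (x + rot ϑ y + w) = (⟨x, hx⟩, ⟨y, hy⟩, ⟨w, hw⟩) := by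
      rw [LinearEquiv.symm_apply_eq]
      exact (hΦa (⟨x, hx⟩, ⟨y, hy⟩, ⟨w, hw⟩)).symm
    change ((e.symm (x + rot ϑ y + w)).1 : Euc d) = x ∧
      ((e.symm (x + rot ϑ y + w)).2.1 : Euc d) = y
    rw [this]
    exact ⟨rfl, rfl⟩

end SumSet

section Averaging

lemma ae_stabHaar_rot_mem {K : Submodule ℝ (Euc d)} (hd : K ≠ ⊥ → 2 ≤ d) {C : Set (Euc d)}
    (hC : MeasurableSet C) (hcone : ∀ r : ℝ, 0 < r → ∀ x ∈ C, r • x ∈ C) (h0 : (0 : Euc d) ∈ C)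
    (p : Euc d →ₗ[ℝ] Euc d) (hpK : ∀ g, p g ∈ K) (hps : ∀ x ∈ K, ∃ g, p g = x) :
    ∀ᵐ g ∂stdGauss d, stabHaar K {ρ | rot (ρ : SOG d) (p g) ∈ C}
      = stdGauss d {x | K.starProjection x ∈ C} := by
  by_cases hK : K = ⊥
  · subst hK
    refine Filter.Eventually.of_forall fun g => ?_
    have h1 : {ρ : stab (⊥ : Submodule ℝ (Euc d)) | rot (ρ : SOG d) (p g) ∈ C} = univ := by
      ext ρ
      simp [(Submodule.mem_bot ℝ).1 (hpK g), rot_zero, h0]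
    have h2 : {x : Euc d | (⊥ : Submodule ℝ (Euc d)).starProjection x ∈ C} = univ := by
      ext x
      simp [h0]
    rw [h1, h2, measure_univ, measure_univ]
  · have hker : p.ker ≠ ⊤ := by
      intro h
      obtain ⟨x, hx, hx0⟩ := Submodule.exists_mem_ne_zero_of_ne_bot hK
      obtain ⟨g, rfl⟩ := hps x hx
      exact hx0 (LinearMap.congr_fun (LinearMap.ker_eq_top.1 h) g)
    refine measure_mono_null (fun g hg => ?_) (stdGauss_submodule_eq_zero p.ker hker)
    by_contra hne
    exact hg (stabHaar_rot_mem (hd hK) K hC hcone (hpK g) hne)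

lemma add_orthogonal_eq_preimage_starProjection {C : Set (Euc d)} {L : Submodule ℝ (Euc d)}
    (hCL : C ⊆ L) : C + (↑Lᗮ : Set (Euc d)) = {x | L.starProjection x ∈ C} := by
  ext g
  constructor
  · rintro ⟨x, hx, w, hw, rfl⟩
    have : L.starProjection (x + w) = x := by
      rw [map_add, Submodule.starProjection_eq_self_iff.2 (hCL hx),
        (Submodule.starProjection_apply_eq_zero_iff L).2 hw, add_zero]
    change L.starProjection (x + w) ∈ C
    rwa [this]
  · intro hg
    exact ⟨L.starProjection g, hg, g - L.starProjection g,
      L.sub_starProjection_mem_orthogonal g, add_sub_cancel _ _⟩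

lemma map_rotLin_stab_mul_mul_inv {L M : Submodule ℝ (Euc d)} (ϑ : SOG d) (ρ : stab L)
    (σ : stab M) : M.map (rotLin ((ρ : SOG d) * ϑ * (σ : SOG d)⁻¹))
      = (M.map (rotLin ϑ)).map (rotLin (ρ : SOG d)) := by
  have h : M.map (rotLin (σ : SOG d)⁻¹) = M := map_rotLin_stab σ⁻¹
  rw [map_rotLin_mul, map_rotLin_mul, h]

lemma rot_mem_orthogonal_map {W : Submodule ℝ (Euc d)} (ϑ : SOG d) {w : Euc d} :
    rot ϑ w ∈ (W.map (rotLin ϑ))ᗮ ↔ w ∈ Wᗮ := by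
  rw [Submodule.mem_orthogonal, Submodule.mem_orthogonal]
  constructor
  · intro h u hu
    rw [← inner_rot_rot ϑ]
    exact h _ ⟨u, hu, rfl⟩
  · rintro h _ ⟨u, hu, rfl⟩
    exact (inner_rot_rot ϑ u w).trans (h u hu)

lemma subset_linHull (C : Set (Euc d)) : C ⊆ (linHull C : Set (Euc d)) := Submodule.subset_span

lemma rot_mem_sumSet {C D : Set (Euc d)} {ϑ : SOG d} (ρ : stab (linHull C)) (σ : stab (linHull D))
    {p q : Euc d →ₗ[ℝ] Euc d}
    (hw : ∀ g, g - p g - rot ϑ (q g) ∈ (linHull C ⊔ (linHull D).map (rotLin ϑ))ᗮ)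
    (hpq : ∀ x ∈ linHull C, ∀ y ∈ linHull D, ∀ w ∈ (linHull C ⊔ (linHull D).map (rotLin ϑ))ᗮ,
      p (x + rot ϑ y + w) = x ∧ q (x + rot ϑ y + w) = y) (g : Euc d) :
    rot (ρ : SOG d) g ∈ sumSet C D ((ρ : SOG d) * ϑ * (σ : SOG d)⁻¹) ↔
      rot (ρ : SOG d) (p g) ∈ C ∧ rot (σ : SOG d) (q g) ∈ D := by
  have hsup : linHull C ⊔ (linHull D).map (rotLin ((ρ : SOG d) * ϑ * (σ : SOG d)⁻¹))
      = (linHull C ⊔ (linHull D).map (rotLin ϑ)).map (rotLin (ρ : SOG d)) := by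
    rw [map_rotLin_stab_mul_mul_inv, Submodule.map_sup, map_rotLin_stab]
  constructor
  · rintro ⟨x, hx, y, hy, w, hw', hg⟩
    have hg' : rot (ρ : SOG d)⁻¹ x + rot ϑ (rot (σ : SOG d)⁻¹ y) + rot (ρ : SOG d)⁻¹ w = g := by
      rw [← rot_inv_rot (ρ : SOG d) g, ← hg, rot_add, rot_add, mul_assoc, rot_mul, rot_inv_rot,
        rot_mul]
    rw [hsup, ← rot_rot_inv (ρ : SOG d) w, rot_mem_orthogonal_map] at hw'
    obtain ⟨h1, h2⟩ := hpq _ (rot_inv_mem_of_stab ρ (subset_linHull C hx)) _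
      (rot_inv_mem_of_stab σ (subset_linHull D hy)) _ hw'
    rw [hg'] at h1 h2
    rw [h1, h2, rot_rot_inv, rot_rot_inv]
    exact ⟨hx, hy⟩
  · rintro ⟨hx, hy⟩
    refine ⟨_, hx, _, hy, rot (ρ : SOG d) (g - p g - rot ϑ (q g)), ?_, ?_⟩
    · rw [hsup, rot_mem_orthogonal_map]
      exact hw g
    · rw [mul_assoc, rot_mul, rot_mul, rot_inv_rot, ← rot_add, ← rot_add]
      congr 1
      abel

/-- Averaging the Gaussian measure of `C + ϑD + L(C + ϑD)^⊥` over independent rotations of `C`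
within `L(C)` and of `D` within `L(D)`. -/
lemma lintegral_stdGauss_sumSet {C D : Set (Euc d)} (hC : IsClosed C) (hD : IsClosed D)
    (hcC : ∀ r : ℝ, 0 < r → ∀ x ∈ C, r • x ∈ C) (hcD : ∀ r : ℝ, 0 < r → ∀ x ∈ D, r • x ∈ D)
    (h0C : (0 : Euc d) ∈ C) (h0D : (0 : Euc d) ∈ D) (hdC : linHull C ≠ ⊥ → 2 ≤ d)
    (hdD : linHull D ≠ ⊥ → 2 ≤ d) {ϑ : SOG d}
    (h : Disjoint (linHull C) ((linHull D).map (rotLin ϑ))) :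
    ∫⁻ z : stab (linHull C) × stab (linHull D),
        stdGauss d (sumSet C D ((z.1 : SOG d) * ϑ * (z.2 : SOG d)⁻¹))
        ∂(stabHaar (linHull C)).prod (stabHaar (linHull D))
      = stdGauss d (C + (↑(linHull C)ᗮ : Set (Euc d))) *
        stdGauss d (D + (↑(linHull D)ᗮ : Set (Euc d))) := by
  obtain ⟨p, q, hp, hq, hw, hpq⟩ := exists_decomposition h
  have hpc : Continuous p := p.continuous_of_finiteDimensional
  have hqc : Continuous q := q.continuous_of_finiteDimensional
  have hT : MeasurableSet {z : (stab (linHull C) × stab (linHull D)) × Euc d |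
      rot (z.1.1 : SOG d) (p z.2) ∈ C ∧ rot (z.1.2 : SOG d) (q z.2) ∈ D} := by
    refine MeasurableSet.inter (IsClosed.measurableSet (hC.preimage ?_))
      (IsClosed.measurableSet (hD.preimage ?_)) <;> fun_prop
  have h1 : ∀ z : stab (linHull C) × stab (linHull D),
      stdGauss d (sumSet C D ((z.1 : SOG d) * ϑ * (z.2 : SOG d)⁻¹)) =
        stdGauss d {g | rot (z.1 : SOG d) (p g) ∈ C ∧ rot (z.2 : SOG d) (q g) ∈ D} := by
    intro z
    rw [← (measurePreserving_rot (z.1 : SOG d)).measure_preimage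
      (measurableSet_sumSet hC hD _).nullMeasurableSet]
    congr 1
    ext g
    exact rot_mem_sumSet z.1 z.2 hw hpq g
  have h2 : ∀ᵐ g ∂stdGauss d, ((stabHaar (linHull C)).prod (stabHaar (linHull D)))
      {z | rot (z.1 : SOG d) (p g) ∈ C ∧ rot (z.2 : SOG d) (q g) ∈ D}
      = stdGauss d (C + (↑(linHull C)ᗮ : Set (Euc d))) *
        stdGauss d (D + (↑(linHull D)ᗮ : Set (Euc d))) := by
    have hps : ∀ x ∈ linHull C, ∃ g, p g = x := fun x hx =>
      ⟨x + rot ϑ 0 + 0, (hpq x hx 0 (zero_mem _) 0 (zero_mem _)).1⟩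
    have hqs : ∀ y ∈ linHull D, ∃ g, q g = y := fun y hy =>
      ⟨0 + rot ϑ y + 0, (hpq 0 (zero_mem _) y hy 0 (zero_mem _)).2⟩
    filter_upwards [ae_stabHaar_rot_mem hdC hC.measurableSet hcC h0C p hp hps,
      ae_stabHaar_rot_mem hdD hD.measurableSet hcD h0D q hq hqs] with g hgC hgD
    rw [add_orthogonal_eq_preimage_starProjection (subset_linHull C),
      add_orthogonal_eq_preimage_starProjection (subset_linHull D), ← hgC, ← hgD,
      ← Measure.prod_prod]
    rfl
  refine (lintegral_congr h1).trans ((Measure.prod_apply hT).symm.trans ?_)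
  rw [Measure.prod_apply_symm hT]
  refine (lintegral_congr_ae h2).trans ?_
  simp

end Averaging

section Sum

lemma linHull_rot_image (ϑ : SOG d) (D : Set (Euc d)) :
    linHull (rot ϑ '' D) = (linHull D).map (rotLin ϑ) :=
  (Submodule.map_span (rotLin ϑ) D).symm

lemma linHull_add_rot_image {C D : Set (Euc d)} (h0C : (0 : Euc d) ∈ C) (h0D : (0 : Euc d) ∈ D)
    (ϑ : SOG d) : linHull (C + rot ϑ '' D) = linHull C ⊔ (linHull D).map (rotLin ϑ) := by
  rw [← linHull_rot_image]
  apply le_antisymm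
  · refine Submodule.span_le.2 ?_
    rintro _ ⟨x, hx, y, hy, rfl⟩
    exact Submodule.add_mem_sup (subset_linHull C hx) (subset_linHull _ hy)
  · refine sup_le (Submodule.span_mono fun x hx => ?_) (Submodule.span_mono fun y hy => ?_)
    · exact ⟨x, hx, 0, ⟨0, h0D, rot_zero ϑ⟩, add_zero x⟩
    · exact ⟨0, h0C, y, hy, zero_add y⟩

lemma dimS_add_rot_image {C D : Set (Euc d)} (h0C : (0 : Euc d) ∈ C) (h0D : (0 : Euc d) ∈ D)
    {ϑ : SOG d} (h : Disjoint (linHull C) ((linHull D).map (rotLin ϑ))) :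
    dimS (C + rot ϑ '' D) = dimS C + dimS D := by
  have := Submodule.finrank_sup_add_finrank_inf_eq (linHull C) ((linHull D).map (rotLin ϑ))
  rwa [h.eq_bot, finrank_bot, add_zero, finrank_map_rotLin,
    ← linHull_add_rot_image h0C h0D] at this

lemma cV_add_rot_image {C D : Set (Euc d)} (hC : IsPolyCone C) (hD : IsPolyCone D) {ϑ : SOG d}
    (h : Disjoint (linHull C) ((linHull D).map (rotLin ϑ))) :
    cV (dimS C + dimS D) (C + rot ϑ '' D) = stdGauss d (sumSet C D ϑ) := by
  have hconv : Convex ℝ (C + rot ϑ '' D) := hC.convex.add (hD.convex.linear_image (rotLin ϑ))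
  have hne : (C + rot ϑ '' D).Nonempty :=
    ⟨_, add_mem_add hC.zero_mem (mem_image_of_mem (rot ϑ) hD.zero_mem)⟩
  have hcone : ∀ r : ℝ, 0 ≤ r → ∀ z ∈ C + rot ϑ '' D, r • z ∈ C + rot ϑ '' D := by
    rintro r hr _ ⟨x, hx, _, ⟨y, hy, rfl⟩, rfl⟩
    exact ⟨r • x, hC.smul_mem r hr x hx, r • rot ϑ y,
      ⟨r • y, hD.smul_mem r hr y hy, rot_smul ϑ r y⟩, (smul_add r x (rot ϑ y)).symm⟩
  rw [← dimS_add_rot_image hC.zero_mem hD.zero_mem h, cV_dimS hconv hne hcone,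
    linHull_add_rot_image hC.zero_mem hD.zero_mem]
  congr 1
  ext g
  constructor
  · rintro ⟨_, ⟨x, hx, _, ⟨y, hy, rfl⟩, rfl⟩, w, hw, rfl⟩
    exact ⟨x, hx, y, hy, w, hw, rfl⟩
  · rintro ⟨x, hx, y, hy, w, hw, rfl⟩
    exact ⟨_, ⟨x, hx, _, ⟨y, hy, rfl⟩, rfl⟩, w, hw, rfl⟩

lemma IsPolyCone.cV_dimS {C : Set (Euc d)} (hC : IsPolyCone C) :
    cV (dimS C) C = stdGauss d (C + (↑(linHull C)ᗮ : Set (Euc d))) :=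
  _root_.cV_dimS hC.convex ⟨0, hC.zero_mem⟩ hC.smul_mem

lemma genSineC_rot_image {C D : Set (Euc d)} (h : dimS C + dimS D ≤ d) (ϑ : SOG d) :
    genSineC C (rot ϑ '' D) = gramVol (linHull C) ((linHull D).map (rotLin ϑ)) := by
  rw [genSineC, linHull_rot_image, genSine, if_pos]
  rwa [finrank_map_rotLin]

lemma gramVol_stab_mul_mul_inv {L M : Submodule ℝ (Euc d)} (ϑ : SOG d) (ρ : stab L)
    (σ : stab M) : gramVol L (M.map (rotLin ((ρ : SOG d) * ϑ * (σ : SOG d)⁻¹)))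
      = gramVol L (M.map (rotLin ϑ)) := by
  rw [map_rotLin_stab_mul_mul_inv, ← gramVol_map_rotLin (ρ : SOG d) L (M.map (rotLin ϑ)),
    map_rotLin_stab]

end Sum

/-- Replacing one factor of an integral over `SO(d)` by its averages over double cosets leaving
the other factor invariant. -/
lemma integral_mul_eq_of_average (ν : Measure (SOG d)) [IsProbabilityMeasure ν]
    [ν.IsMulLeftInvariant] [ν.IsMulRightInvariant] (L M : Submodule ℝ (Euc d)) {u F : SOG d → ℝ}
    (hu : Measurable u) (hF : Measurable F) {a b : ℝ} (hua : ∀ ϑ, |u ϑ| ≤ a)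
    (hFb : ∀ ϑ, |F ϑ| ≤ b)
    (hinv : ∀ (ϑ : SOG d) (ρ : stab L) (σ : stab M),
      F ((ρ : SOG d) * ϑ * (σ : SOG d)⁻¹) = F ϑ) {c : ℝ}
    (havg : ∀ᵐ ϑ ∂ν, ∫ z : stab L × stab M, u ((z.1 : SOG d) * ϑ * (z.2 : SOG d)⁻¹)
      ∂(stabHaar L).prod (stabHaar M) = c) :
    ∫ ϑ, u ϑ * F ϑ ∂ν = c * ∫ ϑ, F ϑ ∂ν := by
  have h1 : ∀ z : stab L × stab M,
      ∫ ϑ, u ((z.1 : SOG d) * ϑ * (z.2 : SOG d)⁻¹) * F ϑ ∂ν = ∫ ϑ, u ϑ * F ϑ ∂ν := by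
    intro z
    have h2 := integral_mul_left_eq_self (μ := ν)
      (fun ϑ => u (ϑ * (z.2 : SOG d)⁻¹) * F (ϑ * (z.2 : SOG d)⁻¹)) (z.1 : SOG d)
    have h3 := integral_mul_right_eq_self (μ := ν) (fun ϑ => u ϑ * F ϑ) (z.2 : SOG d)⁻¹
    simp only [hinv] at h2
    exact h2.trans h3
  have hcont : Continuous fun w : (stab L × stab M) × SOG d =>
      (w.1.1 : SOG d) * w.2 * (w.1.2 : SOG d)⁻¹ := by fun_prop
  have hI : Integrable (Function.uncurry fun (z : stab L × stab M) (ϑ : SOG d) =>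
      u ((z.1 : SOG d) * ϑ * (z.2 : SOG d)⁻¹) * F ϑ)
      (((stabHaar L).prod (stabHaar M)).prod ν) := by
    refine Integrable.of_bound (C := a * b) (Measurable.aestronglyMeasurable
      ((hu.comp hcont.measurable).mul (hF.comp measurable_snd)))
      (Filter.Eventually.of_forall fun w => ?_)
    rw [Function.uncurry, Real.norm_eq_abs, abs_mul]
    exact mul_le_mul (hua _) (hFb _) (abs_nonneg _) ((abs_nonneg _).trans (hua w.2))
  calc ∫ ϑ, u ϑ * F ϑ ∂ν
      = ∫ z, ∫ ϑ, u ((z.1 : SOG d) * ϑ * (z.2 : SOG d)⁻¹) * F ϑ ∂ν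
          ∂(stabHaar L).prod (stabHaar M) := by
        rw [integral_congr_ae (Filter.Eventually.of_forall h1)]
        simp
    _ = ∫ ϑ, ∫ z, u ((z.1 : SOG d) * ϑ * (z.2 : SOG d)⁻¹) * F ϑ
          ∂(stabHaar L).prod (stabHaar M) ∂ν := integral_integral_swap hI
    _ = ∫ ϑ, c * F ϑ ∂ν := by
        refine integral_congr_ae ?_
        filter_upwards [havg] with ϑ hϑ
        rw [integral_mul_const, hϑ]
    _ = c * ∫ ϑ, F ϑ ∂ν := integral_const_mul _ _

end

/-- **Theorem 4.2.** For polyhedral cones `C, D ⊆ ℝ^d` with `dim C = i`, `dim D = j`,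
`i + j = d − k < d`, and a bounded measurable function `f`,
`∫_{SO(d)} V_{d−k}(C + ϑD) f([C,ϑD]) ν(dϑ) = c_{ij}(f) V_i(C) V_j(D)`,
where `c_{ij}(f) = ∫_{SO(d)} f([C,ϑD]) ν(dϑ)` and `+` is the Minkowski sum. -/
theorem kinematic_formula_sum_low_degree {d : ℕ} (C D : Set (Euc d))
    (hC : IsPolyCone C) (hD : IsPolyCone D)
    (i j k : ℕ) (hi : dimS C = i) (hj : dimS D = j) (hijk : i + j + k = d) (hk : 0 < k)
    (f : ℝ → ℝ) (hf : Measurable f) (hfb : ∃ M : ℝ, ∀ x, |f x| ≤ M)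
    (ν : Measure (SOG d)) [ν.IsHaarMeasure] [IsProbabilityMeasure ν] :
    ∫ ϑ, (cV (d - k) (C + rot ϑ '' D)).toReal * f (genSineC C (rot ϑ '' D)) ∂ν
      = (∫ ϑ, f (genSineC C (rot ϑ '' D)) ∂ν) * (cV i C).toReal * (cV j D).toReal := by
  have : ν.IsMulRightInvariant := isMulRightInvariant_of_compact ν
  obtain ⟨B, hB⟩ := hfb
  subst hi hj
  have hdk : d - k = dimS C + dimS D := by omega
  have hdC : linHull C ≠ ⊥ → 2 ≤ d := fun h => by
    have : dimS C ≠ 0 := fun h0 => h (Submodule.finrank_eq_zero.1 h0)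
    omega
  have hdD : linHull D ≠ ⊥ → 2 ≤ d := fun h => by
    have : dimS D ≠ 0 := fun h0 => h (Submodule.finrank_eq_zero.1 h0)
    omega
  have hdis : ∀ᵐ ϑ ∂ν, Disjoint (linHull C) ((linHull D).map (rotLin ϑ)) :=
    measure_not_disjoint_map_rotLin ν (linHull C) (dimS D) (linHull D) rfl
      (by change dimS D + dimS C < d; omega)
  simp only [genSineC_rot_image (show dimS C + dimS D ≤ d by omega)]
  have hmeas : Measurable fun ϑ => stdGauss d (sumSet C D ϑ) :=
    measurable_stdGauss_sumSet hC.isClosed hD.isClosed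
  have hLHS : ∫ ϑ, (cV (d - k) (C + rot ϑ '' D)).toReal *
        f (gramVol (linHull C) ((linHull D).map (rotLin ϑ))) ∂ν
      = ∫ ϑ, (stdGauss d (sumSet C D ϑ)).toReal *
        f (gramVol (linHull C) ((linHull D).map (rotLin ϑ))) ∂ν := by
    refine integral_congr_ae ?_
    filter_upwards [hdis] with ϑ hϑ
    rw [hdk, cV_add_rot_image hC hD hϑ]
  rw [hLHS, integral_mul_eq_of_average ν (linHull C) (linHull D)
    (F := fun ϑ => f (gramVol (linHull C) ((linHull D).map (rotLin ϑ)))) (a := 1) (b := B)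
    (c := (cV (dimS C) C).toReal * (cV (dimS D) D).toReal) hmeas.ennreal_toReal
    (hf.comp (continuous_gramVol_map_rotLin _ _).measurable) (fun ϑ => ?_) (fun ϑ => hB _)
    (fun ϑ ρ σ => congrArg f (gramVol_stab_mul_mul_inv ϑ ρ σ)) ?_]
  · ring
  · filter_upwards [hdis] with ϑ hϑ
    have hcont : Continuous fun z : stab (linHull C) × stab (linHull D) =>
        (z.1 : SOG d) * ϑ * (z.2 : SOG d)⁻¹ := by fun_prop
    have hmeas' : Measurable fun z : stab (linHull C) × stab (linHull D) =>
        stdGauss d (sumSet C D ((z.1 : SOG d) * ϑ * (z.2 : SOG d)⁻¹)) :=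
      hmeas.comp hcont.measurable
    rw [integral_toReal hmeas'.aemeasurable
      (Filter.Eventually.of_forall fun z => measure_lt_top _ _),
      lintegral_stdGauss_sumSet hC.isClosed hD.isClosed (fun r hr => hC.smul_mem r hr.le)
        (fun r hr => hD.smul_mem r hr.le) hC.zero_mem hD.zero_mem hdC hdD hϑ,
      ENNReal.toReal_mul, hC.cV_dimS, hD.cV_dimS]
  · rw [abs_of_nonneg ENNReal.toReal_nonneg]
    exact ENNReal.toReal_le_of_le_ofReal zero_le_one (by simpa using prob_le_one)
end
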